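/- There exists ρ > 0 with the following property. Let m ≥ 0, n ≥ 1 and let b̂ ∈ (1,2] satisfy log b̂ ∈ (2^{−m−1} log 2, 2^{−m} log 2), and suppose the turning point 0 is periodic under T_{b̂} with minimal period 2^m n (i.e. T_{b̂}^{2^m n}(0) = 0 and T_{b̂}^j(0) ≠ 0 for 1 ≤ j < 2^m n). Then the set h^{-1}({log b̂}) ⊆ [-2, 1/4] is an interval of diameter at least exp(−(n+m)ρ). -/

import Mathlib

open Filter Set MeasureTheory

/-- The quadratic family `f_a(x) = x² + a`. -/
noncomputable def fa (a : ℝ) : ℝ → ℝ := fun x => x ^ 2 + a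

/-- The invariant interval `I_a`. -/
noncomputable def Ia (a : ℝ) : Set ℝ :=
  Set.Icc ((-1 - Real.sqrt (1 - 4 * a)) / 2) ((1 + Real.sqrt (1 - 4 * a)) / 2)

/-- Topological entropy of `f_a` restricted to `I_a`. -/
noncomputable def h (a : ℝ) : ℝ := (Dynamics.coverEntropy (fa a) (Ia a)).toReal

/-- The tent map `T_b(x) = 1 − b|x|`. -/
noncomputable def tent (b : ℝ) : ℝ → ℝ := fun x => 1 - b * |x|

open scoped Topology

/-! ### Transversality of periodic critical orbits -/

lemma sq_add_injOn_upper (c : ℂ) : InjOn (fun z : ℂ => z ^ 2 + c) {z | 0 < z.im} := by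
  intro z hz w hw hzw
  simp only [mem_ofPred_eq] at hz hw
  have h1 : z ^ 2 = w ^ 2 := by simpa using hzw
  rcases sq_eq_sq_iff_eq_or_eq_neg.1 h1 with h2 | h2
  · exact h2
  · rw [h2, Complex.neg_im] at hz
    linarith

lemma compl_image_upper_subset (c : ℝ) :
    ((fun z : ℂ => z ^ 2 + c) '' {z | 0 < z.im})ᶜ ⊆ {z : ℂ | z.im = 0} := by
  intro w hw
  by_contra hne
  apply hw
  obtain ⟨z, hz⟩ := IsAlgClosed.exists_pow_nat_eq (w - c) (n := 2) two_pos
  have him : z.im ≠ 0 := by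
    intro h0
    apply hne
    have : w = z ^ 2 + c := by rw [hz]; ring
    rw [mem_ofPred_eq, this]
    simp [sq, h0]
  rcases lt_or_gt_of_ne him with h0 | h0
  · exact ⟨-z, by simpa using h0, by simp [hz]⟩
  · exact ⟨z, h0, by simp [hz]⟩

lemma volume_im_eq_zero : volume {z : ℂ | z.im = 0} = 0 := by
  have h1 : {z : ℂ | z.im = 0} = (LinearMap.ker Complex.imLm : Set ℂ) := by
    ext z; simp
  rw [h1]
  apply Measure.addHaar_submodule
  intro h2
  have : Complex.I ∈ LinearMap.ker Complex.imLm := by rw [h2]; trivial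
  simp at this

/-- Push-forward inequality for quadratic differentials under `z ↦ z² + c`. -/
lemma lintegral_le_of_pushforward {φ : ℂ → ℂ} (hm : Measurable φ) (c : ℝ)
    (hφ : ∀ z : ℂ, 0 < z.im → 4 * ‖z‖ ^ 2 * ‖φ (z ^ 2 + c)‖ ≤ ‖φ z‖ + ‖φ (-z)‖)
    {s : Set ℂ} (hs : MeasurableSet s) :
    ∫⁻ z in s, ‖φ z‖ₑ ≤ ∫⁻ z in (fun z : ℂ => z ^ 2 + c) ⁻¹' s, ‖φ z‖ₑ := by
  set g : ℂ → ℂ := fun z => z ^ 2 + c with hg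
  have hgm : Measurable g := by fun_prop
  set U : Set ℂ := {z | 0 < z.im} with hU
  have hUm : MeasurableSet U := measurableSet_lt measurable_const Complex.measurable_im
  set V : Set ℂ := g ⁻¹' s with hV
  have hVm : MeasurableSet V := hgm hs
  have hUV : MeasurableSet (U ∩ V) := hUm.inter hVm
  have hinj : InjOn g (U ∩ V) := (sq_add_injOn_upper c).mono inter_subset_left
  let g' : ℂ → ℂ →L[ℝ] ℂ := fun z =>
    (ContinuousLinearMap.toSpanSingleton ℂ (2 * z)).restrictScalars ℝ
  have hder : ∀ z ∈ U ∩ V, HasFDerivWithinAt g (g' z) (U ∩ V) z := by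
    intro z _
    have h1 : HasDerivAt g (2 * z) z := by
      simpa [hg] using (hasDerivAt_pow 2 z).add_const (c : ℂ)
    exact (h1.hasFDerivAt.restrictScalars ℝ).hasFDerivWithinAt
  have hdet : ∀ z, |(g' z).det| = 4 * ‖z‖ ^ 2 := by
    intro z
    have h1 : (g' z).det = Complex.normSq (2 * z) := by
      rw [← Algebra.norm_complex_apply, Algebra.norm_apply]
      rw [ContinuousLinearMap.det]
      congr 1
      ext w; all_goals simp [g', mul_comm]
    rw [h1, Complex.normSq_eq_norm_sq, norm_mul, abs_of_nonneg (by positivity)]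
    norm_num [mul_pow]
  have hcov := lintegral_image_eq_lintegral_abs_det_fderiv_mul volume hUV hder hinj
    (fun z => ‖φ z‖ₑ)
  have hae : (s : Set ℂ) ≤ᵐ[volume] (g '' (U ∩ V)) := by
    have h0 : ∀ᵐ z : ℂ, z.im ≠ 0 := by
      rw [ae_iff]; simpa using volume_im_eq_zero
    filter_upwards [h0] with z hz hzs
    have : z ∈ g '' U := by
      by_contra hcon
      exact hz (compl_image_upper_subset c hcon)
    obtain ⟨w, hw, rfl⟩ := this
    exact ⟨w, ⟨hw, hzs⟩, rfl⟩
  have hneg : MeasurePreserving (Neg.neg : ℂ → ℂ) volume volume :=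
    Measure.measurePreserving_neg volume
  have hUV' : MeasurableSet ((Neg.neg : ℂ → ℂ) ⁻¹' (U ∩ V)) := measurable_neg hUV
  calc ∫⁻ z in s, ‖φ z‖ₑ ≤ ∫⁻ z in g '' (U ∩ V), ‖φ z‖ₑ :=
        lintegral_mono' (Measure.restrict_mono' hae le_rfl) le_rfl
    _ = ∫⁻ z in U ∩ V, ENNReal.ofReal |(g' z).det| * ‖φ (g z)‖ₑ := hcov
    _ ≤ ∫⁻ z in U ∩ V, (‖φ z‖ₑ + ‖φ (-z)‖ₑ) := by
        apply setLIntegral_mono' hUV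
        intro z hz
        rw [hdet, ← ofReal_norm, ← ofReal_norm, ← ofReal_norm, ← ENNReal.ofReal_mul (by positivity),
          ← ENNReal.ofReal_add (by positivity) (by positivity)]
        exact ENNReal.ofReal_le_ofReal (hφ z hz.1)
    _ = (∫⁻ z in U ∩ V, ‖φ z‖ₑ) + ∫⁻ z in U ∩ V, ‖φ (-z)‖ₑ :=
        lintegral_add_left hm.enorm _
    _ = (∫⁻ z in U ∩ V, ‖φ z‖ₑ) + ∫⁻ z in (Neg.neg : ℂ → ℂ) ⁻¹' (U ∩ V), ‖φ z‖ₑ := by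
        congr 1
        rw [← hneg.setLIntegral_comp_preimage hUV' hm.enorm]
        congr 2
        ext z; simp
    _ = ∫⁻ z in (U ∩ V) ∪ (Neg.neg : ℂ → ℂ) ⁻¹' (U ∩ V), ‖φ z‖ₑ := by
        rw [lintegral_union hUV']
        rw [Set.disjoint_left]
        rintro z ⟨hz, -⟩ ⟨hz', -⟩
        simp only [hU, mem_ofPred_eq, Complex.neg_im] at hz hz'
        linarith
    _ ≤ ∫⁻ z in V, ‖φ z‖ₑ := by
        apply lintegral_mono_set
        rintro z (hz | hz)
        · exact hz.2
        · have := hz.2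
          simpa [hV, hg] using this

lemma locallyIntegrable_inv_sub (a : ℂ) : LocallyIntegrable (fun z : ℂ => (z - a)⁻¹) := by
  have h0 : LocallyIntegrable (fun z : ℂ => z⁻¹) := by
    refine locallyIntegrable_of_norm_le_rpow (C := 1) (α := 1) (by simp) (by simp)
      (Eventually.of_forall fun z => ?_) measurable_inv.aestronglyMeasurable
    rw [norm_inv, Real.rpow_neg_one, one_mul]
  rw [locallyIntegrable_iff] at h0 ⊢
  intro K hK
  have h1 := h0 ((fun z => z - a) '' K) (hK.image (by fun_prop))
  have hmp : MeasurePreserving (fun z : ℂ => z - a) volume volume :=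
    measurePreserving_sub_right volume a
  have h2 := (hmp.integrableOn_image (MeasurableEquiv.subRight a).measurableEmbedding).1 h1
  exact h2

/-- A quadratic differential with simple poles dominated by its push-forward vanishes on an annulus,
hence at infinitely many points. -/
lemma infinite_zeros_of_pushforward {φ : ℂ → ℂ} (hm : Measurable φ) (hi : LocallyIntegrable φ)
    (c : ℝ)
    (hφ : ∀ z : ℂ, 0 < z.im → 4 * ‖z‖ ^ 2 * ‖φ (z ^ 2 + c)‖ ≤ ‖φ z‖ + ‖φ (-z)‖) :
    {z | φ z = 0}.Infinite := by
  set R : ℝ := |c| + 4 with hR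
  have hc0 := abs_nonneg c
  set D := Metric.closedBall (0 : ℂ) R with hD
  set D' := Metric.closedBall (0 : ℂ) (R - 1) with hD'
  have hsub : (fun z : ℂ => z ^ 2 + c) ⁻¹' D ⊆ D' := by
    intro z hz
    simp only [hD, mem_preimage, mem_closedBall_zero_iff] at hz
    simp only [hD', mem_closedBall_zero_iff]
    have h1 : ‖z‖ ^ 2 ≤ R + |c| := by
      have : z ^ 2 = (z ^ 2 + c) - c := by ring
      calc ‖z‖ ^ 2 = ‖z ^ 2‖ := (norm_pow z 2).symm
        _ ≤ ‖z ^ 2 + c‖ + ‖(c : ℂ)‖ := by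
          conv_lhs => rw [this]
          exact norm_sub_le _ _
        _ ≤ R + |c| := by
          have : ‖(c : ℂ)‖ = |c| := by simp
          linarith
    by_contra hcon
    push Not at hcon
    nlinarith
  have h1 := lintegral_le_of_pushforward hm c hφ (s := D) Metric.isClosed_closedBall.measurableSet
  have h2 : ∫⁻ z in D, ‖φ z‖ₑ ≤ ∫⁻ z in D', ‖φ z‖ₑ := h1.trans (lintegral_mono_set hsub)
  have hfin : ∫⁻ z in D', ‖φ z‖ₑ ≠ ⊤ :=
    (hi.integrableOn_isCompact (isCompact_closedBall _ _)).2.ne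
  have hDD : D' ⊆ D := Metric.closedBall_subset_closedBall (by linarith)
  have hmD' : MeasurableSet D' := Metric.isClosed_closedBall.measurableSet
  have hmD : MeasurableSet D := Metric.isClosed_closedBall.measurableSet
  have h3 : ∫⁻ z in D \ D', ‖φ z‖ₑ = 0 := by
    have h4 := lintegral_inter_add_sdiff (μ := volume) (fun z => ‖φ z‖ₑ) D hmD'
    rw [inter_eq_self_of_subset_right hDD] at h4
    rw [← h4] at h2
    have := ENNReal.le_sub_of_add_le_left hfin h2
    simpa using this
  rw [lintegral_eq_zero_iff hm.enorm] at h3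
  have h5 : ∀ᵐ z ∂volume, z ∈ D \ D' → φ z = 0 := by
    rw [← ae_restrict_iff' (hmD.diff hmD')]
    filter_upwards [h3] with z hz
    simpa using hz
  intro hfinite
  have h6 : volume (D \ D') = 0 := by
    have h7 : volume {z | φ z = 0} = 0 := hfinite.measure_zero _
    refine measure_mono_null (t := {z | φ z = 0} ∪ {z | ¬ (z ∈ D \ D' → φ z = 0)}) ?_
      (measure_union_null h7 (ae_iff.1 h5))
    intro z hz
    by_cases h8 : φ z = 0
    · exact Or.inl h8
    · exact Or.inr fun h9 => h8 (h9 hz)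
  have h8 : Metric.ball ((R - 1 / 2 : ℝ) : ℂ) (1 / 2) ⊆ D \ D' := by
    intro z hz
    rw [Metric.mem_ball, dist_eq_norm] at hz
    have hn : ‖((R - 1 / 2 : ℝ) : ℂ)‖ = R - 1 / 2 := by
      rw [Complex.norm_real, Real.norm_eq_abs, abs_of_nonneg]
      linarith
    have h9 := abs_norm_sub_norm_le z ((R - 1 / 2 : ℝ) : ℂ)
    rw [hn] at h9
    have h10 := abs_lt.1 (h9.trans_lt hz)
    simp only [hD, hD', Set.mem_sdiff, mem_closedBall_zero_iff, not_le]
    constructor <;> linarith [h10.1, h10.2]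
  have h9 := measure_mono_null h8 h6
  exact (Metric.measure_ball_pos volume ((R - 1 / 2 : ℝ) : ℂ) (by norm_num : (0:ℝ) < 1 / 2)).ne' h9

/-- The orbit of the critical point under `x ↦ x² + a`. -/
noncomputable def co (a : ℝ) (j : ℕ) : ℝ := (fa a)^[j] 0

@[simp] lemma co_zero (a : ℝ) : co a 0 = 0 := rfl

lemma co_succ (a : ℝ) (j : ℕ) : co a (j + 1) = co a j ^ 2 + a := by
  rw [co, Function.iterate_succ_apply', fa, co]

@[simp] lemma co_one (a : ℝ) : co a 1 = a := by simp [co_succ]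

lemma co_add (a : ℝ) (i j : ℕ) : co a (i + j) = (fa a)^[i] (co a j) := by
  rw [co, co, Function.iterate_add_apply]

lemma co_inj {c : ℝ} {p : ℕ} (h0 : co c p = 0) (hne : ∀ j, 1 ≤ j → j < p → co c j ≠ 0)
    {i j : ℕ} (hi : 1 ≤ i) (hij : i < j) (hj : j ≤ p) : co c i ≠ co c j := by
  intro he
  have h1 : co c ((p - j) + i) = co c ((p - j) + j) := by rw [co_add, co_add, he]
  rw [Nat.sub_add_cancel hj, h0] at h1
  exact hne _ (by omega) (by omega) h1

section Transversality

open Finset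

lemma sum_prod_ne_zero {c t : ℝ} (ht0 : 0 < t) (ht1 : t ≤ 1) {q : ℕ} (h0 : co c (q + 1) = 0)
    (hne : ∀ j, 1 ≤ j → j < q + 1 → co c j ≠ 0) :
    ∑ j ∈ range (q + 1), ∏ i ∈ range j, t / (2 * co c (i + 1)) ≠ 0 := by
  intro hD
  set A : ℕ → ℝ := fun j => ∏ i ∈ range j, t / (2 * co c (i + 1)) with hA
  have hA0 : A 0 = 1 := by simp [hA]
  have hAs : ∀ j, A (j + 1) = A j * (t / (2 * co c (j + 1))) := fun j => prod_range_succ _ _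
  set φ : ℂ → ℂ := fun z => ∑ j ∈ range (q + 1), (A j : ℂ) * (z - co c (j + 1))⁻¹ with hφ
  have hm : Measurable φ := by
    refine Finset.measurable_fun_sum _ fun j _ => ?_
    exact ((measurable_id.sub_const _).inv).const_mul _
  have hi : LocallyIntegrable φ := by
    refine locallyIntegrable_finsetSum _ fun j _ => ?_
    exact (locallyIntegrable_inv_sub _).smul (A j : ℂ)
  have hkey : ∀ z : ℂ, 0 < z.im → 4 * z ^ 2 * φ (z ^ 2 + c) = t * (φ z + φ (-z)) := by
    intro z hz
    have hz' : ∀ x : ℝ, z ^ 2 - (x : ℂ) ^ 2 ≠ 0 := by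
      intro x hx
      rcases sq_eq_sq_iff_eq_or_eq_neg.1 (sub_eq_zero.1 hx) with h1 | h1
      · rw [h1] at hz; simp at hz
      · rw [h1] at hz; simp at hz
    have hz1 : ∀ x : ℝ, z - (x : ℂ) ≠ 0 := by
      intro x hx
      rw [sub_eq_zero.1 hx] at hz; simp at hz
    have hz2 : ∀ x : ℝ, -z - (x : ℂ) ≠ 0 := by
      intro x hx
      have : z = -(x : ℂ) := by linear_combination -hx
      rw [this] at hz; simp at hz
    have hDc : ∑ j ∈ range (q + 1), (A j : ℂ) = 0 := by exact_mod_cast hD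
    have hL : 4 * z ^ 2 * φ (z ^ 2 + c) =
        ∑ j ∈ range (q + 1), 4 * (co c j : ℂ) ^ 2 * A j * (z ^ 2 - (co c j : ℂ) ^ 2)⁻¹ := by
      have h1 : 4 * z ^ 2 * φ (z ^ 2 + c) = ∑ j ∈ range (q + 1),
          (4 * (co c j : ℂ) ^ 2 * A j * (z ^ 2 - (co c j : ℂ) ^ 2)⁻¹ + 4 * A j) := by
        rw [hφ, mul_sum]
        refine sum_congr rfl fun j _ => ?_
        have h2 : z ^ 2 + c - (co c (j + 1) : ℂ) = z ^ 2 - (co c j : ℂ) ^ 2 := by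
          rw [co_succ]; push_cast; ring
        rw [h2]
        have := hz' (co c j)
        field_simp
        ring
      rw [h1, sum_add_distrib, ← mul_sum, hDc, mul_zero, add_zero]
    have hR : t * (φ z + φ (-z)) = ∑ j ∈ range (q + 1),
        t * A j * (2 * (co c (j + 1) : ℂ)) * (z ^ 2 - (co c (j + 1) : ℂ) ^ 2)⁻¹ := by
      rw [hφ, ← sum_add_distrib, mul_sum]
      refine sum_congr rfl fun j _ => ?_
      have h1 := hz' (co c (j + 1))
      have h2 := hz1 (co c (j + 1))
      have h3 := hz2 (co c (j + 1))
      have h4 : z ^ 2 - (co c (j + 1) : ℂ) ^ 2 =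
        - ((z - co c (j + 1)) * (-z - co c (j + 1))) := by ring
      rw [h4, inv_neg, mul_inv]
      have h5 := mul_inv_cancel₀ h2
      have h6 := mul_inv_cancel₀ h3
      set u := (z - (co c (j + 1) : ℂ))⁻¹
      set v := (-z - (co c (j + 1) : ℂ))⁻¹
      linear_combination (-(t : ℂ) * A j * v) * h5 - (t * A j * u) * h6
    rw [hL, hR, sum_range_succ', sum_range_succ, h0]
    simp only [co_zero, Complex.ofReal_zero, mul_zero, zero_mul, add_zero, ne_eq, OfNat.ofNat_ne_zero,
      not_false_eq_true, zero_pow]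
    refine sum_congr rfl fun j hj => ?_
    have h1 : co c (j + 1) ≠ 0 := hne _ (by omega) (by simpa using hj)
    have h2 : (co c (j + 1) : ℂ) ≠ 0 := by exact_mod_cast h1
    rw [hAs]
    push_cast
    field_simp
    ring
  have hineq : ∀ z : ℂ, 0 < z.im → 4 * ‖z‖ ^ 2 * ‖φ (z ^ 2 + c)‖ ≤ ‖φ z‖ + ‖φ (-z)‖ := by
    intro z hz
    have h1 := congrArg norm (hkey z hz)
    rw [norm_mul, norm_mul, norm_pow, norm_mul, Complex.norm_real, Real.norm_eq_abs,
      abs_of_pos ht0] at h1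
    have h4 : ‖(4 : ℂ)‖ = 4 := by simp
    rw [h4] at h1
    rw [h1]
    calc t * ‖φ z + φ (-z)‖ ≤ 1 * ‖φ z + φ (-z)‖ := by gcongr
      _ ≤ ‖φ z‖ + ‖φ (-z)‖ := by rw [one_mul]; exact norm_add_le _ _
  have hinf := infinite_zeros_of_pushforward hm hi c hineq
  let P : Polynomial ℂ := ∑ j ∈ range (q + 1), Polynomial.C (A j : ℂ) *
    ∏ i ∈ (range (q + 1)).erase j, (Polynomial.X - Polynomial.C (co c (i + 1) : ℂ))
  have hPz : ∀ z, P.eval z = ∑ j ∈ range (q + 1), (A j : ℂ) *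
      ∏ i ∈ (range (q + 1)).erase j, (z - co c (i + 1)) := by
    intro z
    simp [P, Polynomial.eval_finsetSum, Polynomial.eval_prod]
  have hP0 : P = 0 := by
    refine Polynomial.eq_zero_of_infinite_isRoot P ?_
    have hfin : ((range (q + 1)).image fun j => (co c (j + 1) : ℂ) : Set ℂ).Finite :=
      Finset.finite_toSet _
    refine (hinf.sdiff hfin).mono ?_
    rintro z ⟨hz, hz'⟩
    simp only [coe_image, Set.mem_image, SetLike.mem_coe, not_exists, not_and] at hz'
    rw [mem_ofPred_eq, Polynomial.IsRoot, hPz]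
    have h1 : ∀ j ∈ range (q + 1), z - (co c (j + 1) : ℂ) ≠ 0 := by
      intro j hj h2
      exact hz' j hj (sub_eq_zero.1 h2).symm
    have h2 : (∏ i ∈ range (q + 1), (z - (co c (i + 1) : ℂ))) * φ z = 0 := by
      rw [show φ z = 0 from hz, mul_zero]
    rw [hφ, mul_sum] at h2
    rw [← h2]
    refine sum_congr rfl fun j hj => ?_
    rw [← mul_prod_erase _ _ hj]
    have := h1 j hj
    field_simp
  have h1 : P.eval (co c 1 : ℂ) = 0 := by rw [hP0]; simp
  rw [hPz, sum_eq_single 0] at h1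
  · rw [hA0] at h1
    simp only [Complex.ofReal_one, one_mul, prod_eq_zero_iff] at h1
    obtain ⟨i, hi, h2⟩ := h1
    simp only [mem_erase, Finset.mem_range] at hi
    have h3 : co c 1 = co c (i + 1) := by exact_mod_cast sub_eq_zero.1 h2
    exact co_inj h0 hne le_rfl (by omega) (by omega) h3
  · intro j hj hj0
    rw [prod_eq_zero (i := 0) (by simp; omega) (by simp), mul_zero]
  · simp

/-- Positivity of `∑ 1 / (fʲ)'(c)` along a periodic critical orbit. -/
theorem transversality {c : ℝ} {p : ℕ} (hp : 1 ≤ p) (h0 : co c p = 0)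
    (hne : ∀ j, 1 ≤ j → j < p → co c j ≠ 0) :
    0 < ∑ j ∈ range p, ∏ i ∈ range j, (2 * co c (i + 1))⁻¹ := by
  obtain ⟨q, rfl⟩ : ∃ q, p = q + 1 := ⟨p - 1, by omega⟩
  set D : ℝ → ℝ := fun t => ∑ j ∈ range (q + 1), ∏ i ∈ range j, t / (2 * co c (i + 1)) with hD
  have hcont : Continuous D := by
    refine continuous_finsetSum _ fun j _ => continuous_finsetProd _ fun i _ => ?_
    fun_prop
  have hD0 : D 0 = 1 := by
    simp only [hD, zero_div]
    rw [sum_range_succ']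
    simp
  have hD1 : D 1 = ∑ j ∈ range (q + 1), ∏ i ∈ range j, (2 * co c (i + 1))⁻¹ := by
    simp only [hD, one_div]
  rw [← hD1]
  by_contra hcon
  push Not at hcon
  obtain ⟨t, ht, ht0⟩ := intermediate_value_Icc' (zero_le_one) hcont.continuousOn
    (show (0 : ℝ) ∈ Set.Icc (D 1) (D 0) from ⟨hcon, by rw [hD0]; norm_num⟩)
  have htne : t ≠ 0 := by
    rintro rfl
    rw [hD0] at ht0; norm_num at ht0
  exact sum_prod_ne_zero (lt_of_le_of_ne ht.1 htne.symm) ht.2 h0 hne ht0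

end Transversality

/-! ### Pull-back paths of the critical point -/

lemma pos_of_deriv_neg_at_zeros {f f' : ℝ → ℝ} {a b : ℝ} (hab : a < b)
    (hc : ∀ x ∈ Icc a b, HasDerivAt f (f' x) x)
    (hz : ∀ x ∈ Icc a b, f x = 0 → f' x < 0) (hb : 0 ≤ f b) : 0 < f a := by
  have key : ∀ b', a < b' → b' ≤ b → 0 < f b' → 0 < f a := by
    intro b' hab' hb' hpos
    by_contra hcon
    push Not at hcon
    set S := {x ∈ Icc a b' | f x ≤ 0} with hS
    have hcont : ContinuousOn f (Icc a b') := fun x hx =>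
      (hc x ⟨hx.1, hx.2.trans hb'⟩).continuousAt.continuousWithinAt
    have hSc : IsClosed S := by
      have : S = Icc a b' ∩ f ⁻¹' Iic 0 := by ext; simp [hS]
      rw [this]
      exact hcont.preimage_isClosed_of_isClosed isClosed_Icc isClosed_Iic
    have hSb : BddAbove S := ⟨b', fun x hx => hx.1.2⟩
    have hSne : S.Nonempty := ⟨a, ⟨le_rfl, hab'.le⟩, hcon⟩
    have hz0 := hSc.csSup_mem hSne hSb
    set z := sSup S
    have hzb : z < b' := by
      refine lt_of_le_of_ne hz0.1.2 ?_
      intro he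
      have := hz0.2
      rw [he] at this
      linarith
    have hright : ∀ x ∈ Ioo z b', 0 < f x := by
      intro x hx
      by_contra hcon'
      push Not at hcon'
      have : x ≤ z := le_csSup hSb ⟨⟨hz0.1.1.trans hx.1.le, hx.2.le⟩, hcon'⟩
      linarith [hx.1]
    have hzI : z ∈ Icc a b := ⟨hz0.1.1, hz0.1.2.trans hb'⟩
    have hev : ∀ᶠ x in nhdsWithin z (Ioi z), 0 < f x := by
      filter_upwards [Ioo_mem_nhdsGT hzb] with x hx using hright x hx
    have hfz : f z = 0 := by
      refine le_antisymm hz0.2 ?_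
      have h1 : Tendsto f (nhdsWithin z (Ioi z)) (nhds (f z)) :=
        (hc z hzI).continuousAt.continuousWithinAt
      exact ge_of_tendsto h1 (hev.mono fun x hx => hx.le)
    have hd := hz z hzI hfz
    have h2 := (hc z hzI).tendsto_slope
    have h3 : Tendsto (slope f z) (nhdsWithin z (Ioi z)) (nhds (f' z)) :=
      h2.mono_left (nhdsWithin_mono _ fun x hx => ne_of_gt hx)
    have h4 : 0 ≤ f' z := by
      refine ge_of_tendsto h3 ?_
      filter_upwards [hev, self_mem_nhdsWithin] with x hx hx'
      rw [slope_def_field, hfz, sub_zero]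
      exact div_nonneg hx.le (sub_nonneg.2 (le_of_lt hx'))
    linarith
  rcases hb.lt_or_eq with hb0 | hb0
  · exact key b hab le_rfl hb0
  · have hbI : b ∈ Icc a b := ⟨hab.le, le_rfl⟩
    have hd := hz b hbI hb0.symm
    have h2 := (hc b hbI).tendsto_slope
    have h3 : Tendsto (slope f b) (nhdsWithin b (Iio b)) (nhds (f' b)) :=
      h2.mono_left (nhdsWithin_mono _ fun x hx => ne_of_lt hx)
    have h4 := (h3.eventually (gt_mem_nhds hd)).and (Ioo_mem_nhdsLT hab)
    obtain ⟨x, hx, hx'⟩ := h4.exists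
    refine key x hx'.1 hx'.2.le ?_
    rw [slope_def_field, ← hb0, sub_zero] at hx
    rcases div_neg_iff.1 hx with h5 | h5
    · exact h5.1
    · linarith [h5.2, hx'.2]

/-- The pull-back of `0` along the branches of `√(· - a)` with signs `ε`. -/
noncomputable def pull (ε : ℕ → ℝ) (a : ℝ) : ℕ → ℝ
  | 0 => 0
  | j + 1 => ε j * √(pull ε a j - a)

/-- The logarithmic-derivative recursion attached to `pull`. -/
noncomputable def pullD (ε : ℕ → ℝ) (a : ℝ) : ℕ → ℝ
  | 0 => 1
  | j + 1 => 1 + pullD ε a j / (2 * pull ε a (j + 1))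

/-- The first `l` points of the pull-back path lie strictly above the critical value. -/
def PullOK (ε : ℕ → ℝ) (a : ℝ) (l : ℕ) : Prop := ∀ i < l, a < pull ε a i

lemma PullOK.mono {ε : ℕ → ℝ} {a : ℝ} {l l' : ℕ} (hl : l' ≤ l) (H : PullOK ε a l) :
    PullOK ε a l' := fun i hi => H i (hi.trans_le hl)

lemma pullOK_succ {ε : ℕ → ℝ} {a : ℝ} {l : ℕ} :
    PullOK ε a (l + 1) ↔ PullOK ε a l ∧ a < pull ε a l := by
  constructor
  · exact fun H => ⟨H.mono (Nat.le_succ l), H l (Nat.lt_succ_self l)⟩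
  · rintro ⟨h1, h2⟩ i hi
    rcases Nat.lt_succ_iff_lt_or_eq.1 hi with h3 | rfl
    · exact h1 i h3
    · exact h2

section Pull

variable {ε : ℕ → ℝ}

lemma pull_sq (hε : ∀ j, ε j = 1 ∨ ε j = -1)
    {a : ℝ} {j : ℕ} (hj : a ≤ pull ε a j) : pull ε a (j + 1) ^ 2 + a = pull ε a j := by
  rw [pull, mul_pow, Real.sq_sqrt (by linarith)]
  rcases hε j with h1 | h1 <;> rw [h1] <;> ring

lemma pull_ne_zero (hε : ∀ j, ε j = 1 ∨ ε j = -1)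
    {a : ℝ} {j : ℕ} (hj : a < pull ε a j) : pull ε a (j + 1) ≠ 0 := by
  rw [pull]
  have := Real.sqrt_pos.2 (sub_pos.2 hj)
  rcases hε j with h1 | h1 <;> rw [h1] <;> simp <;> positivity

lemma sign_pull {a : ℝ} {j : ℕ} (hj : a < pull ε a j) :
    SignType.sign (pull ε a (j + 1)) = SignType.sign (ε j) := by
  rw [pull, sign_mul, sign_pos (Real.sqrt_pos.2 (sub_pos.2 hj)), mul_one]

lemma iterate_pull (hε : ∀ j, ε j = 1 ∨ ε j = -1)
    {a : ℝ} {l : ℕ} (H : PullOK ε a l) {i : ℕ} (hi : i ≤ l) :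
    (fa a)^[i] (pull ε a l) = pull ε a (l - i) := by
  induction i with
  | zero => rfl
  | succ i ih =>
    rw [Function.iterate_succ_apply', ih (by omega)]
    obtain ⟨k, hk⟩ : ∃ k, l - i = k + 1 := ⟨l - i - 1, by omega⟩
    rw [hk, show l - (i + 1) = k by omega]
    exact pull_sq hε (H k (by omega)).le

lemma hasDerivAt_pull (hε : ∀ j, ε j = 1 ∨ ε j = -1) {l : ℕ} : ∀ {a : ℝ}, PullOK ε a l →
    HasDerivAt (fun x => pull ε x l) (1 - pullD ε a l) a := by
  induction l with
  | zero =>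
    intro a _
    simp only [pull, pullD, sub_self]
    exact hasDerivAt_const a 0
  | succ l ih =>
    intro a H
    rw [pullOK_succ] at H
    have h1 := (ih H.1).sub (hasDerivAt_id a)
    have h2 : pull ε a l - id a ≠ 0 := by simp; linarith [H.2]
    have h3 := (h1.sqrt h2).const_mul (ε l)
    have h4 := Real.sqrt_pos.2 (sub_pos.2 H.2)
    have h5 : 1 - pullD ε a (l + 1) = ε l * ((1 - pullD ε a l - 1) / (2 * √(pull ε a l - a))) := by
      rw [pullD, pull]
      have : ε l ≠ 0 := by rcases hε l with h | h <;> rw [h] <;> norm_num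
      have h6 : ε l * ε l = 1 := by rcases hε l with h | h <;> rw [h] <;> norm_num
      field_simp
      linear_combination (pullD ε a l) * h6
    rw [h5]
    exact h3

lemma pullD_eq_sum (a : ℝ) (l : ℕ) : pullD ε a l =
    ∑ j ∈ Finset.range (l + 1), ∏ i ∈ Finset.range j, (2 * pull ε a (l - i))⁻¹ := by
  induction l with
  | zero => simp [pullD]
  | succ l ih =>
    rw [pullD, ih, Finset.sum_range_succ' _ (l + 1), add_comm]
    congr 1
    · rw [div_eq_inv_mul, Finset.mul_sum]
      refine Finset.sum_congr rfl fun j hj => ?_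
      rw [Finset.prod_range_succ', mul_comm]
      congr 1
      refine Finset.prod_congr rfl fun i hi => ?_
      rw [show l + 1 - (i + 1) = l - i by omega]

lemma co_of_pull (hε : ∀ j, ε j = 1 ∨ ε j = -1)
    {A : ℝ} {l : ℕ} (H : PullOK ε A l) (hl : pull ε A l = A) {j : ℕ} (hj : j ≤ l) :
    co A (j + 1) = pull ε A (l - j) := by
  rw [co_add, co_one, ← iterate_pull hε H hj, hl]

lemma pull_period (hε : ∀ j, ε j = 1 ∨ ε j = -1)
    {A : ℝ} {l : ℕ} (H : PullOK ε A l) (hl : pull ε A l = A) :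
    co A (l + 1) = 0 ∧ ∀ j, 1 ≤ j → j < l + 1 → co A j ≠ 0 := by
  refine ⟨?_, fun j hj hj' => ?_⟩
  · rw [co_of_pull hε H hl le_rfl, Nat.sub_self, pull]
  · obtain ⟨i, rfl⟩ : ∃ i, j = i + 1 := ⟨j - 1, by omega⟩
    rw [co_of_pull hε H hl (by omega)]
    obtain ⟨k, hk⟩ : ∃ k, l - i = k + 1 := ⟨l - i - 1, by omega⟩
    rw [hk]
    exact pull_ne_zero hε (H k (by omega))

lemma pullD_pos (hε : ∀ j, ε j = 1 ∨ ε j = -1)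
    {A : ℝ} {l : ℕ} (H : PullOK ε A l) (hl : pull ε A l = A) : 0 < pullD ε A l := by
  have h1 := pull_period hε H hl
  have h2 := transversality (by omega) h1.1 h1.2
  rw [pullD_eq_sum]
  convert h2 using 1
  refine Finset.sum_congr rfl fun j hj => Finset.prod_congr rfl fun i hi => ?_
  rw [Finset.mem_range] at hi hj
  rw [co_of_pull hε H hl (by omega)]

/-- Admissibility of a pull-back path persists when the parameter decreases. -/
theorem pullOK_of_lt (hε : ∀ j, ε j = 1 ∨ ε j = -1)
    {l : ℕ} : ∀ {a₁ a₂ : ℝ}, a₁ < a₂ → PullOK ε a₂ l → a₂ ≤ pull ε a₂ l →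
    PullOK ε a₁ (l + 1) := by
  induction l with
  | zero =>
    intro a₁ a₂ h12 _ h2 i hi
    obtain rfl : i = 0 := by omega
    simp only [pull] at h2 ⊢
    linarith
  | succ l ih =>
    intro a₁ a₂ h12 H h2
    have hall : ∀ a, a ≤ a₂ → PullOK ε a (l + 1) := by
      intro a ha
      rcases ha.lt_or_eq with h3 | rfl
      · rw [pullOK_succ] at H
        exact ih h3 H.1 H.2.le
      · exact H
    rw [pullOK_succ]
    refine ⟨hall a₁ h12.le, ?_⟩
    have := pos_of_deriv_neg_at_zeros (f := fun a => pull ε a (l + 1) - a)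
      (f' := fun a => 1 - pullD ε a (l + 1) - 1) h12
      (fun x hx => (hasDerivAt_pull hε (hall x hx.2)).sub (hasDerivAt_id x))
      (fun x hx h0 => by
        have := pullD_pos hε (hall x hx.2) (sub_eq_zero.1 h0)
        linarith) (sub_nonneg.2 h2)
    simpa using this

lemma pullOK_antitone (hε : ∀ j, ε j = 1 ∨ ε j = -1)
    {l : ℕ} {a₁ a₂ : ℝ} (h12 : a₁ ≤ a₂) (H : PullOK ε a₂ l) : PullOK ε a₁ l := by
  rcases h12.lt_or_eq with h3 | rfl
  · cases l with
    | zero => intro i hi; omega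
    | succ l =>
      rw [pullOK_succ] at H
      exact pullOK_of_lt hε h3 H.1 H.2.le
  · exact H

lemma pull_fixed_unique (hε : ∀ j, ε j = 1 ∨ ε j = -1)
    {l : ℕ} {a₁ a₂ : ℝ} (H₁ : PullOK ε a₁ l) (h₁ : pull ε a₁ l = a₁)
    (H₂ : PullOK ε a₂ l) (h₂ : pull ε a₂ l = a₂) : a₁ = a₂ := by
  rcases lt_trichotomy a₁ a₂ with h3 | h3 | h3
  · have := (pullOK_succ.1 (pullOK_of_lt hε h3 H₂ h₂.ge)).2
    linarith
  · exact h3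
  · have := (pullOK_succ.1 (pullOK_of_lt hε h3 H₁ h₁.ge)).2
    linarith

end Pull

/-- The signs of the orbit segment `x, …, f^{k-1} x`, read backwards. -/
noncomputable def bsign (s : ℕ → ℝ) (k : ℕ) (j : ℕ) : ℝ :=
  if 0 ≤ s (k - 1 - j) then 1 else -1

lemma bsign_eq (s : ℕ → ℝ) (k j : ℕ) : bsign s k j = 1 ∨ bsign s k j = -1 := by
  unfold bsign; split_ifs <;> simp

lemma bsign_mul_abs (s : ℕ → ℝ) (k j : ℕ) : bsign s k j * |s (k - 1 - j)| = s (k - 1 - j) := by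
  unfold bsign
  split_ifs with h1
  · rw [one_mul, abs_of_nonneg h1]
  · rw [abs_of_neg (not_le.1 h1)]; ring

lemma sign_bsign {s : ℕ → ℝ} {k j : ℕ} (hs : s (k - 1 - j) ≠ 0) :
    SignType.sign (bsign s k j) = SignType.sign (s (k - 1 - j)) := by
  unfold bsign
  split_ifs with h1
  · rw [sign_pos one_pos, sign_pos (lt_of_le_of_ne h1 hs.symm)]
  · rw [sign_neg (by norm_num : (-1 : ℝ) < 0), sign_neg (not_le.1 h1)]

lemma bsign_congr {s s' : ℕ → ℝ} {k : ℕ}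
    (H : ∀ i < k, SignType.sign (s i) = SignType.sign (s' i)) {j : ℕ} (hj : j < k) :
    bsign s k j = bsign s' k j := by
  have h1 := H (k - 1 - j) (by omega)
  unfold bsign
  have : 0 ≤ s (k - 1 - j) ↔ 0 ≤ s' (k - 1 - j) := by
    rw [← sign_nonneg_iff, h1, sign_nonneg_iff]
  simp only [this]

lemma pull_congr {ε ε' : ℕ → ℝ} {a : ℝ} {l : ℕ} (H : ∀ j < l, ε j = ε' j) :
    pull ε a l = pull ε' a l := by
  induction l with
  | zero => rfl
  | succ l ih => rw [pull, pull, ih fun j hj => H j (by omega), H l (by omega)]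

lemma pull_orbit {a x : ℝ} {k : ℕ} (h0 : (fa a)^[k] x = 0) {j : ℕ} (hj : j ≤ k) :
    pull (bsign (fun i => (fa a)^[i] x) k) a j = (fa a)^[k - j] x := by
  induction j with
  | zero => rw [pull, Nat.sub_zero, h0]
  | succ j ih =>
    rw [pull, ih (by omega)]
    have h1 : (fa a)^[k - j] x = ((fa a)^[k - 1 - j] x) ^ 2 + a := by
      rw [show k - j = (k - 1 - j) + 1 by omega, Function.iterate_succ_apply', fa]
    rw [h1, add_sub_cancel_right, Real.sqrt_sq_eq_abs, show k - (j + 1) = k - 1 - j by omega]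
    exact bsign_mul_abs (fun i => (fa a)^[i] x) k j

lemma pullOK_orbit {a x : ℝ} {k : ℕ} (h0 : (fa a)^[k] x = 0) (hne : ∀ i < k, (fa a)^[i] x ≠ 0) :
    PullOK (bsign (fun i => (fa a)^[i] x) k) a k := by
  intro i hi
  rw [pull_orbit h0 hi.le]
  have h1 : (fa a)^[k - i] x = ((fa a)^[k - 1 - i] x) ^ 2 + a := by
    rw [show k - i = (k - 1 - i) + 1 by omega, Function.iterate_succ_apply', fa]
  have := hne (k - 1 - i) (by omega)
  rw [h1]
  have : 0 < ((fa a)^[k - 1 - i] x) ^ 2 := by positivity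
  linarith

lemma sign_iterate_pull {s : ℕ → ℝ} {k : ℕ} {a : ℝ} (hs0 : s k = 0) (hs : ∀ i < k, s i ≠ 0)
    (H : PullOK (bsign s k) a k) {i : ℕ} (hi : i ≤ k) :
    SignType.sign (s i) = SignType.sign ((fa a)^[i] (pull (bsign s k) a k)) := by
  rw [iterate_pull (bsign_eq s k) H hi]
  rcases hi.lt_or_eq with h1 | rfl
  · rw [show k - i = (k - 1 - i) + 1 by omega, sign_pull (H _ (by omega)),
      sign_bsign (hs _ (by omega)), show k - 1 - (k - 1 - i) = i by omega]
  · rw [hs0, Nat.sub_self, pull]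

lemma co_eq_iterate (a : ℝ) (i : ℕ) : (fa a)^[i] a = co a (i + 1) := by
  rw [co_add, co_one]

/-- A superstable parameter is determined by the signs of its critical orbit. -/
theorem periodic_param_unique {a₁ a₂ : ℝ} {p : ℕ} (hp : 1 ≤ p) (h₁ : co a₁ p = 0)
    (h₂ : co a₂ p = 0) (hne : ∀ j, 1 ≤ j → j < p → co a₁ j ≠ 0)
    (hs : ∀ j, 1 ≤ j → j < p → SignType.sign (co a₁ j) = SignType.sign (co a₂ j)) : a₁ = a₂ := by
  obtain ⟨q, rfl⟩ : ∃ q, p = q + 1 := ⟨p - 1, by omega⟩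
  have hne' : ∀ j, 1 ≤ j → j < q + 1 → co a₂ j ≠ 0 := fun j hj hj' => by
    rw [← sign_ne_zero, ← hs j hj hj', sign_ne_zero]
    exact hne j hj hj'
  have e1 : (fa a₁)^[q] a₁ = 0 := by rw [co_eq_iterate, h₁]
  have e2 : (fa a₂)^[q] a₂ = 0 := by rw [co_eq_iterate, h₂]
  have n1 : ∀ i < q, (fa a₁)^[i] a₁ ≠ 0 := fun i hi => by
    rw [co_eq_iterate]; exact hne _ (by omega) (by omega)
  have n2 : ∀ i < q, (fa a₂)^[i] a₂ ≠ 0 := fun i hi => by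
    rw [co_eq_iterate]; exact hne' _ (by omega) (by omega)
  have hcongr : ∀ j < q, bsign (fun i => (fa a₁)^[i] a₁) q j = bsign (fun i => (fa a₂)^[i] a₂) q j :=
    fun j hj => bsign_congr (fun i hi => by
      rw [co_eq_iterate, co_eq_iterate]; exact hs _ (by omega) (by omega)) hj
  have f1 := pull_orbit e1 (le_refl q)
  have f2 := pull_orbit e2 (le_refl q)
  have o1 := pullOK_orbit e1 n1
  have o2 := pullOK_orbit e2 n2
  rw [Nat.sub_self] at f1 f2
  refine pull_fixed_unique (bsign_eq (fun i => (fa a₁)^[i] a₁) q) o1 f1 ?_ ?_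
  · intro i hi
    rw [pull_congr fun j hj => hcongr j (by omega)]
    exact o2 i hi
  · rw [pull_congr hcongr]
    exact f2

/-! ### Counting preimages of the turning point -/

/-- Even maps, strictly increasing and onto `[φ 0, ∞)` on the positive half-line. -/
structure EvenMono (φ : ℝ → ℝ) : Prop where
  even : ∀ x, φ (-x) = φ x
  mono : StrictMonoOn φ (Ici 0)
  surj : ∀ y, φ 0 ≤ y → ∃ x, 0 ≤ x ∧ φ x = y

lemma evenMono_fa (a : ℝ) : EvenMono (fa a) where
  even x := by simp [fa]
  mono x hx y hy hxy := by
    simp only [mem_Ici] at hx hy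
    simp only [fa]; nlinarith
  surj y hy := by
    simp only [fa] at hy
    refine ⟨√(y - a), Real.sqrt_nonneg _, ?_⟩
    rw [fa, Real.sq_sqrt (by linarith)]; ring

/-- The tent map conjugated by `x ↦ -x`. -/
noncomputable def tm (b : ℝ) : ℝ → ℝ := fun x => b * |x| - 1

lemma evenMono_tm {b : ℝ} (hb : 0 < b) : EvenMono (tm b) where
  even x := by simp [tm]
  mono x hx y hy hxy := by
    simp only [mem_Ici] at hx hy
    simp only [tm, abs_of_nonneg hx, abs_of_nonneg hy]
    nlinarith
  surj y hy := by
    simp only [tm, abs_zero, mul_zero] at hy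
    have : 0 ≤ (y + 1) / b := div_nonneg (by linarith) hb.le
    refine ⟨(y + 1) / b, this, ?_⟩
    rw [tm, abs_of_nonneg this]
    field_simp; ring

namespace EvenMono

variable {φ φ₁ φ₂ : ℝ → ℝ}

lemma apply_abs (hφ : EvenMono φ) (x : ℝ) : φ |x| = φ x := by
  rcases abs_cases x with ⟨h1, _⟩ | ⟨h1, _⟩ <;> rw [h1]
  exact hφ.even x

lemma abs_eq_of_eq (hφ : EvenMono φ) {x y : ℝ} (hxy : φ x = φ y) : |x| = |y| := by
  rw [← hφ.apply_abs x, ← hφ.apply_abs y] at hxy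
  exact hφ.mono.injOn (abs_nonneg x) (abs_nonneg y) hxy

lemma eq_of_eq (hφ : EvenMono φ) {x y : ℝ} (hxy : φ x = φ y)
    (hs : SignType.sign x = SignType.sign y) : x = y := by
  rw [← sign_mul_abs x, ← sign_mul_abs y, hs, hφ.abs_eq_of_eq hxy]

lemma zero_lt (hφ : EvenMono φ) {x : ℝ} (hx : x ≠ 0) : φ 0 < φ x := by
  rw [← hφ.apply_abs x]
  exact hφ.mono (by simp) (abs_nonneg x) (abs_pos.2 hx)

lemma zero_le (hφ : EvenMono φ) (x : ℝ) : φ 0 ≤ φ x := by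
  rcases eq_or_ne x 0 with rfl | hx
  · exact le_rfl
  · exact (hφ.zero_lt hx).le

lemma finite_fiber (hφ : EvenMono φ) (y : ℝ) : (φ ⁻¹' {y}).Finite := by
  by_cases hne : ∃ x, φ x = y
  · obtain ⟨x, rfl⟩ := hne
    refine (Set.toFinite {x, -x}).subset ?_
    intro z hz
    rcases abs_eq_abs.1 (hφ.abs_eq_of_eq hz) with h1 | h1 <;> simp [h1]
  · push Not at hne
    convert Set.finite_empty
    ext z
    simpa using hne z

lemma finite_iterate_fiber (hφ : EvenMono φ) (k : ℕ) (y : ℝ) : {x | φ^[k] x = y}.Finite := by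
  induction k generalizing y with
  | zero => simp
  | succ k ih =>
    have : {x | φ^[k + 1] x = y} = ⋃ z ∈ φ ⁻¹' {y}, {x | φ^[k] x = z} := by
      ext x; simp [Function.iterate_succ_apply']
    rw [this]
    exact (hφ.finite_fiber y).biUnion fun z _ => ih z

end EvenMono

/-- The points hitting `0` within the first `n` steps. -/
def zset (φ : ℝ → ℝ) (n : ℕ) : Set ℝ := {x | ∃ k < n, φ^[k] x = 0}

/-- The number of points hitting `0` within the first `n` steps. -/
noncomputable def nz (φ : ℝ → ℝ) (n : ℕ) : ℕ := (zset φ n).ncard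

namespace EvenMono

variable {φ φ₁ φ₂ : ℝ → ℝ}

lemma finite_zset (hφ : EvenMono φ) (n : ℕ) : (zset φ n).Finite := by
  have : zset φ n = ⋃ k ∈ Finset.range n, {x | φ^[k] x = 0} := by
    ext x; simp [zset]
  rw [this]
  exact Set.Finite.biUnion (Finset.finite_toSet _) fun k _ => hφ.finite_iterate_fiber k 0

lemma eq_of_signs (hφ : EvenMono φ) {k : ℕ} : ∀ {x y : ℝ}, φ^[k] x = φ^[k] y →
    (∀ i < k, SignType.sign (φ^[i] x) = SignType.sign (φ^[i] y)) → x = y := by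
  induction k with
  | zero => intro x y hxy _; exact hxy
  | succ k ih =>
    intro x y hxy hs
    refine hφ.eq_of_eq (ih (x := φ x) (y := φ y) hxy fun i hi => ?_) (hs 0 (by omega))
    exact hs (i + 1) (by omega)

lemma nz_le (hφ₁ : EvenMono φ₁) (hφ₂ : EvenMono φ₂) {n : ℕ}
    (H : ∀ k < n, ∀ x, φ₁^[k] x = 0 → (∀ i < k, φ₁^[i] x ≠ 0) →
      ∃ x', ∀ i ≤ k, SignType.sign (φ₁^[i] x) = SignType.sign (φ₂^[i] x')) :
    nz φ₁ n ≤ nz φ₂ n := by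
  classical
  have H' : ∀ x ∈ zset φ₁ n, ∃ k < n, φ₁^[k] x = 0 ∧ (∀ i < k, φ₁^[i] x ≠ 0) ∧
      ∃ x', ∀ i ≤ k, SignType.sign (φ₁^[i] x) = SignType.sign (φ₂^[i] x') := by
    intro x hx
    have hx' : ∃ k, k < n ∧ φ₁^[k] x = 0 := hx
    have h1 := Nat.find_spec hx'
    have h2 : ∀ i < Nat.find hx', φ₁^[i] x ≠ 0 := fun i hi h0 =>
      Nat.find_min hx' hi ⟨hi.trans h1.1, h0⟩
    exact ⟨_, h1.1, h1.2, h2, H _ h1.1 x h1.2 h2⟩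
  choose! K hK h0 hne F hF using H'
  refine Set.ncard_le_ncard_of_injOn F ?_ ?_ (hφ₂.finite_zset n)
  · intro x hx
    refine ⟨K x, hK x hx, ?_⟩
    have := hF x hx (K x) le_rfl
    rw [h0 x hx, sign_zero] at this
    exact sign_eq_zero_iff.1 this.symm
  · have key : ∀ x ∈ zset φ₁ n, ∀ y ∈ zset φ₁ n, F x = F y → K x ≤ K y := by
      intro x hx y hy hxy
      by_contra hlt
      push Not at hlt
      have h1 := hF x hx (K y) hlt.le
      rw [hxy, ← hF y hy (K y) le_rfl, h0 y hy, sign_zero] at h1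
      exact hne x hx _ hlt (sign_eq_zero_iff.1 h1)
    intro x hx y hy hxy
    have hk : K x = K y := le_antisymm (key x hx y hy hxy) (key y hy x hx hxy.symm)
    refine hφ₁.eq_of_signs (k := K x) ?_ fun i hi => ?_
    · rw [h0 x hx, hk, h0 y hy]
    · rw [hF x hx i hi.le, hxy, ← hF y hy i (by omega)]

/-- One step of the kneading order. -/
lemma sign_sub_step (hφ : EvenMono φ) {u w : ℝ} (hu : u ≠ 0)
    (hs : SignType.sign u = SignType.sign w) :
    SignType.sign (u - w) = SignType.sign u * SignType.sign (φ u - φ w) := by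
  have hmono : ∀ {x y : ℝ}, 0 ≤ x → 0 ≤ y → SignType.sign (φ x - φ y) = SignType.sign (x - y) := by
    intro x y hx hy
    rcases lt_trichotomy x y with h1 | rfl | h1
    · rw [sign_neg (sub_neg.2 h1), sign_neg (sub_neg.2 (hφ.mono hx hy h1))]
    · simp
    · rw [sign_pos (sub_pos.2 h1), sign_pos (sub_pos.2 (hφ.mono hy hx h1))]
  rcases lt_or_gt_of_ne hu with h1 | h1
  · rw [sign_neg h1] at hs ⊢
    have hw := sign_eq_neg_one_iff.1 hs.symm
    rw [← hφ.even u, ← hφ.even w, hmono (by linarith) (by linarith),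
      show -u - -w = -(u - w) by ring, Left.sign_neg]
    simp
  · rw [sign_pos h1] at hs ⊢
    have hw := sign_eq_one_iff.1 hs.symm
    rw [hmono h1.le hw.le, one_mul]

/-- The order of two points is governed by the first difference of their itineraries. -/
lemma sign_sub_eq (hφ : EvenMono φ) {N : ℕ} {u w : ℝ} (hu : ∀ i < N, φ^[i] u ≠ 0)
    (hs : ∀ i < N, SignType.sign (φ^[i] u) = SignType.sign (φ^[i] w)) :
    SignType.sign (u - w) = (∏ i ∈ Finset.range N, SignType.sign (φ^[i] u)) *
      SignType.sign (φ^[N] u - φ^[N] w) := by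
  induction N with
  | zero => simp
  | succ N ih =>
    rw [ih (fun i hi => hu i (by omega)) (fun i hi => hs i (by omega)), Finset.prod_range_succ,
      mul_assoc, Function.iterate_succ_apply', Function.iterate_succ_apply',
      ← hφ.sign_sub_step (hu N (by omega)) (hs N (by omega))]

end EvenMono

lemma sign_sub_of_sign_ne {u w : ℝ} (hne : SignType.sign u ≠ SignType.sign w) :
    SignType.sign (u - w) = if SignType.sign u < SignType.sign w then -1 else 1 := by
  split_ifs with h1
  · rw [sign_neg]
    by_contra hcon
    push Not at hcon
    exact absurd (SignType.sign.monotone (sub_nonneg.1 hcon)) (not_le.2 h1)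
  · rw [sign_pos]
    by_contra hcon
    push Not at hcon
    exact hne (le_antisymm (SignType.sign.monotone (sub_nonpos.1 hcon)) (not_lt.1 h1))

namespace EvenMono

variable {φ φ₁ φ₂ : ℝ → ℝ}

/-- Points with the same itineraries up to a first difference compare equally in two maps. -/
lemma sign_sub_congr (hφ₁ : EvenMono φ₁) (hφ₂ : EvenMono φ₂) {N : ℕ} {u₁ w₁ u₂ w₂ : ℝ}
    (hu : ∀ i ≤ N, SignType.sign (φ₁^[i] u₁) = SignType.sign (φ₂^[i] u₂))
    (hw : ∀ i ≤ N, SignType.sign (φ₁^[i] w₁) = SignType.sign (φ₂^[i] w₂))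
    (hne : ∀ i < N, φ₁^[i] u₁ ≠ 0)
    (hs : ∀ i < N, SignType.sign (φ₁^[i] u₁) = SignType.sign (φ₁^[i] w₁))
    (hN : SignType.sign (φ₁^[N] u₁) ≠ SignType.sign (φ₁^[N] w₁)) :
    SignType.sign (u₁ - w₁) = SignType.sign (u₂ - w₂) := by
  rw [hφ₁.sign_sub_eq hne hs, hφ₂.sign_sub_eq (N := N) (u := u₂) (w := w₂), sign_sub_of_sign_ne hN,
    sign_sub_of_sign_ne (by rwa [← hu N le_rfl, ← hw N le_rfl]), hu N le_rfl, hw N le_rfl]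
  · congr 1
    refine Finset.prod_congr rfl fun i hi => ?_
    exact hu i (Finset.mem_range.1 hi).le
  · intro i hi
    rw [← sign_ne_zero, ← hu i hi.le, sign_ne_zero]
    exact hne i hi
  · intro i hi
    rw [← hu i hi.le, ← hw i hi.le, hs i hi]

/-- Itineraries ending at the turning point are transported between maps with the same kneading
data. -/
lemma exists_same_signs (hφ₁ : EvenMono φ₁) (hφ₂ : EvenMono φ₂)
    (hk : ∀ j, SignType.sign (φ₁^[j] 0) = SignType.sign (φ₂^[j] 0)) (k : ℕ) :
    ∀ x, φ₁^[k] x = 0 → (∀ i < k, φ₁^[i] x ≠ 0) →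
      ∃ x', ∀ i ≤ k, SignType.sign (φ₁^[i] x) = SignType.sign (φ₂^[i] x') := by
  classical
  induction k with
  | zero =>
    intro x hx _
    refine ⟨0, fun i hi => ?_⟩
    obtain rfl : i = 0 := by omega
    rw [hx]; rfl
  | succ k ih =>
    intro x hx hne
    obtain ⟨y', hy'⟩ := ih (φ₁ x) hx fun i hi => hne (i + 1) (by omega)
    have hx0 : x ≠ 0 := hne 0 (by omega)
    have hpos := hφ₁.zero_lt hx0
    have hlt : φ₂ 0 < y' := by
      have hkv : ∀ i, SignType.sign (φ₁^[i] (φ₁ 0)) = SignType.sign (φ₂^[i] (φ₂ 0)) :=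
        fun i => hk (i + 1)
      by_cases hex : ∃ N, N ≤ k ∧ SignType.sign (φ₁^[N] (φ₁ x)) ≠ SignType.sign (φ₁^[N] (φ₁ 0))
      · have hN := Nat.find_spec hex
        have hmin : ∀ i < Nat.find hex,
            SignType.sign (φ₁^[i] (φ₁ x)) = SignType.sign (φ₁^[i] (φ₁ 0)) := fun i hi => by
          by_contra hcon
          exact Nat.find_min hex hi ⟨by omega, hcon⟩
        have h1 := hφ₁.sign_sub_congr hφ₂ (N := Nat.find hex) (u₁ := φ₁ x) (w₁ := φ₁ 0) (u₂ := y')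
          (w₂ := φ₂ 0) (fun i hi => hy' i (by omega)) (fun i _ => hkv i)
          (fun i hi => hne (i + 1) (by omega)) hmin hN.2
        rw [sign_pos (sub_pos.2 hpos)] at h1
        exact sub_pos.1 (sign_eq_one_iff.1 h1.symm)
      · push Not at hex
        have h1 : φ₁^[k] (φ₁ 0) = 0 := by
          have h2 := hex k le_rfl
          rw [show φ₁^[k] (φ₁ x) = 0 from hx, sign_zero] at h2
          exact sign_eq_zero_iff.1 h2.symm
        have := hφ₁.eq_of_signs (k := k) (x := φ₁ x) (y := φ₁ 0)
          (by rw [h1]; exact hx) fun i hi => hex i hi.le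
        exact absurd this hpos.ne'
    obtain ⟨z, hz, hzy⟩ := hφ₂.surj y' hlt.le
    have hz0 : 0 < z := by
      refine lt_of_le_of_ne hz ?_
      rintro rfl
      exact hlt.ne hzy
    have hmain : ∀ z', φ₂ z' = y' → SignType.sign x = SignType.sign z' →
        ∀ i ≤ k + 1, SignType.sign (φ₁^[i] x) = SignType.sign (φ₂^[i] z') := by
      intro z' h1 h2 i hi
      cases i with
      | zero => exact h2
      | succ i =>
        rw [Function.iterate_succ_apply, Function.iterate_succ_apply, h1]
        exact hy' i (by omega)
    rcases lt_or_gt_of_ne hx0 with h1 | h1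
    · exact ⟨-z, hmain _ (by rw [hφ₂.even, hzy]) (by rw [sign_neg h1, sign_neg (by linarith)])⟩
    · exact ⟨z, hmain _ hzy (by rw [sign_pos h1, sign_pos hz0])⟩

/-- The counting function depends only on the kneading data. -/
theorem nz_eq_of_kneading (hφ₁ : EvenMono φ₁) (hφ₂ : EvenMono φ₂)
    (hk : ∀ j, SignType.sign (φ₁^[j] 0) = SignType.sign (φ₂^[j] 0)) (n : ℕ) :
    nz φ₁ n = nz φ₂ n :=
  le_antisymm (hφ₁.nz_le hφ₂ fun k _ => hφ₁.exists_same_signs hφ₂ hk k)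
    (hφ₂.nz_le hφ₁ fun k _ => hφ₂.exists_same_signs hφ₁ (fun j => (hk j).symm) k)

end EvenMono

/-- The counting function of the quadratic family decreases with the parameter. -/
theorem nz_fa_antitone {a₁ a₂ : ℝ} (h12 : a₁ ≤ a₂) (n : ℕ) : nz (fa a₂) n ≤ nz (fa a₁) n := by
  refine (evenMono_fa a₂).nz_le (evenMono_fa a₁) fun k _ x hx hne => ?_
  have h1 := pullOK_orbit hx hne
  have h2 := pullOK_antitone (bsign_eq _ k) h12 h1
  exact ⟨_, fun i hi => sign_iterate_pull hx hne h2 hi⟩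

/-- If no parameter in `(a₁, a₂]` is superstable, the counting function is constant there. -/
theorem nz_fa_eq_of_no_superstable {a₁ a₂ : ℝ} (h12 : a₁ ≤ a₂)
    (hno : ∀ A ∈ Ioc a₁ a₂, ∀ p, 1 ≤ p → co A p ≠ 0) (n : ℕ) : nz (fa a₁) n = nz (fa a₂) n := by
  refine le_antisymm ?_ (nz_fa_antitone h12 n)
  refine (evenMono_fa a₁).nz_le (evenMono_fa a₂) fun k _ x hx hne => ?_
  have h1 := pullOK_orbit hx hne
  set ε := bsign (fun i => (fa a₁)^[i] x) k with hε
  have hε' : ∀ j, ε j = 1 ∨ ε j = -1 := bsign_eq _ k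
  have key : ∀ l ≤ k, PullOK ε a₂ l := by
    intro l
    induction l with
    | zero => intro _ i hi; omega
    | succ l ih =>
      intro hl
      have hl' := ih (by omega)
      rw [pullOK_succ]
      refine ⟨hl', ?_⟩
      by_contra hcon
      push Not at hcon
      have hcont : ContinuousOn (fun a => pull ε a l - a) (Icc a₁ a₂) := fun a ha =>
        ((hasDerivAt_pull hε' (pullOK_antitone hε' ha.2 hl')).sub
          (hasDerivAt_id a)).continuousAt.continuousWithinAt
      have hpos : 0 < pull ε a₁ l - a₁ := sub_pos.2 (h1 l (by omega))
      obtain ⟨A, hA, hA0⟩ := intermediate_value_Icc' h12 hcont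
        (show (0 : ℝ) ∈ Icc _ _ from ⟨sub_nonpos.2 hcon, hpos.le⟩)
      have hne1 : a₁ ≠ A := by
        rintro rfl
        exact hpos.ne' hA0
      exact hno A ⟨lt_of_le_of_ne hA.1 hne1, hA.2⟩ (l + 1) (by omega)
        (pull_period hε' (pullOK_antitone hε' hA.2 hl') (sub_eq_zero.1 hA0)).1
  exact ⟨_, fun i hi => sign_iterate_pull hx hne (key k le_rfl) hi⟩

/-! ### Entropy and the growth of the number of preimages of the turning point -/

open ExpGrowth in
lemma expGrowthSup_le_of_subexp {u : ℕ → ENNReal} {X : EReal}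
    (H : ∀ c : ℝ, 1 < c → ∃ v : ℕ → ENNReal, expGrowthSup v ≤ X ∧ ∃ C : ENNReal, C ≠ ⊤ ∧
      ∀ᶠ n in atTop, u n ≤ C * (ENNReal.ofReal c ^ n * v n)) :
    expGrowthSup u ≤ X := by
  rw [← EReal.le_of_forall_lt_iff_le]
  intro z hz
  induction X with
  | top => simp at hz
  | bot =>
    obtain ⟨v, hv, C, hC, hle⟩ := H 2 (by norm_num)
    have h1 := expGrowthSup_le_of_eventually_le (v := (fun n => ENNReal.ofReal 2 ^ n) * v) hC hle
    have h2 : expGrowthSup (fun n : ℕ => ENNReal.ofReal 2 ^ n) = (Real.log 2 : ℝ) := by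
      rw [expGrowthSup_pow, ENNReal.log_ofReal_of_pos (by norm_num)]
    have h3 := expGrowthSup_mul_le (u := fun n : ℕ => ENNReal.ofReal 2 ^ n) (v := v)
      (Or.inl (by rw [h2]; exact EReal.coe_ne_bot _)) (Or.inl (by rw [h2]; exact EReal.coe_ne_top _))
    rw [le_bot_iff.1 hv, EReal.add_bot] at h3
    exact (h1.trans h3).trans bot_le
  | coe x =>
    have hxz : x < z := by exact_mod_cast hz
    have hc : 1 < Real.exp (z - x) := Real.one_lt_exp_iff.2 (by linarith)
    obtain ⟨v, hv, C, hC, hle⟩ := H _ hc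
    have h1 := expGrowthSup_le_of_eventually_le
      (v := (fun n => ENNReal.ofReal (Real.exp (z - x)) ^ n) * v) hC hle
    have h2 : expGrowthSup (fun n : ℕ => ENNReal.ofReal (Real.exp (z - x)) ^ n) = (z - x : ℝ) := by
      rw [expGrowthSup_pow, ENNReal.log_ofReal_of_pos (Real.exp_pos _), Real.log_exp]
    have h3 := expGrowthSup_mul_le (u := fun n : ℕ => ENNReal.ofReal (Real.exp (z - x)) ^ n) (v := v)
      (Or.inl (by rw [h2]; exact EReal.coe_ne_bot _)) (Or.inl (by rw [h2]; exact EReal.coe_ne_top _))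
    refine (h1.trans h3).trans ?_
    rw [h2]
    calc ((z - x : ℝ) : EReal) + expGrowthSup v ≤ ((z - x : ℝ) : EReal) + x := by gcongr
      _ = z := by rw [← EReal.coe_add]; simp

lemma exists_nat_le_pow {c : ℝ} (hc : 1 < c) : ∃ C : ℝ, 0 < C ∧ ∀ n : ℕ, (n : ℝ) ≤ C * c ^ n := by
  refine ⟨1 / (c - 1), by apply one_div_pos.2; linarith, fun n => ?_⟩
  have := one_add_mul_le_pow (a := c - 1) (by linarith) n
  have h2 : (n : ℝ) * (c - 1) ≤ c ^ n := by
    rw [show 1 + (c - 1) = c by ring] at this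
    linarith
  rw [one_div, inv_mul_eq_div, le_div_iff₀ (by linarith)]
  exact h2

lemma card_le_of_interlacing {P Z : Finset ℝ}
    (H : ∀ x ∈ P, ∀ y ∈ P, x < y → ∃ z ∈ Z, x ≤ z ∧ z ≤ y) : P.card ≤ 2 * Z.card + 1 := by
  classical
  rw [← Finset.card_range (2 * Z.card + 1)]
  have hmono : ∀ x ∈ P, ∀ y ∈ P, x < y →
      (Z.filter (· < x)).card + (Z.filter (· ≤ x)).card <
        (Z.filter (· < y)).card + (Z.filter (· ≤ y)).card := by
    intro x hx y hy hxy
    obtain ⟨z, hz, h1, h2⟩ := H x hx y hy hxy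
    have s1 : Z.filter (· < x) ⊆ Z.filter (· < y) := fun w hw => by
      rw [Finset.mem_filter] at hw ⊢; exact ⟨hw.1, hw.2.trans hxy⟩
    have s2 : Z.filter (· ≤ x) ⊆ Z.filter (· ≤ y) := fun w hw => by
      rw [Finset.mem_filter] at hw ⊢; exact ⟨hw.1, hw.2.trans hxy.le⟩
    rcases h1.eq_or_lt with h | h
    · have : (Z.filter (· < x)).card < (Z.filter (· < y)).card := by
        refine Finset.card_lt_card ⟨s1, fun hs => ?_⟩
        have := hs (Finset.mem_filter.2 ⟨hz, h ▸ hxy⟩)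
        rw [Finset.mem_filter] at this
        exact absurd this.2 (by rw [h]; exact lt_irrefl _)
      have := Finset.card_le_card s2
      omega
    · have : (Z.filter (· ≤ x)).card < (Z.filter (· ≤ y)).card := by
        refine Finset.card_lt_card ⟨s2, fun hs => ?_⟩
        have := hs (Finset.mem_filter.2 ⟨hz, h2⟩)
        rw [Finset.mem_filter] at this
        exact absurd this.2 (not_le.2 h)
      have := Finset.card_le_card s1
      omega
  refine Finset.card_le_card_of_injOn
    (fun x => (Z.filter (· < x)).card + (Z.filter (· ≤ x)).card) ?_ ?_
  · intro x _
    have h1 := Finset.card_filter_le Z (· < x)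
    have h2 := Finset.card_filter_le Z (· ≤ x)
    simp only [Finset.coe_range, mem_Iio]
    omega
  · intro x hx y hy hxy
    by_contra hne
    rcases lt_or_gt_of_ne hne with h | h
    · exact (hmono x hx y hy h).ne hxy
    · exact (hmono y hy x hx h).ne hxy.symm

lemma EvenMono.exists_zset_between {φ : ℝ → ℝ} (hφ : EvenMono φ) (hc : Continuous φ) {k : ℕ}
    {x y : ℝ} (hxy : x < y) (he : φ^[k] x = φ^[k] y) : ∃ z ∈ zset φ k, x ≤ z ∧ z ≤ y := by
  by_contra hno
  push Not at hno
  refine hxy.ne (hφ.eq_of_signs he fun i hi => ?_)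
  by_contra hs
  have hcont : ContinuousOn (φ^[i]) (Icc x y) := (hc.iterate i).continuousOn
  have hmem : ∀ z ∈ Icc x y, φ^[i] z ≠ 0 := fun z hz h0 =>
    absurd hz.2 (not_le.2 (hno z ⟨i, hi, h0⟩ hz.1))
  have hx0 := hmem x (left_mem_Icc.2 hxy.le)
  have hy0 := hmem y (right_mem_Icc.2 hxy.le)
  rcases lt_or_gt_of_ne hx0 with h1 | h1 <;> rcases lt_or_gt_of_ne hy0 with h2 | h2
  · exact hs (by rw [sign_neg h1, sign_neg h2])
  · obtain ⟨z, hz, h0⟩ := intermediate_value_Icc hxy.le hcont ⟨h1.le, h2.le⟩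
    exact hmem z hz h0
  · obtain ⟨z, hz, h0⟩ := intermediate_value_Icc' hxy.le hcont ⟨h2.le, h1.le⟩
    exact hmem z hz h0
  · exact hs (by rw [sign_pos h1, sign_pos h2])

lemma zset_mono (φ : ℝ → ℝ) : Monotone (zset φ) := fun _ _ hmn _ ⟨k, hk, h0⟩ =>
  ⟨k, hk.trans_le hmn, h0⟩

lemma EvenMono.nz_mono {φ : ℝ → ℝ} (hφ : EvenMono φ) : Monotone (nz φ) := fun _ _ hmn =>
  Set.ncard_le_ncard (zset_mono φ hmn) (hφ.finite_zset _)

lemma EvenMono.one_le_nz {φ : ℝ → ℝ} (hφ : EvenMono φ) {n : ℕ} (hn : 1 ≤ n) : 1 ≤ nz φ n := by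
  refine (Set.ncard_pos (hφ.finite_zset n)).2 ⟨0, 0, hn, rfl⟩

lemma EvenMono.card_fiber_le {φ : ℝ → ℝ} (hφ : EvenMono φ) (hc : Continuous φ) {k : ℕ} {y : ℝ} :
    {x | φ^[k] x = y}.ncard ≤ 2 * nz φ k + 1 := by
  classical
  rw [Set.ncard_eq_toFinset_card _ (hφ.finite_iterate_fiber k y), nz,
    Set.ncard_eq_toFinset_card _ (hφ.finite_zset k)]
  refine card_le_of_interlacing fun x hx y hy hxy => ?_
  simp only [Set.Finite.mem_toFinset, Set.mem_ofPred_eq] at hx hy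
  obtain ⟨z, hz, h⟩ := hφ.exists_zset_between hc hxy (hx.trans hy.symm)
  exact ⟨z, by simpa using hz, h⟩

lemma continuous_fa (a : ℝ) : Continuous (fa a) := by unfold fa; fun_prop

/-! #### The invariant interval -/

/-- The repelling fixed point of `f_a`. -/
noncomputable def beta (a : ℝ) : ℝ := (1 + √(1 - 4 * a)) / 2

lemma Ia_eq (a : ℝ) : Ia a = Icc (-beta a) (beta a) := by
  rw [Ia, beta]; congr 1; ring

lemma beta_sq {a : ℝ} (ha : a ≤ 1 / 4) : beta a ^ 2 + a = beta a := by
  have := Real.sq_sqrt (show (0:ℝ) ≤ 1 - 4 * a by linarith)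
  unfold beta; nlinarith

lemma beta_pos (a : ℝ) : 1 / 2 ≤ beta a := by
  have := Real.sqrt_nonneg (1 - 4 * a)
  unfold beta; linarith

lemma beta_le {a : ℝ} (ha : -2 ≤ a) : beta a ≤ 2 := by
  have : √(1 - 4 * a) ≤ 3 := by
    rw [Real.sqrt_le_left (by norm_num)]; linarith
  unfold beta; linarith

lemma mapsTo_Ia {a : ℝ} (ha : a ∈ Icc (-2) (1 / 4 : ℝ)) : MapsTo (fa a) (Ia a) (Ia a) := by
  rw [Ia_eq]
  intro x hx
  have h1 := beta_sq ha.2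
  have h2 := beta_pos a
  have h3 := beta_le ha.1
  constructor
  · simp only [fa]; nlinarith [hx.1, hx.2, sq_nonneg x]
  · simp only [fa]
    have := abs_le.2 hx
    have := sq_abs x
    nlinarith [abs_nonneg x]

lemma zset_subset_Ia {a : ℝ} (ha : a ≤ 1 / 4) (n : ℕ) : zset (fa a) n ⊆ Ia a := by
  rw [Ia_eq]
  rintro x ⟨k, -, h0⟩
  rw [mem_Icc, ← abs_le]
  by_contra hx
  push Not at hx
  have h1 := beta_sq ha
  have h2 := beta_pos a
  have key : ∀ k, beta a < |(fa a)^[k] x| := by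
    intro k
    induction k with
    | zero => exact hx
    | succ k ih =>
      rw [Function.iterate_succ_apply', fa]
      have h4 := sq_abs ((fa a)^[k] x)
      refine lt_of_lt_of_le ?_ (le_abs_self _)
      nlinarith
  have := key k
  rw [h0, abs_zero] at this
  linarith

/-- Every point of `[l, r]` lies between two neighbours of a finite `ε`-dense set. -/
lemma exists_grid {l r ε : ℝ} (hε : 0 < ε) : ∃ G : Finset ℝ, l ∈ G ∧
    ∀ x ∈ Icc l r, x ∉ G → ∃ g ∈ G, ∃ g' ∈ G, g < x ∧ x < g' ∧ g' - g ≤ ε := by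
  classical
  obtain ⟨M, hM⟩ := exists_nat_gt ((r - l) / ε)
  refine ⟨(Finset.range (M + 2)).image fun i : ℕ => l + i * ε,
    Finset.mem_image.2 ⟨0, by simp, by simp⟩, fun x hx hxG => ?_⟩
  have h0 : 0 ≤ (x - l) / ε := div_nonneg (by linarith [hx.1]) hε.le
  have h1 := Nat.floor_le h0
  have h2 := Nat.lt_floor_add_one ((x - l) / ε)
  rw [le_div_iff₀ hε] at h1
  rw [div_lt_iff₀ hε] at h2
  rw [div_lt_iff₀ hε] at hM
  have h3 : ⌊(x - l) / ε⌋₊ < M := by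
    have : (⌊(x - l) / ε⌋₊ : ℝ) * ε < M * ε := by linarith [hx.2]
    exact_mod_cast lt_of_mul_lt_mul_right this hε.le
  refine ⟨_, Finset.mem_image.2 ⟨⌊(x - l) / ε⌋₊, by simp; omega, rfl⟩, _,
    Finset.mem_image.2 ⟨⌊(x - l) / ε⌋₊ + 1, by simp; omega, rfl⟩, ?_, ?_, ?_⟩
  · rcases (show l + (⌊(x - l) / ε⌋₊ : ℝ) * ε ≤ x by linarith).lt_or_eq with h | h
    · exact h
    · exact absurd (Finset.mem_image.2 ⟨⌊(x - l) / ε⌋₊, by simp; omega, h⟩) hxG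
  · push_cast; linarith
  · push_cast; linarith

open Dynamics ExpGrowth in
lemma coverEntropy_le_nz {a : ℝ} (ha : a ∈ Icc (-2) (1 / 4 : ℝ)) :
    coverEntropy (fa a) (Ia a) ≤ expGrowthSup fun n => (nz (fa a) n : ENNReal) := by
  classical
  rw [coverEntropy_eq_iSup_basis Metric.uniformity_basis_dist_le]
  refine iSup₂_le fun ε hε => ?_
  obtain ⟨G, hl, hG⟩ := exists_grid (l := -beta a) (r := beta a) hε
  have hφ := evenMono_fa a
  have hc := continuous_fa a
  let D : ℕ → Finset ℝ := fun n => (Finset.range n).biUnion fun k => G.biUnion fun g =>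
    (hφ.finite_iterate_fiber k g).toFinset
  have memD : ∀ n x, x ∈ D n ↔ ∃ k < n, (fa a)^[k] x ∈ G := by
    intro n x
    simp only [D, Finset.mem_biUnion, Finset.mem_range, Set.Finite.mem_toFinset]
    constructor
    · rintro ⟨k, hk, g, hg, h⟩; exact ⟨k, hk, by rw [show (fa a)^[k] x = g from h]; exact hg⟩
    · rintro ⟨k, hk, h⟩; exact ⟨k, hk, _, h, rfl⟩
  have hcover : ∀ n, 1 ≤ n → IsDynCoverOf (fa a) (Ia a) {p : ℝ × ℝ | dist p.1 p.2 ≤ ε} n (D n) := by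
    intro n hn x hx
    rw [Ia_eq] at hx
    have hne : ((D n).filter (· ≤ x)).Nonempty :=
      ⟨-beta a, Finset.mem_filter.2 ⟨(memD n _).2 ⟨0, hn, hl⟩, hx.1⟩⟩
    obtain ⟨y, hy, hmax⟩ := Finset.exists_max_image _ id hne
    obtain ⟨hyD, hyx⟩ := Finset.mem_filter.1 hy
    refine ⟨y, hyD, ?_⟩
    rw [mem_dynEntourage]
    intro k hk
    change dist _ _ ≤ ε
    rcases hyx.eq_or_lt with rfl | hlt
    · simp [hε.le]
    have hno : ∀ z, y < z → z ≤ x → (fa a)^[k] z ∉ G := fun z h1 h2 h3 =>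
      absurd (hmax z (Finset.mem_filter.2 ⟨(memD n z).2 ⟨k, hk, h3⟩, h2⟩)) (not_le.2 h1)
    have hkx : (fa a)^[k] x ∈ Icc (-beta a) (beta a) := by
      rw [← Ia_eq]; exact (mapsTo_Ia ha).iterate k (by rw [Ia_eq]; exact hx)
    obtain ⟨g, hg, g', hg', h1, h2, h3⟩ := hG _ hkx (hno x hlt le_rfl)
    have hcont : ContinuousOn ((fa a)^[k]) (Icc y x) := (hc.iterate k).continuousOn
    have hgy : g ≤ (fa a)^[k] y := by
      by_contra hcon
      push Not at hcon
      obtain ⟨z, hz, h0⟩ := intermediate_value_Icc hyx hcont ⟨hcon.le, h1.le⟩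
      have : y < z := lt_of_le_of_ne hz.1 (by rintro rfl; linarith)
      exact hno z this hz.2 (by rw [h0]; exact hg)
    have hgy' : (fa a)^[k] y ≤ g' := by
      by_contra hcon
      push Not at hcon
      obtain ⟨z, hz, h0⟩ := intermediate_value_Icc' hyx hcont ⟨h2.le, hcon.le⟩
      have : y < z := lt_of_le_of_ne hz.1 (by rintro rfl; linarith)
      exact hno z this hz.2 (by rw [h0]; exact hg')
    rw [Real.dist_eq, abs_le]
    constructor <;> linarith
  have hcard : ∀ n, 1 ≤ n → (D n).card ≤ n * (G.card * (3 * nz (fa a) n)) := by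
    intro n hn
    refine (Finset.card_biUnion_le_card_mul _ _ (G.card * (3 * nz (fa a) n)) fun k hk => ?_).trans
      (by rw [Finset.card_range])
    refine Finset.card_biUnion_le_card_mul _ _ _ fun g _ => ?_
    have h1 := hφ.card_fiber_le hc (k := k) (y := g)
    rw [Set.ncard_eq_toFinset_card _ (hφ.finite_iterate_fiber k g)] at h1
    have h2 := hφ.nz_mono (Finset.mem_range.1 hk).le
    have h3 := hφ.one_le_nz hn
    omega
  refine expGrowthSup_le_of_subexp fun c hc1 => ⟨_, le_rfl, ?_⟩
  obtain ⟨C, hC, hCn⟩ := exists_nat_le_pow hc1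
  refine ⟨ENNReal.ofReal (C * (G.card * 3)), ENNReal.ofReal_ne_top, ?_⟩
  filter_upwards [eventually_ge_atTop 1] with n hn
  have h1 : coverMincard (fa a) (Ia a) {p : ℝ × ℝ | dist p.1 p.2 ≤ ε} n ≤
      ((n * (G.card * (3 * nz (fa a) n)) : ℕ) : ℕ∞) :=
    (hcover n hn).coverMincard_le_card.trans (by exact_mod_cast hcard n hn)
  refine (ENat.toENNReal_mono h1).trans ?_
  rw [ENat.toENNReal_coe, ← ENNReal.ofReal_natCast, ← ENNReal.ofReal_natCast (nz (fa a) n),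
    ← ENNReal.ofReal_pow (by linarith), ← ENNReal.ofReal_mul (by positivity),
    ← ENNReal.ofReal_mul (by positivity)]
  refine ENNReal.ofReal_le_ofReal ?_
  push_cast
  have : (n : ℝ) * (G.card * (3 * nz (fa a) n)) ≤ (C * c ^ n) * (G.card * (3 * nz (fa a) n)) :=
    mul_le_mul_of_nonneg_right (hCn n) (by positivity)
  linarith

lemma differentiable_fa (a : ℝ) : Differentiable ℝ (fa a) := by unfold fa; fun_prop

lemma hasDerivAt_iterate_zero (a : ℝ) {p : ℕ} (hp : 1 ≤ p) : HasDerivAt ((fa a)^[p]) 0 0 := by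
  obtain ⟨q, rfl⟩ := Nat.exists_eq_add_of_le' hp
  have h1 : HasDerivAt (fa a) 0 0 := by
    have := ((hasDerivAt_id (0 : ℝ)).fun_pow 2).add_const a
    simp only [id, mul_zero, zero_mul, Nat.add_one_sub_one, pow_one] at this
    exact this
  have h2 := (((differentiable_fa a).iterate q) (fa a 0)).hasDerivAt.comp (0 : ℝ) h1
  rw [mul_zero] at h2
  exact h2

lemma EvenMono.card_le_three_pow {φ : ℝ → ℝ} (hφ : EvenMono φ) {n : ℕ} {S : Finset ℝ}
    {T : Finset ℕ} (hS : ∀ z ∈ S, z ∈ zset φ n)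
    (hT : ∀ i < n, i ∉ T → ∀ z ∈ S, ∀ z' ∈ S, SignType.sign (φ^[i] z) = SignType.sign (φ^[i] z')) :
    S.card ≤ 3 ^ T.card := by
  classical
  have h3 : (Finset.univ : Finset (T → SignType)).card = 3 ^ T.card := by
    rw [Finset.card_univ, Fintype.card_fun, Fintype.card_coe]; rfl
  rw [← h3]
  refine Finset.card_le_card_of_injOn (fun z (i : T) => SignType.sign (φ^[i] z))
    (fun _ _ => by simp) fun z hz z' hz' hzz => ?_
  obtain ⟨k, hk, h0⟩ := hS z hz
  have hall : ∀ i < n, SignType.sign (φ^[i] z) = SignType.sign (φ^[i] z') := by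
    intro i hi
    by_cases hiT : i ∈ T
    · exact congrFun hzz ⟨i, hiT⟩
    · exact hT i hi hiT z hz z' hz'
  have h1 := hall k hk
  rw [h0, sign_zero] at h1
  exact hφ.eq_of_signs (h0.trans (sign_eq_zero_iff.1 h1.symm).symm) fun i hi => hall i (hi.trans hk)

lemma sign_eq_of_dist_le {u w ε : ℝ} (h1 : dist u w ≤ ε) (h2 : ε < |w|) :
    SignType.sign u = SignType.sign w := by
  rw [Real.dist_eq, abs_le] at h1
  rcases lt_abs.1 h2 with h | h
  · rw [sign_pos (show 0 < w by linarith [h1.2]), sign_pos (show 0 < u by linarith)]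
  · rw [sign_neg (show w < 0 by linarith [h1.2]), sign_neg (show u < 0 by linarith)]

open Dynamics in
lemma nz_le_coverMincard {a : ℝ} (ha : a ≤ 1 / 4) {ε : ℝ} {n B : ℕ} (hB1 : 1 ≤ B)
    (hB : ∀ y : ℝ, ∀ S : Finset ℝ, (∀ z ∈ S, z ∈ zset (fa a) n) →
      (∀ z ∈ S, ∀ k < n, dist ((fa a)^[k] z) ((fa a)^[k] y) ≤ ε) → S.card ≤ B) :
    (nz (fa a) n : ENNReal) ≤ B * (coverMincard (fa a) (Ia a) {p : ℝ × ℝ | dist p.1 p.2 ≤ ε} n) := by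
  classical
  rcases eq_or_ne (coverMincard (fa a) (Ia a) {p : ℝ × ℝ | dist p.1 p.2 ≤ ε} n) ⊤ with h | h
  · rw [h, ENat.toENNReal_top, ENNReal.mul_top (by exact_mod_cast (by omega : B ≠ 0))]
    exact le_top
  · obtain ⟨s, hs, hcard⟩ := (coverMincard_finite_iff _ _ _ _).1 (lt_top_iff_ne_top.2 h)
    rw [← hcard, ENat.toENNReal_coe]
    have hfin := (evenMono_fa a).finite_zset n
    have hsub : hfin.toFinset ⊆ s.biUnion fun y => hfin.toFinset.filter fun z =>
        ∀ k < n, dist ((fa a)^[k] z) ((fa a)^[k] y) ≤ ε := by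
      intro z hz
      have hz' : z ∈ zset (fa a) n := by simpa using hz
      obtain ⟨y, hy, hzy⟩ := hs (zset_subset_Ia ha n hz')
      exact Finset.mem_biUnion.2 ⟨y, hy, Finset.mem_filter.2 ⟨hz, mem_dynEntourage.1 hzy⟩⟩
    have : nz (fa a) n ≤ s.card * B := by
      rw [nz, Set.ncard_eq_toFinset_card _ hfin]
      refine (Finset.card_le_card hsub).trans (Finset.card_biUnion_le_card_mul _ _ _ fun y _ => ?_)
      refine hB y _ (fun z hz => ?_) fun z hz => (Finset.mem_filter.1 hz).2
      simpa using (Finset.mem_filter.1 hz).1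
    calc (nz (fa a) n : ENNReal) ≤ ((s.card * B : ℕ) : ENNReal) := by exact_mod_cast this
      _ = B * s.card := by push_cast; ring

lemma exists_radius_of_nonperiodic {a : ℝ} (h : ∀ p, 1 ≤ p → co a p ≠ 0) (K : ℕ) :
    ∃ ε > 0, ∀ i, 1 ≤ i → i ≤ K → ∀ x, |x| ≤ ε → ε < |(fa a)^[i] x| := by
  have key : ∀ i ∈ Finset.Icc 1 K, ∀ᶠ ε in nhdsWithin (0 : ℝ) (Ioi 0),
      ∀ x, |x| ≤ ε → ε < |(fa a)^[i] x| := by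
    intro i hi
    have h0 : 0 < |(fa a)^[i] 0| := abs_pos.2 (h i (Finset.mem_Icc.1 hi).1)
    have hc : ContinuousAt (fun x => |(fa a)^[i] x|) 0 :=
      ((continuous_fa a).iterate i).abs.continuousAt
    obtain ⟨δ, hδ, hball⟩ := Metric.eventually_nhds_iff.1
      (hc.eventually (lt_mem_nhds (half_lt_self h0)))
    filter_upwards [Ioo_mem_nhdsGT (lt_min hδ (half_pos h0))] with ε hε x hx
    have h1 := hball (y := x) (by
      rw [Real.dist_eq, sub_zero]; exact hx.trans_lt (hε.2.trans_le (min_le_left _ _)))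
    exact (hε.2.trans_le (min_le_right _ _)).trans h1
  obtain ⟨ε, hε, hpos⟩ := (((Finset.eventually_all _).2 key).and self_mem_nhdsWithin).exists
  exact ⟨ε, hpos, fun i h1 h2 => hε i (Finset.mem_Icc.2 ⟨h1, h2⟩)⟩

lemma exists_radius_of_periodic {a : ℝ} {p : ℕ} (hp : 1 ≤ p) (h0 : co a p = 0) :
    ∃ ε > 0, ∀ x, |x| ≤ 2 * ε → x ≠ 0 → ∀ j, (fa a)^[j] x ≠ 0 := by
  classical
  have hex : ∃ p, 1 ≤ p ∧ co a p = 0 := ⟨p, hp, h0⟩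
  obtain ⟨q, hq, hmin⟩ : ∃ q, (1 ≤ q ∧ co a q = 0) ∧ ∀ j < q, ¬ (1 ≤ j ∧ co a j = 0) :=
    ⟨Nat.find hex, Nat.find_spec hex, fun j hj => Nat.find_min hex hj⟩
  have hφ := evenMono_fa a
  have e1 : ∀ᶠ x in nhds (0 : ℝ), |(fa a)^[q] x| ≤ |x| := by
    have := (hasDerivAt_iff_isLittleO.1 (hasDerivAt_iterate_zero a hq.1)).bound one_pos
    filter_upwards [this] with x hx
    rw [show (fa a)^[q] 0 = 0 from hq.2] at hx
    simpa using hx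
  have e2 : ∀ i ∈ Finset.Ico 1 q, ∀ᶠ x in nhds (0 : ℝ),
      SignType.sign ((fa a)^[i] x) = SignType.sign ((fa a)^[i] 0) := by
    intro i hi
    have hi' := Finset.mem_Ico.1 hi
    have hne : (fa a)^[i] 0 ≠ 0 := fun h => hmin i hi'.2 ⟨hi'.1, h⟩
    have hc : ContinuousAt ((fa a)^[i]) 0 := ((continuous_fa a).iterate i).continuousAt
    rcases lt_or_gt_of_ne hne with h | h
    · filter_upwards [hc.eventually (gt_mem_nhds h)] with x hx
      rw [sign_neg h, sign_neg hx]
    · filter_upwards [hc.eventually (lt_mem_nhds h)] with x hx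
      rw [sign_pos h, sign_pos hx]
  obtain ⟨δ, hδ, hball⟩ := Metric.eventually_nhds_iff.1 (e1.and ((Finset.eventually_all _).2 e2))
  have hqne : ∀ x, |x| < δ → x ≠ 0 → (fa a)^[q] x ≠ 0 := by
    intro x hx hne h
    have hs := (hball (y := x) (by simpa using hx)).2
    obtain ⟨r, rfl⟩ := Nat.exists_eq_add_of_le' hq.1
    have h1 : fa a x = fa a 0 := by
      refine hφ.eq_of_signs (k := r) (h.trans hq.2.symm) fun i hi => ?_
      exact hs (i + 1) (Finset.mem_Ico.2 ⟨by omega, by omega⟩)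
    have := hφ.abs_eq_of_eq h1
    rw [abs_zero] at this
    exact hne (abs_eq_zero.1 this)
  have main : ∀ j x, |x| < δ → x ≠ 0 → (fa a)^[j] x ≠ 0 := by
    intro j
    induction j using Nat.strong_induction_on with
    | _ j ih =>
      intro x hx hne
      rcases lt_or_ge j q with hj | hj
      · rcases Nat.eq_zero_or_pos j with rfl | hj0
        · exact hne
        · have hs := (hball (y := x) (by simpa using hx)).2 j (Finset.mem_Ico.2 ⟨hj0, hj⟩)
          intro h
          rw [h, sign_zero] at hs
          exact hmin j hj ⟨hj0, (sign_eq_zero_iff.1 hs.symm)⟩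
      · obtain ⟨r, rfl⟩ := Nat.exists_eq_add_of_le' hj
        rw [Function.iterate_add_apply]
        refine ih r (by omega) _ ?_ (hqne x hx hne)
        exact ((hball (y := x) (by simpa using hx)).1).trans_lt hx
  refine ⟨δ / 4, by linarith, fun x hx hne j => main j x (by linarith) hne⟩

open Dynamics ExpGrowth in
lemma nz_le_coverEntropy {a : ℝ} (ha : a ∈ Icc (-2) (1 / 4 : ℝ)) :
    (expGrowthSup fun n => (nz (fa a) n : ENNReal)) ≤ coverEntropy (fa a) (Ia a) := by
  classical
  have hφ := evenMono_fa a
  have hent : ∀ ε : ℝ, 0 < ε → (expGrowthSup fun n => ((coverMincard (fa a) (Ia a)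
      {p : ℝ × ℝ | dist p.1 p.2 ≤ ε} n : ENat) : ENNReal)) ≤ coverEntropy (fa a) (Ia a) :=
    fun ε hε => coverEntropyEntourage_le_coverEntropy _ _ (Metric.uniformity_basis_dist_le.mem_of_mem hε)
  refine expGrowthSup_le_of_subexp fun c hc => ?_
  have hc' : 1 ≤ ENNReal.ofReal c := by
    rw [← ENNReal.ofReal_one]; exact ENNReal.ofReal_le_ofReal hc.le
  by_cases hper : ∀ p, 1 ≤ p → co a p ≠ 0
  · obtain ⟨K, hK⟩ := pow_unbounded_of_one_lt 3 hc
    have hK0 : 0 < K := by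
      rcases Nat.eq_zero_or_pos K with rfl | h
      · norm_num at hK
      · exact h
    obtain ⟨ε, hε, hrad⟩ := exists_radius_of_nonperiodic hper K
    refine ⟨_, hent ε hε, 3, by norm_num, Eventually.of_forall fun n => ?_⟩
    have := nz_le_coverMincard (n := n) ha.2 (ε := ε) (B := 3 ^ (n / K + 1)) (Nat.one_le_pow _ _ (by norm_num))
      fun y S hS hdist => by
        have hT : ((Finset.range n).filter fun i => |(fa a)^[i] y| ≤ ε).card ≤ n / K + 1 := by
          rw [← Finset.card_range (n / K + 1)]
          refine Finset.card_le_card_of_injOn (fun i => i / K) ?_ ?_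
          · intro i hi
            have : i < n := by simpa using (Finset.mem_filter.1 hi).1
            have := Nat.div_le_div_right (c := K) this.le
            simp only [Finset.coe_range, mem_Iio]; omega
          · have key : ∀ i j, i < j → |(fa a)^[i] y| ≤ ε → |(fa a)^[j] y| ≤ ε → i / K ≠ j / K := by
              intro i j hij hi hj heq
              have h1 : j - i ≤ K := by
                have h2 := Nat.div_add_mod i K
                have h3 := Nat.div_add_mod j K
                have h4 := Nat.mod_lt j hK0
                rw [heq] at h2
                omega
              have h2 := hrad (j - i) (by omega) h1 _ hi
              rw [← Function.iterate_add_apply, Nat.sub_add_cancel hij.le] at h2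
              exact absurd hj (not_le.2 h2)
            intro i hi j hj hij
            by_contra hne
            rcases lt_or_gt_of_ne hne with hlt | hlt
            · exact key i j hlt (Finset.mem_filter.1 hi).2 (Finset.mem_filter.1 hj).2 hij
            · exact key j i hlt (Finset.mem_filter.1 hj).2 (Finset.mem_filter.1 hi).2 hij.symm
        refine (hφ.card_le_three_pow hS fun i hi hiT z hz z' hz' => ?_).trans
          (Nat.pow_le_pow_right (by norm_num) hT)
        have hlt : ε < |(fa a)^[i] y| := by
          by_contra hcon
          exact hiT (Finset.mem_filter.2 ⟨Finset.mem_range.2 hi, not_lt.1 hcon⟩)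
        rw [sign_eq_of_dist_le (hdist z hz i hi) hlt, sign_eq_of_dist_le (hdist z' hz' i hi) hlt]
    refine this.trans ?_
    rw [← mul_assoc]
    gcongr ?_ * _
    push_cast
    rw [pow_succ, mul_comm]
    gcongr 3 * ?_
    calc (3 : ENNReal) ^ (n / K) ≤ (ENNReal.ofReal c ^ K) ^ (n / K) := by
          gcongr
          rw [← ENNReal.ofReal_pow (by linarith), ← ENNReal.ofReal_ofNat]
          exact ENNReal.ofReal_le_ofReal hK.le
      _ ≤ ENNReal.ofReal c ^ n := by
          rw [← pow_mul]
          exact pow_le_pow_right₀ hc' (Nat.mul_div_le n K)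
  · push Not at hper
    obtain ⟨p, hp, h0⟩ := hper
    obtain ⟨ε, hε, hrad⟩ := exists_radius_of_periodic hp h0
    refine ⟨_, hent ε hε, 1, by norm_num, Eventually.of_forall fun n => ?_⟩
    have := nz_le_coverMincard (n := n) ha.2 (ε := ε) (B := 1) le_rfl fun y S hS hdist => by
      have hhit : ∀ z ∈ S, ∀ i < n, |(fa a)^[i] y| ≤ ε →
          (∀ j < i, ε < |(fa a)^[j] y|) → (fa a)^[i] z = 0 := by
        intro z hz i hi hiy hfirst
        obtain ⟨k, hk, hk0⟩ := hS z hz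
        have hik : i ≤ k := by
          by_contra hcon
          push Not at hcon
          have h1 := hdist z hz k hk
          rw [hk0, dist_comm, Real.dist_eq, sub_zero] at h1
          exact absurd (hfirst k hcon) (not_lt.2 h1)
        by_contra hne
        have h1 := hdist z hz i hi
        rw [Real.dist_eq] at h1
        have h2 : |(fa a)^[i] z| ≤ 2 * ε := by
          have := abs_sub_abs_le_abs_sub ((fa a)^[i] z) ((fa a)^[i] y)
          linarith
        refine hrad _ h2 hne (k - i) ?_
        rw [← Function.iterate_add_apply, Nat.sub_add_cancel hik]
        exact hk0
      have := hφ.card_le_three_pow (T := ∅) hS fun i hi _ z hz z' hz' => by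
        by_cases hex : ∃ j, j ≤ i ∧ |(fa a)^[j] y| ≤ ε
        · have hsp := Nat.find_spec hex
          have hmin : ∀ j < Nat.find hex, ε < |(fa a)^[j] y| := fun j hj => by
            have := Nat.find_min hex hj
            push Not at this
            exact this (hj.le.trans hsp.1)
          have e1 := hhit z hz _ (hsp.1.trans_lt hi) hsp.2 hmin
          have e2 := hhit z' hz' _ (hsp.1.trans_lt hi) hsp.2 hmin
          obtain ⟨r, hr⟩ := Nat.exists_eq_add_of_le' hsp.1
          rw [hr, Function.iterate_add_apply, Function.iterate_add_apply, e1, e2]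
        · push Not at hex
          rw [sign_eq_of_dist_le (hdist z hz i hi) (hex i le_rfl),
            sign_eq_of_dist_le (hdist z' hz' i hi) (hex i le_rfl)]
      simpa using this
    rw [one_mul]
    refine this.trans ?_
    rw [Nat.cast_one, one_mul]
    exact le_mul_of_one_le_left zero_le (one_le_pow₀ hc')

/-- The growth rate of the number of preimages of the turning point. -/
noncomputable def growth (φ : ℝ → ℝ) : EReal := ExpGrowth.expGrowthSup fun n => (nz φ n : ENNReal)

theorem h_eq_growth {a : ℝ} (ha : a ∈ Icc (-2) (1 / 4 : ℝ)) : h a = (growth (fa a)).toReal := by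
  rw [h, growth, le_antisymm (coverEntropy_le_nz ha) (nz_le_coverEntropy ha)]

lemma EvenMono.nz_le_three_pow {φ : ℝ → ℝ} (hφ : EvenMono φ) (n : ℕ) : nz φ n ≤ 3 ^ n := by
  classical
  have hfin := hφ.finite_zset n
  rw [nz, Set.ncard_eq_toFinset_card _ hfin]
  refine (hφ.card_le_three_pow (T := Finset.range n) (fun z hz => by simpa using hz)
    fun i hi hi' => absurd (Finset.mem_range.2 hi) hi').trans (by simp)

lemma growth_ne_top {φ : ℝ → ℝ} (hφ : EvenMono φ) : growth φ ≠ ⊤ := by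
  have : growth φ ≤ ENNReal.log 3 := by
    rw [← ExpGrowth.expGrowthSup_pow]
    refine ExpGrowth.expGrowthSup_monotone fun n => ?_
    exact_mod_cast hφ.nz_le_three_pow n
  refine ne_top_of_le_ne_top ?_ this
  simp

lemma growth_nonneg {φ : ℝ → ℝ} (hφ : EvenMono φ) : 0 ≤ growth φ := by
  rw [← ExpGrowth.expGrowthSup_const (b := 1) (by simp) (by simp)]
  refine ExpGrowth.expGrowthSup_eventually_monotone ?_
  filter_upwards [eventually_ge_atTop 1] with n hn
  exact_mod_cast hφ.one_le_nz hn

theorem h_antitoneOn : AntitoneOn h (Icc (-2) (1 / 4)) := by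
  intro a₁ h₁ a₂ h₂ h12
  rw [h_eq_growth h₁, h_eq_growth h₂]
  refine EReal.toReal_le_toReal ?_ ?_ (growth_ne_top (evenMono_fa a₁))
  · exact ExpGrowth.expGrowthSup_monotone fun n => by exact_mod_cast nz_fa_antitone h12 n
  · exact ne_bot_of_le_ne_bot (by simp) (growth_nonneg (evenMono_fa a₂))

/-! ### Tent maps -/

section tent

variable {b : ℝ}

lemma continuous_tm (b : ℝ) : Continuous (tm b) := by unfold tm; fun_prop

lemma abs_tm_iterate_sub (hb : 0 < b) {x y : ℝ} {n : ℕ}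
    (H : ∀ i < n, 0 ≤ (tm b)^[i] x * (tm b)^[i] y) :
    |(tm b)^[n] x - (tm b)^[n] y| = b ^ n * |x - y| := by
  induction n with
  | zero => simp
  | succ n ih =>
    have h1 := H n (by omega)
    rw [Function.iterate_succ_apply', Function.iterate_succ_apply', pow_succ]
    have e : tm b ((tm b)^[n] x) - tm b ((tm b)^[n] y) =
        b * (|(tm b)^[n] x| - |(tm b)^[n] y|) := by simp only [tm]; ring
    have e2 : |(|(tm b)^[n] x| - |(tm b)^[n] y|)| = |(tm b)^[n] x - (tm b)^[n] y| := by
      rcases mul_nonneg_iff.1 h1 with ⟨ha, hb⟩ | ⟨ha, hb⟩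
      · rw [abs_of_nonneg ha, abs_of_nonneg hb]
      · rw [abs_of_nonpos ha, abs_of_nonpos hb, ← abs_neg]; congr 1; ring
    rw [e, abs_mul, abs_of_pos hb, e2, ih fun i hi => H i (by omega)]
    ring

lemma mul_nonneg_of_no_zero_between {g : ℝ → ℝ} (hg : Continuous g) {x y : ℝ} (hxy : x < y)
    (H : ∀ z, x < z → z < y → g z ≠ 0) : 0 ≤ g x * g y := by
  by_contra hcon
  push Not at hcon
  rcases mul_neg_iff.1 hcon with ⟨h1, h2⟩ | ⟨h1, h2⟩
  · obtain ⟨z, hz, h0⟩ := intermediate_value_Ioo' hxy.le hg.continuousOn ⟨h2, h1⟩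
    exact H z hz.1 hz.2 h0
  · obtain ⟨z, hz, h0⟩ := intermediate_value_Ioo hxy.le hg.continuousOn ⟨h1, h2⟩
    exact H z hz.1 hz.2 h0

lemma tm_mem_Icc (hb : 1 < b) (hb2 : b ≤ 2) {x : ℝ} (hx : |x| ≤ 1 / (b - 1)) (n : ℕ) :
    |(tm b)^[n] x| ≤ 1 / (b - 1) := by
  have hr : b * (1 / (b - 1)) - 1 = 1 / (b - 1) := by field_simp [(by linarith : b - 1 ≠ 0)]; ring
  have h1 : 1 ≤ 1 / (b - 1) := by rw [le_div_iff₀ (by linarith)]; linarith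
  induction n with
  | zero => exact hx
  | succ n ih =>
    rw [Function.iterate_succ_apply', tm, abs_le]
    constructor
    · nlinarith [abs_nonneg ((tm b)^[n] x)]
    · nlinarith

lemma zset_tm_subset (hb : 1 < b) (n : ℕ) {x : ℝ} (hx : x ∈ zset (tm b) n) :
    |x| ≤ 1 / (b - 1) := by
  have hr : b * (1 / (b - 1)) - 1 = 1 / (b - 1) := by field_simp [(by linarith : b - 1 ≠ 0)]; ring
  have h1 : 0 < 1 / (b - 1) := by apply one_div_pos.2; linarith
  obtain ⟨k, -, h0⟩ := hx
  by_contra hcon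
  push Not at hcon
  have key : ∀ k, 1 / (b - 1) < |(tm b)^[k] x| := by
    intro k
    induction k with
    | zero => exact hcon
    | succ k ih =>
      rw [Function.iterate_succ_apply']
      refine lt_of_lt_of_le ?_ (le_abs_self _)
      rw [tm]; nlinarith
  have := key k
  rw [h0, abs_zero] at this
  linarith

lemma pow_le_nz_tm (hb : 1 < b) (hb2 : b ≤ 2) {n : ℕ} (hn : 1 ≤ n) : b ^ n ≤ 6 * nz (tm b) n := by
  classical
  have hφ := evenMono_tm (b := b) (by linarith)
  have hfin := hφ.finite_zset n
  set r := 1 / (b - 1) with hr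
  have hr0 : 0 < r := by apply one_div_pos.2; linarith
  have hbn : 0 < b ^ n := by positivity
  set d := 4 * r / b ^ n with hd
  have hd0 : 0 < d := by positivity
  set M := ⌊2 * r / d⌋₊ with hM
  have hMd : (M : ℝ) * d ≤ 2 * r := by
    have := Nat.floor_le (show 0 ≤ 2 * r / d by positivity)
    rwa [le_div_iff₀ hd0] at this
  have hM1 : b ^ n / 2 < M + 1 := by
    have := Nat.lt_floor_add_one (2 * r / d)
    have e : 2 * r / d = b ^ n / 2 := by rw [hd]; field_simp; ring
    rw [← hM] at this
    rwa [e] at this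
  let P : Finset ℝ := (Finset.range (M + 1)).image fun i : ℕ => -r + i * d
  have hPcard : P.card = M + 1 := by
    rw [Finset.card_image_of_injective, Finset.card_range]
    intro i j hij
    have : (i : ℝ) * d = j * d := by simpa using hij
    exact_mod_cast mul_right_cancel₀ hd0.ne' this
  have hle := card_le_of_interlacing (P := P) (Z := hfin.toFinset) fun x hx y hy hxy => by
    by_contra hno
    push Not at hno
    obtain ⟨i, hi, rfl⟩ := Finset.mem_image.1 hx
    obtain ⟨j, hj, rfl⟩ := Finset.mem_image.1 hy
    have hbd : ∀ i ∈ Finset.range (M + 1), |-r + (i : ℝ) * d| ≤ r := fun i hi => by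
      have : (i : ℝ) ≤ M := by exact_mod_cast Nat.lt_succ_iff.1 (Finset.mem_range.1 hi)
      rw [abs_le]
      constructor <;> nlinarith [(Nat.cast_nonneg i : (0 : ℝ) ≤ i)]
    have h1 := abs_tm_iterate_sub (b := b) (by linarith) (n := n) fun k hk =>
      mul_nonneg_of_no_zero_between ((continuous_tm b).iterate k) hxy fun z h1 h2 h0 =>
        absurd h2.le (not_le.2 (hno z (by simpa using ⟨k, hk, h0⟩) h1.le))
    have h2 := tm_mem_Icc hb hb2 (hbd i hi) n
    have h3 := tm_mem_Icc hb hb2 (hbd j hj) n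
    have h4 := abs_sub ((tm b)^[n] (-r + i * d)) ((tm b)^[n] (-r + j * d))
    have hij : (i : ℝ) + 1 ≤ j := by
      have : (i : ℝ) < j := by nlinarith
      exact_mod_cast (by exact_mod_cast this : i < j)
    have h5 : d ≤ |(-r + i * d) - (-r + j * d)| := by
      rw [abs_sub_comm]; refine le_trans ?_ (le_abs_self _); nlinarith
    have h6 : b ^ n * d = 4 * r := by rw [hd]; field_simp
    have h7 := mul_le_mul_of_nonneg_left h5 hbn.le
    linarith
  rw [hPcard, ← Set.ncard_eq_toFinset_card _ hfin] at hle
  have h1 := hφ.one_le_nz hn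
  have h2 : (M : ℝ) + 1 ≤ 3 * nz (tm b) n := by
    have : M + 1 ≤ 3 * nz (tm b) n := by unfold nz at *; omega
    exact_mod_cast this
  linarith

lemma exists_pos_le_dist {O : Set ℝ} (hO : O.Finite) :
    ∃ δ > 0, ∀ u ∈ O, ∀ v ∈ O, u ≠ v → δ ≤ |u - v| := by
  classical
  by_cases hne : ((hO.toFinset ×ˢ hO.toFinset).filter fun q => q.1 ≠ q.2).Nonempty
  · obtain ⟨q, hq, hmin⟩ := Finset.exists_min_image _ (fun q => |q.1 - q.2|) hne
    refine ⟨|q.1 - q.2|, abs_pos.2 (sub_ne_zero.2 (Finset.mem_filter.1 hq).2),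
      fun u hu v hv huv => hmin (u, v) ?_⟩
    simp [hu, hv, huv]
  · refine ⟨1, one_pos, fun u hu v hv huv => absurd ⟨(u, v), ?_⟩ hne⟩
    simp [hu, hv, huv]

lemma iterate_mod_of_periodic {φ : ℝ → ℝ} {p : ℕ} (h0 : φ^[p] 0 = 0) (j : ℕ) :
    φ^[j] 0 = φ^[j % p] 0 := by
  have : Function.IsPeriodicPt φ p 0 := h0
  exact (this.iterate_mod_apply j).symm

lemma nz_tm_le (hb : 1 < b) {p : ℕ} (hp : 1 ≤ p) (h0 : (tm b)^[p] 0 = 0) :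
    ∃ C : ℝ, 0 < C ∧ ∀ n, (nz (tm b) n : ℝ) ≤ C * b ^ n := by
  classical
  have hφ := evenMono_tm (b := b) (by linarith)
  have hO : (Set.range fun j => (tm b)^[j] 0).Finite := by
    refine ((Finset.range p).image fun j => (tm b)^[j] 0).finite_toSet.subset ?_
    rintro _ ⟨j, rfl⟩
    rw [Finset.mem_coe, Finset.mem_image]
    exact ⟨j % p, Finset.mem_range.2 (Nat.mod_lt _ hp), (iterate_mod_of_periodic h0 j).symm⟩
  obtain ⟨δ, hδ, hsep⟩ := exists_pos_le_dist hO
  set r := 1 / (b - 1) with hr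
  have hr0 : 0 < r := by apply one_div_pos.2; linarith
  refine ⟨2 * r / δ + 1, by positivity, fun n => ?_⟩
  have hbn : 0 < b ^ n := by positivity
  have hbn1 : 1 ≤ b ^ n := one_le_pow₀ hb.le
  have hfin := hφ.finite_zset n
  have hgap : ∀ x ∈ zset (tm b) n, ∀ y ∈ zset (tm b) n, x < y → δ ≤ b ^ n * (y - x) := by
    intro x hx y hy hxy
    obtain ⟨w, hw, hmin⟩ := Finset.exists_min_image (hfin.toFinset.filter (x < ·)) id
      ⟨y, by simp [hy, hxy]⟩
    obtain ⟨hw1, hw2⟩ := Finset.mem_filter.1 hw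
    have hw3 : w ≤ y := hmin y (by simp [hy, hxy])
    have hw1' : w ∈ zset (tm b) n := by simpa using hw1
    have h1 := abs_tm_iterate_sub (b := b) (by linarith) (n := n) fun k hk =>
      mul_nonneg_of_no_zero_between ((continuous_tm b).iterate k) hw2 fun z h1 h2 h0 => by
        have hz : z ∈ zset (tm b) n := ⟨k, hk, h0⟩
        exact absurd (hmin z (by simp [hz, h1])) (not_le.2 h2)
    have hmemO : ∀ z ∈ zset (tm b) n, (tm b)^[n] z ∈ Set.range fun j => (tm b)^[j] 0 := by
      rintro z ⟨k, hk, hz⟩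
      refine ⟨n - k, ?_⟩
      change (tm b)^[n - k] 0 = _
      rw [← hz, ← Function.iterate_add_apply, Nat.sub_add_cancel hk.le]
    have hne : (tm b)^[n] x ≠ (tm b)^[n] w := by
      intro h
      rw [h, sub_self, abs_zero] at h1
      have : 0 < |x - w| := abs_pos.2 (by linarith)
      nlinarith [mul_pos hbn this]
    have h2 := hsep _ (hmemO x hx) _ (hmemO w hw1') hne
    rw [h1, abs_sub_comm, abs_of_pos (by linarith)] at h2
    nlinarith
  have hcard : nz (tm b) n ≤ ⌊2 * r / δ * b ^ n⌋₊ + 1 := by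
    rw [nz, Set.ncard_eq_toFinset_card _ hfin, ← Finset.card_range (⌊2 * r / δ * b ^ n⌋₊ + 1)]
    refine Finset.card_le_card_of_injOn (fun x => ⌊(x + r) / δ * b ^ n⌋₊) ?_ ?_
    · intro x hx
      have hx' : x ∈ zset (tm b) n := by simpa using hx
      have := (abs_le.1 (zset_tm_subset hb n hx')).2
      simp only [Finset.coe_range, mem_Iio, Nat.lt_succ_iff]
      refine Nat.floor_le_floor ?_
      gcongr
      linarith
    · have key : ∀ x ∈ zset (tm b) n, ∀ y ∈ zset (tm b) n, x < y →
          ⌊(x + r) / δ * b ^ n⌋₊ ≠ ⌊(y + r) / δ * b ^ n⌋₊ := by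
        intro x hx y hy hxy heq
        have h1 := hgap x hx y hy hxy
        have hx0 := (abs_le.1 (zset_tm_subset hb n hx)).1
        have h2 : 0 ≤ (x + r) / δ * b ^ n :=
          mul_nonneg (div_nonneg (by linarith) hδ.le) hbn.le
        have h3 := Nat.lt_floor_add_one ((y + r) / δ * b ^ n)
        have h4 := Nat.floor_le h2
        rw [heq] at h4
        have h5 : (y + r) / δ * b ^ n - (x + r) / δ * b ^ n = b ^ n * (y - x) / δ := by ring
        have h6 : 1 ≤ b ^ n * (y - x) / δ := by rwa [le_div_iff₀ hδ, one_mul]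
        linarith
      intro x hx y hy hxy
      have hx' : x ∈ zset (tm b) n := by simpa using hx
      have hy' : y ∈ zset (tm b) n := by simpa using hy
      by_contra hne
      rcases lt_or_gt_of_ne hne with h | h
      · exact key x hx' y hy' h hxy
      · exact key y hy' x hx' h hxy.symm
  have h1 : (nz (tm b) n : ℝ) ≤ ⌊2 * r / δ * b ^ n⌋₊ + 1 := by exact_mod_cast hcard
  have h2 := Nat.floor_le (show 0 ≤ 2 * r / δ * b ^ n by positivity)
  linarith

theorem growth_tm (hb : 1 < b) (hb2 : b ≤ 2) {p : ℕ} (hp : 1 ≤ p) (h0 : (tm b)^[p] 0 = 0) :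
    growth (tm b) = (Real.log b : ℝ) := by
  have hlog : ((Real.log b : ℝ) : EReal) =
      ExpGrowth.expGrowthSup fun n : ℕ => ENNReal.ofReal b ^ n := by
    rw [ExpGrowth.expGrowthSup_pow, ENNReal.log_ofReal_of_pos (by linarith)]
  rw [hlog, growth]
  apply le_antisymm
  · obtain ⟨C, hC, hle⟩ := nz_tm_le hb hp h0
    refine ExpGrowth.expGrowthSup_le_of_eventually_le (b := ENNReal.ofReal C) (by simp)
      (Eventually.of_forall fun n => ?_)
    rw [← ENNReal.ofReal_natCast, ← ENNReal.ofReal_pow (by linarith), ← ENNReal.ofReal_mul hC.le]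
    exact ENNReal.ofReal_le_ofReal (hle n)
  · refine ExpGrowth.expGrowthSup_le_of_eventually_le (b := 6) (by simp) ?_
    filter_upwards [eventually_ge_atTop 1] with n hn
    rw [← ENNReal.ofReal_natCast, ← ENNReal.ofReal_pow (by linarith), ← ENNReal.ofReal_ofNat,
      ← ENNReal.ofReal_mul (by norm_num)]
    exact ENNReal.ofReal_le_ofReal (pow_le_nz_tm hb hb2 hn)

end tent

/-- The orbit of the turning point of the tent map. -/
noncomputable def ct (b : ℝ) (j : ℕ) : ℝ := (tm b)^[j] 0

@[simp] lemma ct_zero (b : ℝ) : ct b 0 = 0 := rfl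

lemma ct_succ (b : ℝ) (j : ℕ) : ct b (j + 1) = b * |ct b j| - 1 := by
  rw [ct, Function.iterate_succ_apply', tm, ct]

@[simp] lemma ct_one (b : ℝ) : ct b 1 = -1 := by simp [ct_succ]

lemma tent_iterate_zero (b : ℝ) (j : ℕ) : (tent b)^[j] 0 = -ct b j := by
  induction j with
  | zero => simp
  | succ j ih => rw [Function.iterate_succ_apply', ih, tent, ct_succ, abs_neg]; ring

lemma ct_gt_neg_one {b : ℝ} (hb : 0 < b) {j : ℕ} (h : ct b j ≠ 0) : -1 < ct b (j + 1) := by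
  rw [ct_succ]
  have := mul_pos hb (abs_pos.2 h)
  linarith

lemma abs_ct_le_one {b : ℝ} (hb : 0 < b) (hb2 : b ≤ 2) (j : ℕ) : |ct b j| ≤ 1 := by
  induction j with
  | zero => simp
  | succ j ih =>
    rw [ct_succ, abs_le]
    constructor <;> nlinarith [abs_nonneg (ct b j)]

lemma ct_two_mul {b : ℝ} (hb : 1 < b) (hb2 : b ^ 2 ≤ 2) (j : ℕ) :
    ct b (2 * j) = -(b - 1) * ct (b ^ 2) j ∧ ct b (2 * j + 1) < 0 := by
  have hodd : ∀ j, ct b (2 * j) = -(b - 1) * ct (b ^ 2) j → ct b (2 * j + 1) < 0 := by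
    intro j h
    rw [ct_succ, h, abs_mul, abs_neg, abs_of_pos (by linarith : 0 < b - 1)]
    have h1 := abs_ct_le_one (b := b ^ 2) (by positivity) hb2 j
    have h2 : (b - 1) * |ct (b ^ 2) j| ≤ (b - 1) * 1 := by gcongr
    nlinarith
  induction j with
  | zero => simp
  | succ j ih =>
    have h : ct b (2 * (j + 1)) = -(b - 1) * ct (b ^ 2) (j + 1) := by
      rw [show 2 * (j + 1) = 2 * j + 1 + 1 by ring, ct_succ, abs_of_neg ih.2, ct_succ, ih.1,
        ct_succ, abs_mul, abs_neg, abs_of_pos (by linarith : 0 < b - 1)]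
      ring
    exact ⟨h, hodd _ h⟩

lemma ct_signs (m : ℕ) : ∀ {b : ℝ}, 1 < b → b ^ 2 ^ m < 2 →
    (∀ k < m, ∀ j, Odd j → 0 < (-1) ^ (k + 1) * ct b (2 ^ k * j)) ∧
    0 < (-1) ^ (m + 1) * ct b (2 ^ m) ∧ 0 < (-1) ^ m * ct b (2 ^ (m + 1)) := by
  induction m with
  | zero =>
    intro b hb _
    refine ⟨by simp, by simp, ?_⟩
    simp only [pow_zero, zero_add, pow_one, one_mul]
    rw [show (2 : ℕ) = 1 + 1 from rfl, ct_succ, ct_one]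
    simp; linarith
  | succ m ih =>
    intro b hb hbm
    have hb2 : (b ^ 2) ^ 2 ^ m < 2 := by rw [← pow_mul, ← pow_succ']; exact hbm
    have hbb : 1 < b ^ 2 := one_lt_pow₀ hb (by norm_num)
    have hle : b ^ 2 ≤ 2 := by
      refine le_trans ?_ hb2.le
      exact le_self_pow₀ hbb.le (by positivity)
    obtain ⟨h1, h2, h3⟩ := ih hbb hb2
    have hb1 : 0 < b - 1 := by linarith
    refine ⟨?_, ?_, ?_⟩
    · intro k hk j hj
      rcases Nat.eq_zero_or_pos k with rfl | hk0
      · obtain ⟨i, rfl⟩ := hj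
        have := (ct_two_mul hb hle i).2
        simpa using this
      · obtain ⟨k, rfl⟩ := Nat.exists_eq_add_of_le' hk0
        have := h1 k (by omega) j hj
        rw [show 2 ^ (k + 1) * j = 2 * (2 ^ k * j) by ring, (ct_two_mul hb hle _).1]
        have e : (-1 : ℝ) ^ (k + 1 + 1) * (-(b - 1) * ct (b ^ 2) (2 ^ k * j)) =
          (b - 1) * ((-1) ^ (k + 1) * ct (b ^ 2) (2 ^ k * j)) := by ring
        rw [e]; positivity
    · rw [show 2 ^ (m + 1) = 2 * 2 ^ m by ring, (ct_two_mul hb hle _).1]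
      have e : (-1 : ℝ) ^ (m + 1 + 1) * (-(b - 1) * ct (b ^ 2) (2 ^ m)) =
          (b - 1) * ((-1) ^ (m + 1) * ct (b ^ 2) (2 ^ m)) := by ring
      rw [e]; positivity
    · rw [show 2 ^ (m + 1 + 1) = 2 * 2 ^ (m + 1) by ring, (ct_two_mul hb hle _).1]
      have e : (-1 : ℝ) ^ (m + 1) * (-(b - 1) * ct (b ^ 2) (2 ^ (m + 1))) =
          (b - 1) * ((-1) ^ m * ct (b ^ 2) (2 ^ (m + 1))) := by ring
      rw [e]; positivity

lemma ct_renormalization {b : ℝ} (hb : 1 < b) {q r : ℕ} (hq : 1 ≤ q) (hr : 2 ≤ r)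
    (hper : ct b (r * q) = 0) (hq0 : ct b q ≠ 0) (hr0 : ct b ((r - 1) * q) ≠ 0)
    (hs : ∀ j < r, ∀ i, 0 < i → i < q →
      SignType.sign (ct b (j * q + i)) = SignType.sign (ct b i)) :
    ct b (2 * q) * ct b q < 0 := by
  have key : ∀ i, i + 1 ≤ q → ∃ S : ℝ, (S = 1 ∨ S = -1) ∧ ∀ j < r,
      ct b (j * q + (i + 1)) = ct b (i + 1) + S * b ^ (i + 1) * |ct b (j * q)| := by
    intro i
    induction i with
    | zero =>
      intro _
      refine ⟨1, Or.inl rfl, fun j _ => ?_⟩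
      rw [zero_add, ct_succ, ct_one]; ring
    | succ i ih =>
      intro hi
      obtain ⟨S, hS, hj⟩ := ih (by omega)
      set s : ℝ := ((SignType.sign (ct b (i + 1)) : SignType) : ℝ) with hsdef
      have hne : ct b (i + 1) ≠ 0 := by
        intro h0
        have h1 := hs (r - 1) (by omega) (i + 1) (by omega) (by omega)
        rw [h0, sign_zero] at h1
        have h2 := sign_eq_zero_iff.1 h1
        have h3 := hj (r - 1) (by omega)
        rw [h0, h2] at h3
        have h4 : 0 < b ^ (i + 1) * |ct b ((r - 1) * q)| :=
          mul_pos (by positivity) (abs_pos.2 hr0)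
        rcases hS with rfl | rfl <;> linarith
      have habs : ∀ j < r, |ct b (j * q + (i + 1))| = s * ct b (j * q + (i + 1)) := by
        intro j hjr
        rw [hsdef, ← hs j hjr (i + 1) (by omega) (by omega), sign_mul_self]
      refine ⟨s * S, ?_, fun j hjr => ?_⟩
      · rcases lt_or_gt_of_ne hne with h | h
        · rw [hsdef, sign_neg h]; rcases hS with rfl | rfl <;> simp
        · rw [hsdef, sign_pos h]; rcases hS with rfl | rfl <;> simp
      · have h1 := habs 0 (by omega)
        rw [zero_mul, zero_add] at h1
        rw [← add_assoc, ct_succ, habs j hjr, hj j hjr, ct_succ b (i + 1), h1]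
        ring
  obtain ⟨q', rfl⟩ := Nat.exists_eq_add_of_le' hq
  obtain ⟨S, hS, hj⟩ := key q' le_rfl
  set L := b ^ (q' + 1) with hL
  have hL1 : 1 < L := one_lt_pow₀ hb (by omega)
  have h1 := hj (r - 1) (by omega)
  have h2 := hj 1 (by omega)
  rw [show (r - 1) * (q' + 1) + (q' + 1) = r * (q' + 1) by
    obtain ⟨r', rfl⟩ := Nat.exists_eq_add_of_le' (show 1 ≤ r by omega)
    simp; ring, hper] at h1
  rw [one_mul, ← two_mul] at h2
  have h3 : 0 < L * |ct b ((r - 1) * (q' + 1))| := mul_pos (by positivity) (abs_pos.2 hr0)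
  rw [h2]
  rcases hS with rfl | rfl
  · have hneg : ct b (q' + 1) < 0 := by linarith
    rw [abs_of_neg hneg]
    nlinarith [mul_pos_of_neg_of_neg hneg hneg]
  · have hpos : 0 < ct b (q' + 1) := by linarith
    rw [abs_of_pos hpos]
    nlinarith [mul_pos hpos hpos]

lemma continuous_co (j : ℕ) : Continuous fun a => co a j := by
  induction j with
  | zero => simpa using continuous_const
  | succ j ih => simp only [co_succ]; fun_prop

lemma abs_le_two_of_mem_Ia {a x : ℝ} (ha : a ∈ Icc (-2 : ℝ) (1 / 4)) (hx : x ∈ Ia a) : |x| ≤ 2 := by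
  rw [Ia_eq] at hx
  exact abs_le.2 ⟨by linarith [hx.1, beta_le ha.1], by linarith [hx.2, beta_le ha.1]⟩

lemma mem_Ia_of_abs_le {a x : ℝ} (hx : |x| ≤ 1 / 2) : x ∈ Ia a := by
  rw [Ia_eq]
  have := abs_le.1 hx
  have := beta_pos a
  constructor <;> linarith

lemma abs_iterate_sub_le {a x : ℝ} (ha : a ∈ Icc (-2 : ℝ) (1 / 4)) (hx : |x| ≤ 1 / 2) (N : ℕ) :
    |(fa a)^[N + 1] x - (fa a)^[N + 1] 0| ≤ 4 ^ N * x ^ 2 := by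
  induction N with
  | zero => simp [fa]
  | succ N ih =>
    have hm := mapsTo_Ia ha
    have h1 := abs_le_two_of_mem_Ia ha (hm.iterate (N + 1) (mem_Ia_of_abs_le hx))
    have h2 := abs_le_two_of_mem_Ia ha (hm.iterate (N + 1) (mem_Ia_of_abs_le (x := 0) (by simp)))
    rw [Function.iterate_succ_apply' _ (N + 1), Function.iterate_succ_apply' _ (N + 1)]
    generalize (fa a)^[N + 1] x = u at *
    generalize (fa a)^[N + 1] 0 = w at *
    have h3 : fa a u - fa a w = (u + w) * (u - w) := by simp only [fa]; ring
    rw [h3, abs_mul, pow_succ]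
    have h4 : |u + w| ≤ 4 := (abs_add_le u w).trans (by linarith)
    calc |u + w| * |u - w| ≤ 4 * (4 ^ N * x ^ 2) := by gcongr
      _ = _ := by ring

/-- Near a parameter with `co A q = 0`, the first return map to a small neighbourhood of `0` does
not change the sign of `co a q`. -/
lemma eventually_sign_co_mul {A : ℝ} {q : ℕ} (h0 : co A q = 0) (j : ℕ) :
    ∀ᶠ a in 𝓝 A, a ∈ Icc (-2 : ℝ) (1 / 4) →
      SignType.sign (co a ((j + 1) * q)) = SignType.sign (co a q) := by
  rcases q with _ | N
  · simp
  have hev : ∀ᶠ a in 𝓝 A, |co a (N + 1)| < 1 / (9 * 4 ^ N) := by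
    have h1 : Tendsto (fun a => |co a (N + 1)|) (𝓝 A) (𝓝 0) := by
      have := ((continuous_co (N + 1)).abs).tendsto A
      simpa [h0] using this
    exact h1.eventually (gt_mem_nhds (by positivity))
  filter_upwards [hev] with a ha hI
  have h4 : (1 : ℝ) ≤ 4 ^ N := one_le_pow₀ (by norm_num)
  rw [lt_div_iff₀ (by positivity)] at ha
  have hc0 := abs_nonneg (co a (N + 1))
  have hsmall : |co a (N + 1)| ≤ 1 / 9 := by nlinarith
  have key : ∀ i, |co a ((i + 1) * (N + 1)) - co a (N + 1)| ≤ |co a (N + 1)| / 2 := by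
    intro i
    induction i with
    | zero => simp; try positivity
    | succ i ih =>
      have h5 : |co a ((i + 1) * (N + 1))| ≤ 3 / 2 * |co a (N + 1)| := by
        have := abs_add_le (co a ((i + 1) * (N + 1)) - co a (N + 1)) (co a (N + 1))
        rw [sub_add_cancel] at this
        linarith
      have h6 := abs_iterate_sub_le hI (x := co a ((i + 1) * (N + 1))) (by linarith) N
      rw [← co_add, ← co, show N + 1 + (i + 1) * (N + 1) = (i + 1 + 1) * (N + 1) by ring,
        ← sq_abs] at h6
      refine h6.trans ?_
      have h7 : |co a ((i + 1) * (N + 1))| ^ 2 ≤ (3 / 2 * |co a (N + 1)|) ^ 2 := by gcongr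
      calc 4 ^ N * |co a ((i + 1) * (N + 1))| ^ 2 ≤ 4 ^ N * (3 / 2 * |co a (N + 1)|) ^ 2 := by gcongr
        _ = 1 / 4 * (|co a (N + 1)| * (9 * 4 ^ N)) * |co a (N + 1)| := by ring
        _ ≤ 1 / 4 * 1 * |co a (N + 1)| := by gcongr
        _ ≤ _ := by linarith
  have := key j
  have hb := abs_le.1 this
  rcases lt_trichotomy (co a (N + 1)) 0 with h | h | h
  · rw [abs_of_neg h] at hb
    rw [sign_neg h, sign_neg (by linarith)]
  · rw [h] at hb
    simp only [abs_zero] at hb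
    rw [h, show co a ((j + 1) * (N + 1)) = 0 by linarith]
  · rw [abs_of_pos h] at hb
    rw [sign_pos h, sign_pos (by linarith)]

/-- The kneading sequence of the tent map compared with a `q`-periodic sequence. -/
lemma ct_compare_periodic {b : ℝ} (hb : 0 < b) {p q : ℕ} (hq : 1 ≤ q) (hqp : q < p)
    (h0 : ct b p = 0) (hne : ∀ j, 1 ≤ j → j < p → ct b j ≠ 0) :
    ∃ N, q ≤ N ∧ N < p ∧
      (∀ i < N, SignType.sign (ct b (i + 1)) = SignType.sign (ct b (i % q + 1))) ∧
      SignType.sign (ct b (N + 1)) ≠ SignType.sign (ct b (N % q + 1)) ∧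
      ∀ x : ℝ, SignType.sign x = SignType.sign (ct b (N % q + 1)) →
        (∏ i ∈ Finset.range N, SignType.sign (ct b (i + 1))) * SignType.sign (ct b (N + 1) - x) =
          ∏ i ∈ Finset.range q, SignType.sign (ct b (i + 1)) := by
  classical
  have hex : ∃ N, SignType.sign (ct b (N + 1)) ≠ SignType.sign (ct b (N % q + 1)) := by
    refine ⟨p - 1, ?_⟩
    have hlt := Nat.mod_lt (p - 1) hq
    rw [Nat.sub_add_cancel (by omega), h0, sign_zero]
    exact (sign_ne_zero.2 (hne _ (by omega) (by omega))).symm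
  obtain ⟨N, hN, hmin⟩ : ∃ N, SignType.sign (ct b (N + 1)) ≠ SignType.sign (ct b (N % q + 1)) ∧
      ∀ i < N, SignType.sign (ct b (i + 1)) = SignType.sign (ct b (i % q + 1)) :=
    ⟨Nat.find hex, Nat.find_spec hex, fun i hi => not_not.1 (Nat.find_min hex hi)⟩
  have hNp : N < p := by
    by_contra hcon
    have h1 := hmin (p - 1) (by omega)
    have hlt := Nat.mod_lt (p - 1) hq
    rw [Nat.sub_add_cancel (by omega), h0, sign_zero] at h1
    exact sign_ne_zero.2 (hne _ (by omega) (by omega)) h1.symm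
  have hqN : q ≤ N := by
    by_contra hcon
    exact hN (by rw [Nat.mod_eq_of_lt (by omega)])
  refine ⟨N, hqN, hNp, hmin, hN, fun x hx => ?_⟩
  obtain ⟨M, rfl⟩ := Nat.exists_eq_add_of_le' hqN
  have hshift : ∀ i, (i + q) % q = i % q := fun i => Nat.add_mod_right i q
  have hper : ∀ i < M, SignType.sign (ct b (i + 1)) = SignType.sign (ct b (i + q + 1)) :=
    fun i hi => by rw [hmin i (by omega), hmin (i + q) (by omega), hshift]
  have hit : ∀ i, (tm b)^[i] (ct b 1) = ct b (i + 1) := fun i => by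
    rw [ct, ct, ← Function.iterate_add_apply]
  have hit' : ∀ i, (tm b)^[i] (ct b (q + 1)) = ct b (i + q + 1) := fun i => by
    rw [ct, ct, ← Function.iterate_add_apply, add_assoc]
  have h1 := (evenMono_tm hb).sign_sub_eq (N := M) (u := ct b 1) (w := ct b (q + 1))
    (fun i hi => by rw [hit]; exact hne _ (by omega) (by omega))
    (fun i hi => by rw [hit, hit']; exact hper i hi)
  have hgt := ct_gt_neg_one hb (hne q hq hqp)
  rw [sign_neg (by rw [ct_one]; linarith), hit, hit'] at h1
  simp only [hit] at h1
  have hsx : SignType.sign x = SignType.sign (ct b (M + 1)) := by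
    rw [hx, hshift, hmin M (by omega)]
  have h2 : SignType.sign (ct b (M + q + 1) - x) =
      -SignType.sign (ct b (M + 1) - ct b (M + q + 1)) := by
    rw [← neg_sub, Left.sign_neg, sign_sub_of_sign_ne (by rw [hx]; exact hN.symm),
      sign_sub_of_sign_ne (by rw [← hsx, hx]; exact hN.symm), hsx]
  rw [h2, add_comm M q, Finset.prod_range_add]
  have h3 : ∏ i ∈ Finset.range M, SignType.sign (ct b (q + i + 1)) =
      ∏ i ∈ Finset.range M, SignType.sign (ct b (i + 1)) :=
    Finset.prod_congr rfl fun i hi => by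
      rw [hper i (Finset.mem_range.1 hi), add_comm q i]
  rw [h3, add_comm q M, mul_assoc, mul_neg, ← h1]
  simp

/-- The kneading sequence of `fa a` precedes that of the tent map. -/
def KneadLT (b : ℝ) (p : ℕ) (a : ℝ) : Prop :=
  ∃ N < p, (∀ i < N, SignType.sign (co a (i + 1)) = SignType.sign (ct b (i + 1))) ∧
    SignType.sign (co a (N + 1)) ≠ SignType.sign (ct b (N + 1)) ∧
    (∏ i ∈ Finset.range N, SignType.sign (ct b (i + 1))) *
      SignType.sign (ct b (N + 1) - co a (N + 1)) = 1

lemma kneadLT_iff {b a : ℝ} {p N : ℕ} (hN : N < p)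
    (hs : ∀ i < N, SignType.sign (co a (i + 1)) = SignType.sign (ct b (i + 1)))
    (hd : SignType.sign (co a (N + 1)) ≠ SignType.sign (ct b (N + 1))) :
    KneadLT b p a ↔ (∏ i ∈ Finset.range N, SignType.sign (ct b (i + 1))) *
      SignType.sign (ct b (N + 1) - co a (N + 1)) = 1 := by
  refine ⟨?_, fun h => ⟨N, hN, hs, hd, h⟩⟩
  rintro ⟨M, -, hMs, hMd, hM⟩
  rcases lt_trichotomy M N with h | rfl | h
  · exact absurd (hs M h) hMd
  · exact hM
  · exact absurd (hMs N h) hd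

lemma eventually_sign_eq {g : ℝ → ℝ} (hg : Continuous g) {A : ℝ} (hA : g A ≠ 0) :
    ∀ᶠ a in 𝓝 A, SignType.sign (g a) = SignType.sign (g A) := by
  rcases hA.lt_or_gt with h | h
  · filter_upwards [hg.continuousAt.eventually (gt_mem_nhds h)] with a ha
    rw [sign_neg ha, sign_neg h]
  · filter_upwards [hg.continuousAt.eventually (lt_mem_nhds h)] with a ha
    rw [sign_pos ha, sign_pos h]

lemma kneadLT_locally_const {b A : ℝ} (hb : 0 < b) {p N : ℕ} (h0 : ct b p = 0)
    (hne : ∀ j, 1 ≤ j → j < p → ct b j ≠ 0) (hN : N < p)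
    (hs : ∀ i < N, SignType.sign (co A (i + 1)) = SignType.sign (ct b (i + 1)))
    (hd : SignType.sign (co A (N + 1)) ≠ SignType.sign (ct b (N + 1))) :
    ∃ Q : Prop, ∀ᶠ a in 𝓝 A, a ∈ Icc (-2 : ℝ) (1 / 4) → (KneadLT b p a ↔ Q) := by
  have hE : ∀ᶠ a in 𝓝 A, ∀ i < p, co A (i + 1) ≠ 0 →
      SignType.sign (co a (i + 1)) = SignType.sign (co A (i + 1)) := by
    refine (eventually_all_finite (finite_Iio p)).2 fun i _ => ?_
    by_cases hi : co A (i + 1) = 0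
    · exact Eventually.of_forall fun a h => absurd hi h
    · filter_upwards [eventually_sign_eq (continuous_co (i + 1)) hi] with a ha _ using ha
  have hsne : ∀ i < N, co A (i + 1) ≠ 0 := fun i hi => by
    rw [← sign_ne_zero, hs i hi, sign_ne_zero]
    exact hne _ (by omega) (by omega)
  by_cases hc : co A (N + 1) = 0
  · have hq : N + 1 < p := by
      refine lt_of_le_of_ne hN fun he => hd ?_
      rw [hc, he, h0]
    have hF : ∀ᶠ a in 𝓝 A, ∀ j < p, a ∈ Icc (-2 : ℝ) (1 / 4) →
        SignType.sign (co a ((j + 1) * (N + 1))) = SignType.sign (co a (N + 1)) :=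
      (eventually_all_finite (finite_Iio p)).2 fun j _ => eventually_sign_co_mul hc j
    obtain ⟨M, hqM, hMp, hper, hMd, hM⟩ := ct_compare_periodic hb (q := N + 1) (by omega) hq h0 hne
    refine ⟨∏ i ∈ Finset.range (N + 1), SignType.sign (ct b (i + 1)) = 1, ?_⟩
    filter_upwards [hE, hF] with a haE haF hI
    have hs' : ∀ i < N, SignType.sign (co a (i + 1)) = SignType.sign (ct b (i + 1)) :=
      fun i hi => by rw [haE i (by omega) (hsne i hi), hs i hi]
    by_cases hσ : SignType.sign (co a (N + 1)) = SignType.sign (ct b (N + 1))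
    · have hall : ∀ i < p, SignType.sign (co a (i + 1)) = SignType.sign (ct b (i % (N + 1) + 1)) := by
        intro i hi
        have hdm := Nat.div_add_mod i (N + 1)
        rcases (Nat.le_of_lt_succ (Nat.mod_lt i (Nat.succ_pos N))).lt_or_eq with hr | hr
        · rw [Nat.succ_eq_add_one] at hr
          have h1 : co A (i + 1) = co A (i % (N + 1) + 1) := by
            rw [co, iterate_mod_of_periodic hc, Nat.add_mod, Nat.mod_eq_of_lt (a := 1) (by omega),
              Nat.mod_eq_of_lt (a := i % (N + 1) + 1) (by omega), co]
          rw [haE i hi (by rw [h1]; exact hsne _ hr), h1, hs _ hr]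
        · rw [hr, ← hσ, ← haF (i / (N + 1)) ((Nat.div_le_self _ _).trans_lt hi) hI]
          congr 2
          rw [hr] at hdm
          nlinarith
      rw [kneadLT_iff hMp (fun i hi => by rw [hall i (by omega), hper i hi])
        (by rw [hall M hMp]; exact hMd.symm), hM _ (hall M hMp)]
    · rw [kneadLT_iff hN hs' hσ, Finset.prod_range_succ]
      have h1 := hne (N + 1) (by omega) hq
      have h2 : SignType.sign (ct b (N + 1) - co a (N + 1)) = SignType.sign (ct b (N + 1)) := by
        rw [sign_sub_of_sign_ne (Ne.symm hσ)]
        revert hσ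
        rw [← sign_ne_zero] at h1
        revert h1
        generalize SignType.sign (ct b (N + 1)) = s
        generalize SignType.sign (co a (N + 1)) = t
        revert s t
        decide
      rw [h2]
  · refine ⟨KneadLT b p A, ?_⟩
    filter_upwards [hE] with a haE hI
    have hs' : ∀ i < N, SignType.sign (co a (i + 1)) = SignType.sign (ct b (i + 1)) :=
      fun i hi => by rw [haE i (by omega) (hsne i hi), hs i hi]
    have h1 := haE N hN hc
    rw [kneadLT_iff hN hs hd, kneadLT_iff hN hs' (by rwa [h1]), sign_sub_of_sign_ne hd.symm,
      sign_sub_of_sign_ne (by rw [h1]; exact hd.symm), h1]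

/-- Realization of a periodic tent kneading sequence in the quadratic family. -/
theorem exists_param_of_tent {b : ℝ} (hb : 1 < b) {p : ℕ} (hp : 3 ≤ p) (h0 : ct b p = 0)
    (hne : ∀ j, 1 ≤ j → j < p → ct b j ≠ 0) :
    ∃ a ∈ Icc (-2 : ℝ) (-1), ∀ j ≤ p, SignType.sign (co a j) = SignType.sign (ct b j) := by
  classical
  have hct2 : 0 < ct b 2 := by rw [ct_succ, ct_one]; simp; linarith
  set S : Set ℝ := {a | a ∈ Icc (-2 : ℝ) 0 ∧ KneadLT b p a} with hS
  have hSne : (-2 : ℝ) ∈ S := by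
    refine ⟨by norm_num, ?_⟩
    have hex : ∃ N, ct b (N + 2) ≤ 0 := ⟨p - 2, by rw [Nat.sub_add_cancel (by omega), h0]⟩
    obtain ⟨N, hN, hmin⟩ : ∃ N, ct b (N + 2) ≤ 0 ∧ ∀ i < N, 0 < ct b (i + 2) :=
      ⟨Nat.find hex, Nat.find_spec hex, fun i hi => not_le.1 (Nat.find_min hex hi)⟩
    have hNp : N + 1 < p := by
      by_contra hcon
      have := hmin (p - 2) (by omega)
      rw [Nat.sub_add_cancel (by omega), h0] at this
      exact this.false
    have hco : ∀ i, co (-2) (i + 2) = 2 := by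
      intro i
      induction i with
      | zero => rw [co_succ, co_one]; norm_num
      | succ i ih => rw [show i + 1 + 2 = i + 2 + 1 by ring, co_succ, ih]; norm_num
    refine ⟨N + 1, hNp, ?_, ?_, ?_⟩
    · rintro (_ | i) hi
      · simp
      · rw [hco, sign_pos two_pos, sign_pos (hmin i (by omega))]
    · rw [hco, sign_pos two_pos]
      intro h1
      rw [eq_comm, sign_eq_one_iff] at h1
      linarith
    · rw [Finset.prod_range_succ', Finset.prod_eq_one, hco, sign_neg (a := ct b (N + 1 + 1) - 2)]
      · simp
      · rw [show N + 1 + 1 = N + 2 by ring]; linarith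
      · intro i hi
        exact sign_pos (hmin i (Finset.mem_range.1 hi))
  have hSub : ∀ a ∈ S, a ≤ -1 := by
    rintro a ⟨ha, hk⟩
    by_contra! hcon
    rcases ha.2.lt_or_eq with h | rfl
    · have h2 : co a 2 < 0 := by rw [co_succ, co_one]; nlinarith
      rw [kneadLT_iff (N := 1) (by omega) (fun i hi => by
        obtain rfl : i = 0 := by omega
        simp [h]) (by rw [sign_neg h2, sign_pos hct2]; decide)] at hk
      rw [sign_pos (by linarith)] at hk
      simp at hk
    · rw [kneadLT_iff (N := 0) (by omega) (fun i hi => by omega) (by simp)] at hk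
      simp at hk
  have hbdd : BddAbove S := ⟨-1, hSub⟩
  set A := sSup S with hA
  have hA2 : -2 ≤ A := le_csSup hbdd hSne
  have hA1 : A ≤ -1 := csSup_le ⟨_, hSne⟩ hSub
  refine ⟨A, ⟨hA2, hA1⟩, ?_⟩
  by_contra hcon
  have hex : ∃ N, N < p ∧ SignType.sign (co A (N + 1)) ≠ SignType.sign (ct b (N + 1)) := by
    push Not at hcon
    obtain ⟨j, hj, hj'⟩ := hcon
    rcases j with _ | N
    · simp at hj'
    · exact ⟨N, hj, hj'⟩
  obtain ⟨Q, hQ⟩ := kneadLT_locally_const (A := A) (by linarith) h0 hne (Nat.find_spec hex).1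
    (fun i hi => by
      by_contra h
      exact Nat.find_min hex hi ⟨hi.trans (Nat.find_spec hex).1, h⟩) (Nat.find_spec hex).2
  have hq : Q := by
    have h1 : ∃ᶠ a in 𝓝 A, a ∈ S := mem_closure_iff_frequently.1 (csSup_mem_closure ⟨_, hSne⟩ hbdd)
    obtain ⟨a, ⟨ha, hk⟩, haQ⟩ := (h1.and_eventually hQ).exists
    exact (haQ ⟨ha.1, by linarith [ha.2]⟩).1 hk
  have h2 : ∀ᶠ a in 𝓝[>] A, a ∈ Ioo A 0 := Ioo_mem_nhdsGT (by linarith)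
  obtain ⟨a, ha, haQ⟩ := (h2.and (hQ.filter_mono nhdsWithin_le_nhds)).exists
  have : a ∈ S := ⟨⟨by linarith [ha.1], ha.2.le⟩,
    (haQ ⟨by linarith [ha.1], by linarith [ha.2]⟩).2 hq⟩
  exact (le_csSup hbdd this).not_gt ha.1

theorem exists_center {b : ℝ} (hb : 1 < b) (hb2 : b ≤ 2) {p : ℕ} (hp : 3 ≤ p) (h0 : ct b p = 0)
    (hne : ∀ j, 1 ≤ j → j < p → ct b j ≠ 0) :
    ∃ a ∈ Icc (-2 : ℝ) (-1), (∀ j, SignType.sign (co a j) = SignType.sign (ct b j)) ∧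
      h a = Real.log b := by
  obtain ⟨a, ha, hs⟩ := exists_param_of_tent hb hp h0 hne
  have hc0 : co a p = 0 := by
    have := hs p le_rfl
    rwa [h0, sign_zero, sign_eq_zero_iff] at this
  have hall : ∀ j, SignType.sign (co a j) = SignType.sign (ct b j) := fun j => by
    have h1 := hs (j % p) (Nat.mod_lt j (by omega)).le
    rwa [co, ct, ← iterate_mod_of_periodic hc0, ← iterate_mod_of_periodic h0] at h1
  refine ⟨a, ha, hall, ?_⟩
  have hg : growth (fa a) = growth (tm b) := by
    simp only [growth, (evenMono_fa a).nz_eq_of_kneading (evenMono_tm (by linarith : 0 < b)) hall]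
  rw [h_eq_growth ⟨ha.1, by linarith [ha.2]⟩, hg, growth_tm hb hb2 (by omega) h0, EReal.toReal_coe]

/-- Increasing maps of `[p, q]`, with derivative `g'`, that expand cross-ratios; `deriv_mul_le` and
`le_deriv` are the two infinitesimal forms of the inequality `cross`. -/
structure CrossExpanding (g g' : ℝ → ℝ) (p q : ℝ) : Prop where
  hasDerivAt : ∀ x, HasDerivAt g (g' x) x
  nonneg : ∀ x, p ≤ x → x ≤ q → 0 ≤ g' x
  lt : ∀ x y, p ≤ x → x < y → y ≤ q → g x < g y
  cross : ∀ x₁ x₂ x₃ x₄, p ≤ x₁ → x₁ < x₂ → x₂ < x₃ → x₃ < x₄ → x₄ ≤ q →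
    (x₃ - x₂) * (x₄ - x₁) * ((g x₂ - g x₁) * (g x₄ - g x₃)) ≤
      (g x₃ - g x₂) * (g x₄ - g x₁) * ((x₂ - x₁) * (x₄ - x₃))
  deriv_mul_le : ∀ x y, p ≤ x → x < y → y ≤ q → g' x * g' y * (y - x) ^ 2 ≤ (g y - g x) ^ 2
  le_deriv : ∀ x₁ x x₂, p ≤ x₁ → x₁ < x → x < x₂ → x₂ ≤ q →
    (x₂ - x₁) * ((g x - g x₁) * (g x₂ - g x)) ≤ g' x * (g x₂ - g x₁) * ((x - x₁) * (x₂ - x))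

namespace CrossExpanding

variable {f f' g g' : ℝ → ℝ} {p q : ℝ}

lemma le (hg : CrossExpanding g g' p q) {x y : ℝ} (hx : p ≤ x) (hxy : x ≤ y) (hy : y ≤ q) :
    g x ≤ g y := by
  rcases hxy.lt_or_eq with h | rfl
  · exact (hg.lt x y hx h hy).le
  · exact le_rfl

lemma continuous (hg : CrossExpanding g g' p q) : Continuous g :=
  continuous_iff_continuousAt.2 fun x => (hg.hasDerivAt x).continuousAt

lemma mono (hg : CrossExpanding g g' p q) {p' q' : ℝ} (hp : p ≤ p') (hq : q' ≤ q) :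
    CrossExpanding g g' p' q' where
  hasDerivAt := hg.hasDerivAt
  nonneg x h1 h2 := hg.nonneg x (hp.trans h1) (h2.trans hq)
  lt x y h1 h2 h3 := hg.lt x y (hp.trans h1) h2 (h3.trans hq)
  cross _ _ _ _ h1 h2 h3 h4 h5 := hg.cross _ _ _ _ (hp.trans h1) h2 h3 h4 (h5.trans hq)
  deriv_mul_le x y h1 h2 h3 := hg.deriv_mul_le x y (hp.trans h1) h2 (h3.trans hq)
  le_deriv _ _ _ h1 h2 h3 h4 := hg.le_deriv _ _ _ (hp.trans h1) h2 h3 (h4.trans hq)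

lemma affine {c : ℝ} (hc : 0 < c) (d p q : ℝ) :
    CrossExpanding (fun x => c * x + d) (fun _ => c) p q where
  hasDerivAt x := by simpa using ((hasDerivAt_id x).const_mul c).add_const d
  nonneg _ _ _ := hc.le
  lt x y _ h _ := by nlinarith
  cross _ _ _ _ _ _ _ _ _ := by apply le_of_eq; ring
  deriv_mul_le x y _ _ _ := by apply le_of_eq; ring
  le_deriv _ _ _ _ _ _ _ := by apply le_of_eq; ring

lemma sq (q : ℝ) : CrossExpanding (fun x => x ^ 2) (fun x => 2 * x) 0 q where
  hasDerivAt x := by simpa using hasDerivAt_pow 2 x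
  nonneg x h _ := by positivity
  lt x y h1 h2 _ := by nlinarith
  cross x₁ x₂ x₃ x₄ h0 h1 h2 h3 _ := by
    have h : 0 ≤ (x₃ - x₂) * (x₄ - x₁) * ((x₂ - x₁) * (x₄ - x₃)) * ((x₃ - x₁) * (x₄ - x₂)) := by
      have := sub_pos.2 h1
      have := sub_pos.2 h2
      have := sub_pos.2 h3
      have : 0 < x₄ - x₁ := by linarith
      have : 0 < x₃ - x₁ := by linarith
      have : 0 < x₄ - x₂ := by linarith
      positivity
    linarith
  deriv_mul_le x y h0 h1 _ := by nlinarith [sq_nonneg ((y - x) * (y - x))]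
  le_deriv x₁ x x₂ h0 h1 h2 _ := by
    have h : 0 ≤ (x₂ - x₁) * ((x - x₁) * (x₂ - x)) * ((x - x₁) * (x₂ - x)) := by
      have := sub_pos.2 h1
      have := sub_pos.2 h2
      have : 0 < x₂ - x₁ := by linarith
      positivity
    linarith

lemma reflect (hg : CrossExpanding g g' p q) :
    CrossExpanding (fun x => -g (-x)) (fun x => g' (-x)) (-q) (-p) where
  hasDerivAt x := by
    have h1 := ((hg.hasDerivAt (-x)).comp x (hasDerivAt_neg x)).neg
    rwa [mul_neg_one, neg_neg] at h1
  nonneg x h1 h2 := hg.nonneg _ (by linarith) (by linarith)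
  lt x y h1 h2 h3 := by
    have := hg.lt (-y) (-x) (by linarith) (by linarith) (by linarith)
    linarith
  cross x₁ x₂ x₃ x₄ h1 h2 h3 h4 h5 := by
    have := hg.cross (-x₄) (-x₃) (-x₂) (-x₁) (by linarith) (by linarith) (by linarith) (by linarith)
      (by linarith)
    linarith
  deriv_mul_le x y h1 h2 h3 := by
    have := hg.deriv_mul_le (-y) (-x) (by linarith) (by linarith) (by linarith)
    linarith
  le_deriv x₁ x x₂ h1 h2 h3 h4 := by
    have := hg.le_deriv (-x₂) (-x) (-x₁) (by linarith) (by linarith) (by linarith) (by linarith)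
    linarith

lemma comp (hg : CrossExpanding g g' (f p) (f q)) (hf : CrossExpanding f f' p q) :
    CrossExpanding (fun x => g (f x)) (fun x => g' (f x) * f' x) p q where
  hasDerivAt x := (hg.hasDerivAt (f x)).comp x (hf.hasDerivAt x)
  nonneg x h1 h2 := mul_nonneg (hg.nonneg _ (hf.le le_rfl h1 h2) (hf.le h1 h2 le_rfl))
    (hf.nonneg x h1 h2)
  lt x y h1 h2 h3 := hg.lt _ _ (hf.le le_rfl h1 (h2.le.trans h3)) (hf.lt x y h1 h2 h3)
    (hf.le (h1.trans h2.le) h3 le_rfl)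
  cross x₁ x₂ x₃ x₄ h1 h2 h3 h4 h5 := by
    have e1 := hf.lt x₁ x₂ h1 h2 (by linarith)
    have e2 := hf.lt x₂ x₃ (by linarith) h3 (by linarith)
    have e3 := hf.lt x₃ x₄ (by linarith) h4 (by linarith)
    have l0 := hf.le le_rfl h1 (by linarith)
    have l1 := hf.le (x := x₄) (by linarith) h5 le_rfl
    have k1 := hf.cross x₁ x₂ x₃ x₄ h1 h2 h3 h4 h5
    have k2 := hg.cross _ _ _ _ l0 e1 e2 e3 l1
    have g1 := hg.lt _ _ l0 e1 (by linarith)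
    have g2 := hg.lt _ _ (by linarith) e2 (by linarith)
    have g3 := hg.lt _ _ (by linarith) e3 l1
    have a1 : 0 < (f x₂ - f x₁) * (f x₄ - f x₃) := mul_pos (by linarith) (by linarith)
    have a2 : 0 < (f x₃ - f x₂) * (f x₄ - f x₁) := mul_pos (by linarith) (by linarith)
    have a3 : 0 < (g (f x₂) - g (f x₁)) * (g (f x₄) - g (f x₃)) :=
      mul_pos (by linarith) (by linarith)
    have a4 : 0 < (x₂ - x₁) * (x₄ - x₃) := mul_pos (by linarith) (by linarith)
    generalize (f x₂ - f x₁) * (f x₄ - f x₃) = A1 at *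
    generalize (f x₃ - f x₂) * (f x₄ - f x₁) = A2 at *
    generalize (g (f x₂) - g (f x₁)) * (g (f x₄) - g (f x₃)) = A3 at *
    generalize (g (f x₃) - g (f x₂)) * (g (f x₄) - g (f x₁)) = A5 at *
    generalize (x₂ - x₁) * (x₄ - x₃) = A4 at *
    generalize (x₃ - x₂) * (x₄ - x₁) = A6 at *
    refine le_of_mul_le_mul_right (a := A1) ?_ a1
    calc A6 * A3 * A1 = A6 * A1 * A3 := by ring
      _ ≤ A2 * A4 * A3 := by gcongr
      _ = A2 * A3 * A4 := by ring
      _ ≤ A5 * A1 * A4 := by gcongr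
      _ = _ := by ring
  deriv_mul_le x y h1 h2 h3 := by
    have k1 := hf.deriv_mul_le x y h1 h2 h3
    have l0 := hf.le le_rfl h1 (by linarith)
    have l1 := hf.le (x := y) (by linarith) h3 le_rfl
    have e := hf.lt x y h1 h2 h3
    have k2 := hg.deriv_mul_le _ _ l0 e l1
    have n1 := hg.nonneg (f x) l0 (by linarith)
    have n2 := hg.nonneg (f y) (by linarith) l1
    calc g' (f x) * f' x * (g' (f y) * f' y) * (y - x) ^ 2
        = g' (f x) * g' (f y) * (f' x * f' y * (y - x) ^ 2) := by ring
      _ ≤ g' (f x) * g' (f y) * (f y - f x) ^ 2 := by gcongr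
      _ ≤ _ := k2
  le_deriv x₁ x x₂ h1 h2 h3 h4 := by
    have e1 := hf.lt x₁ x h1 h2 (by linarith)
    have e2 := hf.lt x x₂ (by linarith) h3 h4
    have l0 := hf.le le_rfl h1 (by linarith)
    have l1 := hf.le (x := x₂) (by linarith) h4 le_rfl
    have k1 := hf.le_deriv _ _ _ h1 h2 h3 h4
    have k2 := hg.le_deriv _ _ _ l0 e1 e2 l1
    have g1 := hg.lt _ _ l0 e1 (by linarith)
    have g2 := hg.lt _ _ (by linarith) e2 l1
    have n1 := hf.nonneg x (by linarith) (by linarith)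
    have a1 : 0 < (f x - f x₁) * (f x₂ - f x) := mul_pos (by linarith) (by linarith)
    have a3 : 0 < (g (f x) - g (f x₁)) * (g (f x₂) - g (f x)) :=
      mul_pos (by linarith) (by linarith)
    have a4 : 0 < (x - x₁) * (x₂ - x) := mul_pos (by linarith) (by linarith)
    have a5 : 0 < g (f x₂) - g (f x₁) := by linarith
    generalize (f x - f x₁) * (f x₂ - f x) = A1 at *
    generalize (g (f x) - g (f x₁)) * (g (f x₂) - g (f x)) = A3 at *
    generalize (x - x₁) * (x₂ - x) = A4 at *
    refine le_of_mul_le_mul_right (a := A1) ?_ a1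
    calc (x₂ - x₁) * A3 * A1 = (x₂ - x₁) * A1 * A3 := by ring
      _ ≤ f' x * (f x₂ - f x₁) * A4 * A3 := by gcongr
      _ = f' x * A4 * ((f x₂ - f x₁) * A3) := by ring
      _ ≤ f' x * A4 * (g' (f x) * (g (f x₂) - g (f x₁)) * A1) := by gcongr
      _ = _ := by ring

/-- The orientation-preserving second iterate `u ↦ -g (g u ^ 2)`. -/
lemma twice {l z : ℝ} (hg : CrossExpanding g g' l 1) (hl0 : l ≤ 0) (hgl : g l = -1) (hlz : l ≤ z)
    (hz : z ≤ 1) (hgz : g z ≤ 0) :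
    CrossExpanding (fun u => -g (g u ^ 2)) (fun u => g' (g u ^ 2) * (-(2 * g u)) * g' u) l z := by
  have hgz1 : -1 ≤ g z := hgl ▸ hg.le le_rfl hlz hz
  have h1 : CrossExpanding (fun x : ℝ => -(-x) ^ 2) (fun x => 2 * -x) (g l) (g z) :=
    (CrossExpanding.sq (-g l)).reflect.mono (by simp) (by simpa using hgz)
  have h2 := h1.comp (hg.mono le_rfl hz)
  have h3 : CrossExpanding (fun x => -g (-x)) (fun x => g' (-x)) (-(-g l) ^ 2) (-(-g z) ^ 2) :=
    hg.reflect.mono (by rw [hgl]; norm_num) (by nlinarith)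
  have h4 := CrossExpanding.comp (f := fun x => -(-g x) ^ 2) h3 h2
  convert h4 using 2 with u u
  · simp
  · simp only [neg_neg, even_two, Even.neg_pow]
    ring

end CrossExpanding

/-- `x ↦ g (x ^ 2)` is a unimodal map of `[-1, 1]` with `g` cross-ratio expanding, boundary fixed
point `1` and interior fixed point `-r`. -/
structure FoldFactor (g g' : ℝ → ℝ) (l r : ℝ) : Prop where
  exp : CrossExpanding g g' l 1
  l_nonpos : l ≤ 0
  map_l : g l = -1
  map_one : g 1 = 1
  r_pos : 0 < r
  r_lt : r < 1
  map_r : g (r ^ 2) = -r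
  sq_pos : 0 < g (g 0 ^ 2)
  deriv_one : 1 / 2 ≤ g' 1

namespace FoldFactor

variable {g g' : ℝ → ℝ} {l r : ℝ}

lemma neg_one_le (hg : FoldFactor g g' l r) {u : ℝ} (hu : 0 ≤ u) (hu1 : u ≤ 1) : -1 ≤ g u :=
  hg.map_l ▸ hg.exp.le le_rfl (hg.l_nonpos.trans hu) hu1

lemma le_one (hg : FoldFactor g g' l r) {u : ℝ} (hu : 0 ≤ u) (hu1 : u ≤ 1) : g u ≤ 1 :=
  hg.map_one ▸ hg.exp.le (hg.l_nonpos.trans hu) hu1 le_rfl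

lemma zero_lt_neg (hg : FoldFactor g g' l r) : g 0 < -r := by
  rw [← hg.map_r]
  exact hg.exp.lt _ _ hg.l_nonpos (pow_pos hg.r_pos 2)
    (pow_le_one₀ hg.r_pos.le hg.r_lt.le)

lemma twice_sq (hg : FoldFactor g g' l r) {y : ℝ} (hy : 0 ≤ y) (hy1 : y ≤ 1) (hgy : g (y ^ 2) ≤ 0) :
    CrossExpanding (fun x => -g (g (x ^ 2) ^ 2))
      (fun x => g' (g (x ^ 2) ^ 2) * (-(2 * g (x ^ 2))) * g' (x ^ 2) * (2 * x)) 0 y := by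
  have h2 : CrossExpanding (fun u => -g (g u ^ 2))
      (fun u => g' (g u ^ 2) * (-(2 * g u)) * g' u) (0 ^ 2) (y ^ 2) :=
    (hg.exp.twice hg.l_nonpos hg.map_l (hg.l_nonpos.trans (sq_nonneg y))
      (pow_le_one₀ hy hy1) hgy).mono (by simpa using hg.l_nonpos) le_rfl
  exact CrossExpanding.comp (f := fun x => x ^ 2) h2 (CrossExpanding.sq y)

/-- The second iterate has no fixed point between the turning point and `-r`. -/
lemma twice_lt (hg : FoldFactor g g' l r) {x : ℝ} (hx : 0 ≤ x) (hxr : x < r) :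
    -g (g (x ^ 2) ^ 2) < x := by
  by_contra! hcon
  obtain ⟨t, ht, hfix⟩ : ∃ t ∈ Icc 0 x, -g (g (t ^ 2) ^ 2) - t = 0 := by
    have hc : ContinuousOn (fun t => -g (g (t ^ 2) ^ 2) - t) (Icc 0 x) := by
      have := hg.exp.continuous
      fun_prop
    refine intermediate_value_Icc hx hc ⟨?_, by simpa using hcon⟩
    simpa using hg.sq_pos.le
  have hw := hg.sq_pos
  have htr : t < r := ht.2.trans_lt hxr
  have ht0 : 0 < t := ht.1.lt_of_ne (by
    rintro rfl
    simp at hfix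
    linarith)
  have hr := hg.r_pos
  have hr1 := hg.r_lt
  have htt : t ^ 2 < r ^ 2 := by gcongr
  have hr2 : r ^ 2 < 1 := by nlinarith
  set y := -g (t ^ 2) with hy
  have hyr : r < y := by
    have := hg.exp.lt _ _ (hg.l_nonpos.trans (sq_nonneg t)) htt hr2.le
    rw [hg.map_r] at this
    linarith
  have hy1 : y ≤ 1 := by
    have := hg.neg_one_le (sq_nonneg t) (htt.trans hr2).le
    linarith
  have hgy : g (y ^ 2) = -t := by rw [hy, neg_sq]; linarith
  have hE := hg.twice_sq (y := y) (by linarith) hy1 (by linarith)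
  set Φ : ℝ → ℝ := fun x => -g (g (x ^ 2) ^ 2) with hΦ
  have Φ0 : Φ 0 = -g (g 0 ^ 2) := by simp [hΦ]
  have Φt : Φ t = t := by simp only [hΦ]; linarith
  have Φr : Φ r = r := by simp only [hΦ]; rw [hg.map_r, neg_sq, hg.map_r, neg_neg]
  have Φy : Φ y = y := by simp only [hΦ]; rw [hgy, neg_sq]
  have h1 := hE.le_deriv 0 t r le_rfl ht0 htr hyr.le
  have h2 := hE.le_deriv t r y ht0.le htr hyr le_rfl
  have h3 := hE.deriv_mul_le t r ht0.le htr hyr.le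
  rw [Φ0, Φt, Φr] at h1
  rw [Φt, Φr, Φy] at h2
  rw [Φt, Φr] at h3
  generalize g' (g (t ^ 2) ^ 2) * (-(2 * g (t ^ 2))) * g' (t ^ 2) * (2 * t) = D at *
  generalize g' (g (r ^ 2) ^ 2) * (-(2 * g (r ^ 2))) * g' (r ^ 2) * (2 * r) = E at *
  generalize g (g 0 ^ 2) = w at *
  have e2 : 1 ≤ E := by
    have : 0 < (y - t) * ((r - t) * (y - r)) :=
      mul_pos (by linarith) (mul_pos (by linarith) (by linarith))
    by_contra! hE1
    nlinarith
  have e1 : r * (t + w) ≤ D * (r + w) * t := by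
    have : 0 < r - t := by linarith
    by_contra! hD
    nlinarith
  have e3 : D * E ≤ 1 := by
    have : 0 < (r - t) ^ 2 := pow_pos (by linarith) 2
    by_contra! hD
    nlinarith
  have e4 : D ≤ 1 := by
    by_contra! hD
    nlinarith
  have : D * ((r + w) * t) ≤ 1 * ((r + w) * t) := by
    have : 0 < (r + w) * t := mul_pos (by linarith) ht0
    gcongr
  nlinarith [mul_pos hw (sub_pos.2 htr)]

lemma r_sq_lt_one (hg : FoldFactor g g' l r) : r ^ 2 < 1 := by
  have := hg.r_pos
  have := hg.r_lt
  nlinarith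

/-- The interior fixed point is repelling. -/
lemma one_le_multiplier (hg : FoldFactor g g' l r) : 1 ≤ 2 * r * g' (r ^ 2) := by
  have hr := hg.r_pos
  have hn : 0 ≤ g' (r ^ 2) := hg.exp.nonneg _ (hg.l_nonpos.trans (sq_nonneg r)) hg.r_sq_lt_one.le
  have hE := (hg.twice_sq hr.le hg.r_lt.le (by rw [hg.map_r]; linarith)).hasDerivAt r
  rw [hg.map_r, neg_sq] at hE
  have hD : 1 ≤ g' (r ^ 2) * (-(2 * -r)) * g' (r ^ 2) * (2 * r) := by
    refine ge_of_tendsto (hE.tendsto_slope.mono_left (nhdsWithin_mono r (s := Iio r)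
      fun x hx => (ne_of_lt hx : x ≠ r))) ?_
    filter_upwards [Ioo_mem_nhdsLT hr] with x hx
    have h1 := hg.twice_lt hx.1.le hx.2
    rw [slope_def_field, hg.map_r, neg_sq, hg.map_r, neg_neg,
      one_le_div_of_neg (by linarith [hx.2])]
    linarith
  by_contra! hcon
  have h0 : 0 ≤ 2 * r * g' (r ^ 2) := by positivity
  nlinarith

lemma one_le_deriv (hg : FoldFactor g g' l r) : 1 / 2 ≤ g' (r ^ 2) := by
  have h1 := hg.one_le_multiplier
  have hr := hg.r_lt
  have hn : 0 ≤ g' (r ^ 2) := hg.exp.nonneg _ (hg.l_nonpos.trans (sq_nonneg r)) hg.r_sq_lt_one.le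
  nlinarith [hg.r_pos]

lemma one_eighth_le (hg : FoldFactor g g' l r) : 1 / 8 ≤ r := by
  by_contra! hr
  have hr0 := hg.r_pos
  have h1 := hg.exp.deriv_mul_le _ _ (hg.l_nonpos.trans (sq_nonneg r)) hg.r_sq_lt_one le_rfl
  rw [hg.map_one, hg.map_r] at h1
  have h2 : 4 ≤ g' (r ^ 2) := by
    have := hg.one_le_multiplier
    by_contra! h
    nlinarith
  have h3 : (4 : ℝ) * (1 / 2) * (1 - r ^ 2) ^ 2 ≤ g' (r ^ 2) * g' 1 * (1 - r ^ 2) ^ 2 := by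
    have := hg.deriv_one
    gcongr
  have h4 : 63 / 64 ≤ 1 - r ^ 2 := by nlinarith
  nlinarith

lemma deriv_le (hg : FoldFactor g g' l r) (hr : r ≤ 3 / 4) {u : ℝ} (hu : 0 ≤ u) (hu1 : u ≤ 1) :
    g' u ≤ 200 := by
  have hr0 := hg.r_pos
  have hr2 : r ^ 2 ≤ 9 / 16 := by nlinarith
  have hlu := hg.l_nonpos.trans hu
  have hnu := hg.exp.nonneg u hlu hu1
  have hrange : ∀ {x y : ℝ}, 0 ≤ x → x ≤ 1 → 0 ≤ y → y ≤ 1 → (g y - g x) ^ 2 ≤ 4 := by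
    intro x y hx hx1 hy hy1
    have := hg.neg_one_le hx hx1
    have := hg.le_one hx hx1
    have := hg.neg_one_le hy hy1
    have := hg.le_one hy hy1
    nlinarith
  rcases le_total u (25 / 32) with h | h
  · have h1 := (hg.exp.deriv_mul_le u 1 hlu (by linarith) le_rfl).trans
      (hrange hu hu1 zero_le_one le_rfl)
    have h2 : g' u * (1 / 2) * (7 / 32) ^ 2 ≤ g' u * g' 1 * (1 - u) ^ 2 := by
      have := hg.deriv_one
      gcongr
      linarith
    linarith
  · have h1 := (hg.exp.deriv_mul_le (r ^ 2) u (hg.l_nonpos.trans (sq_nonneg r)) (by linarith)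
      hu1).trans (hrange (sq_nonneg r) (by linarith) hu hu1)
    have h2 : 1 / 2 * g' u * (7 / 32) ^ 2 ≤ g' (r ^ 2) * g' u * (u - r ^ 2) ^ 2 := by
      have := hg.one_le_deriv
      gcongr
      linarith
    linarith

end FoldFactor

lemma exists_neg_fixed {g : ℝ → ℝ} (hc : Continuous g) (h0 : g 0 < 0) (h1 : g 1 = 1) :
    ∃ r, 0 < r ∧ r < 1 ∧ g (r ^ 2) = -r := by
  obtain ⟨r, hr, h⟩ := intermediate_value_Ioo zero_le_one
    (f := fun x => g (x ^ 2) + x) (by fun_prop) (show (0 : ℝ) ∈ _ from ⟨by simpa using h0, by simp [h1]⟩)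
  exact ⟨r, hr.1, hr.2, by linarith⟩

namespace FoldFactor

variable {g g' : ℝ → ℝ} {l r : ℝ}

/-- The fold factor of the renormalization `x ↦ -(1 / r) P (P (-r x))` of `P x = g (x ^ 2)`. -/
noncomputable def next (g : ℝ → ℝ) (r : ℝ) (u : ℝ) : ℝ := 1 / r * -g (g (r ^ 2 * u + 0) ^ 2) + 0

noncomputable def nextDeriv (g g' : ℝ → ℝ) (r : ℝ) (u : ℝ) : ℝ :=
  1 / r * (g' (g (r ^ 2 * u + 0) ^ 2) * (-(2 * g (r ^ 2 * u + 0))) * g' (r ^ 2 * u + 0) * r ^ 2)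

lemma exp_next (hg : FoldFactor g g' l r) :
    CrossExpanding (next g r) (nextDeriv g g' r) (l / r ^ 2) 1 := by
  have hr := hg.r_pos
  have h1 : CrossExpanding (fun u => -g (g u ^ 2))
      (fun u => g' (g u ^ 2) * (-(2 * g u)) * g' u) (r ^ 2 * (l / r ^ 2) + 0) (r ^ 2 * 1 + 0) := by
    rw [mul_div_cancel₀ _ (by positivity), add_zero, add_zero, mul_one]
    exact hg.exp.twice hg.l_nonpos hg.map_l (hg.l_nonpos.trans (sq_nonneg r)) hg.r_sq_lt_one.le
      (by rw [hg.map_r]; linarith)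
  have h2 := CrossExpanding.comp (f := fun u => r ^ 2 * u + 0) h1
    (CrossExpanding.affine (c := r ^ 2) (by positivity) 0 _ _)
  exact CrossExpanding.comp (g := fun x => 1 / r * x + 0) (g' := fun _ => 1 / r)
    (CrossExpanding.affine (by positivity) 0 _ _) h2

lemma next_one (hg : FoldFactor g g' l r) : next g r 1 = 1 := by
  have hr := hg.r_pos.ne'
  simp only [next, mul_one, add_zero]
  rw [hg.map_r, neg_sq, hg.map_r]
  field_simp

lemma exists_l_next (hg : FoldFactor g g' l r) (hren : g (g 0 ^ 2) ≤ r) :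
    ∃ l', l / r ^ 2 ≤ l' ∧ l' ≤ 0 ∧ next g r l' = -1 := by
  have hr := hg.r_pos
  have hl := div_nonpos_of_nonpos_of_nonneg hg.l_nonpos (sq_nonneg r)
  obtain ⟨l', h, h'⟩ := intermediate_value_Icc hl hg.exp_next.continuous.continuousOn
    (show (-1 : ℝ) ∈ _ from by
      constructor
      · simp only [next]
        rw [mul_div_cancel₀ _ (by positivity), add_zero, add_zero, hg.map_l, neg_sq, one_pow,
          hg.map_one, mul_neg_one, neg_le_neg_iff, le_div_iff₀ hr]
        linarith [hg.r_lt]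
      · simp only [next, mul_zero, add_zero]
        rw [mul_neg, neg_le_neg_iff, one_div, inv_mul_le_iff₀ hr]
        linarith)
  exact ⟨l', h.1, h.2, h'⟩

lemma half_le_nextDeriv_one (hg : FoldFactor g g' l r) : 1 / 2 ≤ nextDeriv g g' r 1 := by
  have hr := hg.r_pos
  have h1 := hg.one_le_multiplier
  simp only [nextDeriv, mul_one, add_zero]
  rw [hg.map_r, neg_sq]
  have : 1 / r * (g' (r ^ 2) * -(2 * -r) * g' (r ^ 2) * r ^ 2) = (2 * r * g' (r ^ 2)) ^ 2 / 2 := by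
    field_simp
  rw [this]
  nlinarith

/-- A priori bound: after one renormalization the interior fixed point stays away from `-1`. -/
lemma next_le (hg : FoldFactor g g' l r) (hr34 : r ≤ 3 / 4) (hren : g (g 0 ^ 2) ≤ r) {ρ : ℝ}
    (hρ0 : 0 < ρ) (hρ1 : ρ < 1) (hρ : next g r (ρ ^ 2) = -ρ) : ρ ≤ 3 / 4 := by
  have hr := hg.r_pos
  set x := r * ρ with hx
  have hx0 : 0 < x := by positivity
  have hxr : x < r := by nlinarith
  have hxx : x ^ 2 < r ^ 2 := by gcongr
  obtain ⟨y, hy⟩ : ∃ y, y = -g (x ^ 2) := ⟨_, rfl⟩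
  have hyx : g (y ^ 2) = x := by
    simp only [next, add_zero, ← mul_pow] at hρ
    rw [← hx] at hρ
    rw [hy, neg_sq]
    field_simp at hρ
    rw [hx]
    linarith
  have hry : r < y := by
    have := hg.exp.lt _ _ (hg.l_nonpos.trans (sq_nonneg x)) hxx hg.r_sq_lt_one.le
    rw [hg.map_r] at this
    linarith
  obtain ⟨V, hV⟩ : ∃ V, V = -g 0 := ⟨_, rfl⟩
  have hyV : y < V := by
    have := hg.exp.lt _ _ hg.l_nonpos (pow_pos hx0 2) (hxx.trans hg.r_sq_lt_one).le
    linarith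
  have hV1 : V ≤ 1 := by linarith [hg.neg_one_le le_rfl zero_le_one]
  have hVlt : V < 1 := by
    refine hV1.lt_of_ne fun h => ?_
    rw [show g 0 = -1 by linarith, neg_sq, one_pow, hg.map_one] at hren
    linarith
  obtain ⟨z, hz⟩ : ∃ z, z = g (V ^ 2) := ⟨_, rfl⟩
  have hzr : z ≤ r := by rw [hz, hV, neg_sq]; exact hren
  have hg0 : g 0 = -V := by linarith
  have hl0 : l < 0 := by
    refine hg.l_nonpos.lt_of_ne fun h => ?_
    have := hg.map_l
    rw [h, hg0] at this
    linarith
  have hryy : r ^ 2 < y ^ 2 := by gcongr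
  have hyV2 : y ^ 2 < V ^ 2 := by
    have : 0 < y := by linarith
    gcongr
  have hV21 : V ^ 2 < 1 := by nlinarith
  have hxz : x < z := by
    have := hg.exp.lt _ _ (hg.l_nonpos.trans (sq_nonneg y)) hyV2 hV21.le
    rwa [hyx, ← hz] at this
  have c1 := hg.exp.cross _ _ _ _ (hg.l_nonpos.trans (sq_nonneg r)) hryy hyV2 hV21 le_rfl
  have c2 := hg.exp.cross _ _ _ _ le_rfl hl0 (pow_pos hx0 2) hxx hg.r_sq_lt_one.le
  rw [hyx, ← hz, hg.map_one, hg.map_r] at c1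
  rw [hg.map_l, hg0, hg.map_r, show g (x ^ 2) = -y by linarith] at c2
  have d2 : x ^ 2 * (1 - V) * (y - r) ≤ (V - y) * (1 - r) * (r ^ 2 - x ^ 2) := by
    have e : 0 ≤ x ^ 2 * (1 - V) * (y - r) * r ^ 2 :=
      mul_nonneg (mul_nonneg (mul_nonneg (sq_nonneg x) (by linarith)) (by linarith)) (sq_nonneg r)
    refine le_of_mul_le_mul_right (a := -l) ?_ (by linarith)
    linarith
  have d1 : (V - y) * (V + y) * (1 - r) * (x + r) * (1 - z) ≤
      (z - x) * (y - r) * (y + r) * (1 - V) * (1 + V) := by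
    refine le_of_mul_le_mul_right (a := 1 + r) ?_ (by linarith)
    linarith
  have d3 : x ^ 2 * (V + y) * (x + r) * (1 - z) ≤ (z - x) * (y + r) * (1 + V) * (r ^ 2 - x ^ 2) := by
    have e0 : 0 < (1 - V) * (y - r) := mul_pos (by linarith) (by linarith)
    refine le_of_mul_le_mul_right (a := (1 - V) * (y - r)) ?_ e0
    have e1 : 0 ≤ (V + y) * (x + r) * (1 - z) :=
      mul_nonneg (mul_nonneg (by linarith) (by linarith)) (by linarith)
    calc x ^ 2 * (V + y) * (x + r) * (1 - z) * ((1 - V) * (y - r))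
        = x ^ 2 * (1 - V) * (y - r) * ((V + y) * (x + r) * (1 - z)) := by ring
      _ ≤ (V - y) * (1 - r) * (r ^ 2 - x ^ 2) * ((V + y) * (x + r) * (1 - z)) := by gcongr
      _ = (V - y) * (V + y) * (1 - r) * (x + r) * (1 - z) * (r ^ 2 - x ^ 2) := by ring
      _ ≤ (z - x) * (y - r) * (y + r) * (1 - V) * (1 + V) * (r ^ 2 - x ^ 2) := by
        have : 0 ≤ r ^ 2 - x ^ 2 := by linarith
        gcongr
      _ = _ := by ring
  have d4 : x ^ 2 * (V + y) * (x + r) * (1 - r) ≤ (r - x) * (V + y) * 2 * (r ^ 2 - x ^ 2) := by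
    calc x ^ 2 * (V + y) * (x + r) * (1 - r) ≤ x ^ 2 * (V + y) * (x + r) * (1 - z) := by
          have : 0 ≤ V + y := by linarith
          gcongr
      _ ≤ (z - x) * (y + r) * (1 + V) * (r ^ 2 - x ^ 2) := d3
      _ ≤ (r - x) * (V + y) * 2 * (r ^ 2 - x ^ 2) := by
        have : 0 ≤ r ^ 2 - x ^ 2 := by linarith
        have : 0 ≤ r - x := by linarith
        have : 0 ≤ V + y := by linarith
        gcongr
        · linarith
        · linarith
        · linarith
  have d5 : ρ ^ 2 * (1 - r) ≤ 2 * (1 - ρ) ^ 2 := by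
    have e : 0 < (V + y) * (x + r) * r ^ 2 := by
      have : 0 < V + y := by linarith
      positivity
    refine le_of_mul_le_mul_right (a := (V + y) * (x + r) * r ^ 2) ?_ e
    rw [hx] at d4 ⊢
    linarith
  by_contra! hcon
  have : (3 / 4 : ℝ) ^ 2 * (1 / 4) ≤ ρ ^ 2 * (1 - r) := by gcongr; linarith
  have : (1 - ρ) ^ 2 ≤ (1 / 4) ^ 2 := pow_le_pow_left₀ (by linarith) (by linarith) 2
  linarith

/-- If the odd iterates of the turning point stay on one side, the map is renormalizable. -/
lemma map_map_zero_le (hg : FoldFactor g g' l r) {e : ℕ → ℝ} (he0 : e 0 = 0)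
    (he : ∀ j, e (j + 1) = -g (e j ^ 2)) (hodd : ∀ j, Odd j → 0 < e j) : g (g 0 ^ 2) ≤ r := by
  by_contra! hcon
  have hr := hg.r_pos
  have e1 : e 1 = -g 0 := by rw [he 0, he0]; norm_num
  have e2 : e 2 = -g (g 0 ^ 2) := by rw [he 1, e1, neg_sq]
  have hg0 : g 0 ^ 2 ≤ 1 := by
    have := hg.neg_one_le le_rfl zero_le_one
    have := hg.zero_lt_neg
    nlinarith
  have e3 : e 3 < r := by
    rw [he 2, e2, neg_sq]
    have h1 := hg.le_one (sq_nonneg (g 0)) hg0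
    have h2 := hg.exp.lt (r ^ 2) (g (g 0 ^ 2) ^ 2) (hg.l_nonpos.trans (sq_nonneg r)) (by gcongr)
      (by nlinarith)
    rw [hg.map_r] at h2
    linarith
  have hstep : ∀ i, e (2 * (i + 1) + 3) = -g (g (e (2 * i + 3) ^ 2) ^ 2) := fun i => by
    rw [show 2 * (i + 1) + 3 = 2 * i + 3 + 1 + 1 by ring, he, he, neg_sq]
  have hpos : ∀ i, 0 < e (2 * i + 3) := fun i => hodd _ ⟨i + 1, by ring⟩
  have hlt : ∀ i, e (2 * i + 3) < r := by
    intro i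
    induction i with
    | zero => exact e3
    | succ i ih => rw [hstep]; exact (hg.twice_lt (hpos i).le ih).trans ih
  have hanti : Antitone fun i => e (2 * i + 3) := antitone_nat_of_succ_le fun i => by
    simp only [hstep]
    exact (hg.twice_lt (hpos i).le (hlt i)).le
  have hbdd : BddBelow (range fun i => e (2 * i + 3)) := ⟨0, by rintro _ ⟨i, rfl⟩; exact (hpos i).le⟩
  have hlim := tendsto_atTop_ciInf hanti hbdd
  set L := ⨅ i, e (2 * i + 3) with hL
  have hL0 : 0 ≤ L := le_ciInf fun i => (hpos i).le
  have hLr : L < r := (ciInf_le hbdd 0).trans_lt e3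
  have hc : Continuous fun x => -g (g (x ^ 2) ^ 2) := by
    have := hg.exp.continuous
    fun_prop
  have hlim' : Tendsto (fun i => e (2 * (i + 1) + 3)) atTop (𝓝 (-g (g (L ^ 2) ^ 2))) := by
    simp only [hstep]
    exact (hc.tendsto L).comp hlim
  have := tendsto_nhds_unique hlim' (hlim.comp (tendsto_add_atTop_nat 1))
  exact (hg.twice_lt hL0 hLr).ne this

end FoldFactor

/-- The derivative of the `N`-th iterate of `fa a`. -/
noncomputable def dsp (a : ℝ) (N : ℕ) (x : ℝ) : ℝ := ∏ i ∈ Finset.range N, 2 * (fa a)^[i] x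

/-- The derivative of `(fa a)^[N] x` in the parameter. -/
noncomputable def dpar (a : ℝ) : ℕ → ℝ → ℝ
  | 0, _ => 0
  | N + 1, x => 2 * (fa a)^[N] x * dpar a N x + 1

lemma hasDerivAt_iterate (a : ℝ) (N : ℕ) (x : ℝ) : HasDerivAt ((fa a)^[N]) (dsp a N x) x := by
  induction N with
  | zero => simpa [dsp] using hasDerivAt_id x
  | succ N ih =>
    have h1 : HasDerivAt (fun y => (fa a)^[N] y ^ 2 + a) (2 * (fa a)^[N] x * dsp a N x) x := by
      simpa using (ih.pow 2).add_const a
    have h2 : (fa a)^[N + 1] = fun y => (fa a)^[N] y ^ 2 + a := by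
      funext y
      rw [Function.iterate_succ_apply', fa]
    rw [h2, dsp, Finset.prod_range_succ, mul_comm]
    exact h1

lemma hasDerivAt_iterate_param (a : ℝ) (N : ℕ) (x : ℝ) :
    HasDerivAt (fun a => (fa a)^[N] x) (dpar a N x) a := by
  induction N with
  | zero => simpa [dpar] using hasDerivAt_const a x
  | succ N ih =>
    have h1 : HasDerivAt (fun a => (fa a)^[N] x ^ 2 + a) (2 * (fa a)^[N] x * dpar a N x + 1) a := by
      simpa using (ih.fun_pow 2).fun_add (hasDerivAt_id' a)
    have h2 : (fun a => (fa a)^[N + 1] x) = fun a => (fa a)^[N] x ^ 2 + a := by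
      funext a
      rw [Function.iterate_succ_apply', fa]
    rw [h2]
    exact h1

lemma dpar_add (a : ℝ) (N N' : ℕ) (x : ℝ) :
    dpar a (N + N') x = dsp a N' ((fa a)^[N] x) * dpar a N x + dpar a N' ((fa a)^[N] x) := by
  induction N' with
  | zero => simp [dsp, dpar]
  | succ N' ih =>
    rw [← add_assoc, dpar, ih, dpar, dsp, dsp, Finset.prod_range_succ, add_comm N N',
      Function.iterate_add_apply]
    ring

/-- The sign conditions on the critical orbit inherited from an `m` times renormalizable tent map. -/
def RenormSigns (m : ℕ) (a : ℝ) : Prop :=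
  (∀ k < m, ∀ j, Odd j → 0 < (-1) ^ (k + 1) * co a (2 ^ k * j)) ∧
    0 < (-1) ^ (m + 1) * co a (2 ^ m) ∧ 0 < (-1) ^ m * co a (2 ^ (m + 1))

lemma RenormSigns.two_pow {m : ℕ} {a : ℝ} (hs : RenormSigns m a) {k : ℕ} (hk : k ≤ m) :
    0 < (-1) ^ (k + 1) * co a (2 ^ k) ∧ 0 < (-1) ^ k * co a (2 ^ (k + 1)) := by
  obtain ⟨h1, h2, h3⟩ := hs
  rcases hk.lt_or_eq with hk | rfl
  · refine ⟨by simpa using h1 k hk 1 odd_one, ?_⟩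
    rcases (Nat.succ_le_of_lt hk).lt_or_eq with hk' | hk'
    · simpa [pow_succ] using h1 (k + 1) hk' 1 odd_one
    · rw [Nat.succ_eq_add_one] at hk'
      rw [← hk'] at h2
      simpa [pow_succ] using h2
  · exact ⟨h2, h3⟩

/-- A fold factor of the `2 ^ k`-th iterate. -/
structure RenormLevel (a : ℝ) (k : ℕ) (β : ℝ) (g g' : ℝ → ℝ) (l r : ℝ) : Prop where
  fold : FoldFactor g g' l r
  r_le : r ≤ 3 / 4
  sign_pos : 0 < (-1) ^ k * β
  le_abs : 1 / 8 ^ k ≤ |β|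
  conj : ∀ x, (fa a)^[2 ^ k] (β * x) = β * g (x ^ 2)
  dpar_le : ∀ x, |x| ≤ |β| → |dpar a (2 ^ k) x| ≤ 401 ^ k

lemma signs_of_conj {m k : ℕ} {a β : ℝ} {g : ℝ → ℝ} (hs : RenormSigns m a) (hk : k ≤ m)
    (hβ : 0 < (-1) ^ k * β) (hc : ∀ x, (fa a)^[2 ^ k] (β * x) = β * g (x ^ 2)) :
    g 0 < 0 ∧ 0 < g (g 0 ^ 2) := by
  obtain ⟨h1, h2⟩ := hs.two_pow hk
  have e1 : co a (2 ^ k) = β * g 0 := by simpa [co] using hc 0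
  have e2 : co a (2 ^ (k + 1)) = β * g (g 0 ^ 2) := by
    rw [pow_succ, mul_two, co_add, e1, hc]
  rw [e1, pow_succ] at h1
  rw [e2, ← mul_assoc] at h2
  refine ⟨?_, pos_of_mul_pos_right h2 hβ.le⟩
  by_contra! hcon
  nlinarith [mul_nonneg hβ.le hcon]

namespace RenormLevel

variable {a β l r : ℝ} {k : ℕ} {g g' : ℝ → ℝ}

lemma ne_zero (hL : RenormLevel a k β g g' l r) : β ≠ 0 := by
  rintro rfl
  simpa using hL.sign_pos

lemma bounds (hL : RenormLevel a k β g g' l r) {x : ℝ} (hx : |x| ≤ |β|) :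
    |(fa a)^[2 ^ k] x| ≤ |β| ∧ |dsp a (2 ^ k) x| ≤ 400 ∧
      |(fa a)^[2 ^ k] x - (fa a)^[2 ^ k] 0| ≤ 200 * 8 ^ k * x ^ 2 := by
  have hβ := hL.ne_zero
  have hβ0 := abs_pos.2 hβ
  obtain ⟨t, rfl⟩ : ∃ t, x = β * t := ⟨x / β, by field_simp⟩
  have ht : |t| ≤ 1 := by
    rw [abs_mul] at hx
    exact le_of_mul_le_mul_left (by linarith) hβ0
  have ht0 := sq_nonneg t
  have ht1 : t ^ 2 ≤ 1 := (sq_le_one_iff_abs_le_one t).2 ht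
  have hg := hL.fold
  refine ⟨?_, ?_, ?_⟩
  · rw [hL.conj, abs_mul]
    exact mul_le_of_le_one_right hβ0.le (abs_le.2 ⟨hg.neg_one_le ht0 ht1, hg.le_one ht0 ht1⟩)
  · have h1 : HasDerivAt (fun t => (fa a)^[2 ^ k] (β * t)) (dsp a (2 ^ k) (β * t) * β) t := by
      have := (hasDerivAt_iterate a (2 ^ k) (β * t)).comp t ((hasDerivAt_id t).const_mul β)
      simpa [Function.comp_def] using this
    have h2 : HasDerivAt (fun t => (fa a)^[2 ^ k] (β * t)) (β * (g' (t ^ 2) * (2 * t))) t := by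
      simp only [hL.conj]
      have := ((hg.exp.hasDerivAt (t ^ 2)).comp t (hasDerivAt_pow 2 t)).const_mul β
      simpa [Function.comp_def] using this
    have h3 := h1.unique h2
    have h4 : dsp a (2 ^ k) (β * t) = g' (t ^ 2) * (2 * t) := by
      rw [mul_comm] at h3
      exact mul_left_cancel₀ hβ h3
    rw [h4, abs_mul, abs_mul, abs_of_nonneg (hg.exp.nonneg _ (hg.l_nonpos.trans ht0) ht1), abs_two]
    calc g' (t ^ 2) * (2 * |t|) ≤ 200 * (2 * 1) := by
          gcongr
          exact hg.deriv_le hL.r_le ht0 ht1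
      _ = _ := by norm_num
  · have h0 : (fa a)^[2 ^ k] 0 = β * g 0 := by simpa using hL.conj 0
    have h1 : g (t ^ 2) - g 0 ≤ 200 * (t ^ 2 - 0) := by
      refine Convex.image_sub_le_mul_sub_of_deriv_le (convex_Icc (0 : ℝ) 1)
        hg.exp.continuous.continuousOn
        (fun x _ => (hg.exp.hasDerivAt x).differentiableAt.differentiableWithinAt) (fun x hx => ?_)
        0 (by simp) (t ^ 2) ⟨ht0, ht1⟩ ht0
      rw [(hg.exp.hasDerivAt x).deriv]
      have := interior_subset hx
      exact hg.deriv_le hL.r_le this.1 this.2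
    have h2 : 0 ≤ g (t ^ 2) - g 0 := sub_nonneg.2 (hg.exp.le hg.l_nonpos ht0 ht1)
    have h3 : 1 ≤ 8 ^ k * |β| := by
      have := hL.le_abs
      rwa [div_le_iff₀' (by positivity)] at this
    rw [hL.conj, h0, ← mul_sub, abs_mul, abs_of_nonneg h2]
    calc |β| * (g (t ^ 2) - g 0) ≤ |β| * (200 * (t ^ 2 - 0)) := by gcongr
      _ = 200 * (1 * (|β| * t ^ 2)) := by ring
      _ ≤ 200 * (8 ^ k * |β| * (|β| * t ^ 2)) := by gcongr
      _ = 200 * 8 ^ k * (β * t) ^ 2 := by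
        rw [mul_pow, ← sq_abs β]
        ring

end RenormLevel

lemma RenormSigns.exists_level_zero {m : ℕ} {a : ℝ} (ha : -2 ≤ a) (hs : RenormSigns m a) :
    ∃ β g g' l r, RenormLevel a 0 β g g' l r := by
  have ha0 : a < 0 := by simpa [co_one] using (hs.two_pow (Nat.zero_le m)).1
  have hsq := beta_sq (a := a) (by linarith)
  have h2 := beta_le ha
  have h1 : 1 < beta a := by
    have := beta_pos a
    nlinarith
  have hβ0 : beta a ≠ 0 := by positivity
  have hconj : ∀ x, (fa a)^[2 ^ 0] (beta a * x) = beta a * (beta a * x ^ 2 + a / beta a) := by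
    intro x
    rw [pow_zero, Function.iterate_one, fa]
    field_simp
  obtain ⟨-, h3⟩ := signs_of_conj hs (Nat.zero_le m) (β := beta a)
    (g := fun u => beta a * u + a / beta a) (by simpa using zero_lt_one.trans h1) hconj
  refine ⟨beta a, fun u => beta a * u + a / beta a, fun _ => beta a, -(beta a + a) / beta a ^ 2,
    (beta a - 1) / beta a,
    ⟨⟨CrossExpanding.affine (by positivity) _ _ _, ?_, ?_, ?_, ?_, ?_, ?_, h3, by linarith⟩,
      ?_, by simpa using zero_lt_one.trans h1, ?_, hconj, ?_⟩⟩
  · exact div_nonpos_of_nonpos_of_nonneg (by nlinarith) (sq_nonneg _)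
  · field_simp
    ring
  · field_simp
    linarith
  · exact div_pos (by linarith) (by linarith)
  · rw [div_lt_one (by linarith)]
    linarith
  · field_simp
    nlinarith
  · rw [div_le_iff₀ (by linarith)]
    linarith
  · simpa using h1.le.trans (le_abs_self _)
  · intro x _
    simp [dpar]

lemma RenormLevel.exists_next {m k : ℕ} {a β l r : ℝ} {g g' : ℝ → ℝ}
    (hL : RenormLevel a k β g g' l r) (hs : RenormSigns m a) (hk : k < m) :
    ∃ β g g' l r, RenormLevel a (k + 1) β g g' l r := by
  have hg := hL.fold
  have hβ := hL.ne_zero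
  have hr := hg.r_pos
  have hren : g (g 0 ^ 2) ≤ r := by
    refine hg.map_map_zero_le (e := fun j => -(co a (2 ^ k * j) / β)) (by simp) (fun j => ?_) ?_
    · have h1 : co a (2 ^ k * (j + 1)) = β * g ((co a (2 ^ k * j) / β) ^ 2) := by
        rw [← hL.conj, mul_div_cancel₀ _ hβ, ← co_add]
        congr 1
        ring
      rw [h1, neg_sq, mul_div_cancel_left₀ _ hβ]
    · intro j hj
      have h1 := hs.1 k hk j hj
      have h2 := hL.sign_pos
      have h3 : -(co a (2 ^ k * j) / β) = (-1) ^ (k + 1) * co a (2 ^ k * j) / ((-1) ^ k * β) := by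
        rw [pow_succ]
        field_simp
      rw [h3]
      exact div_pos h1 h2
  have hconj : ∀ x, (fa a)^[2 ^ (k + 1)] (-(r * β) * x) =
      -(r * β) * FoldFactor.next g r (x ^ 2) := by
    intro x
    rw [pow_succ, mul_two, Function.iterate_add_apply, show -(r * β) * x = β * (-(r * x)) by ring,
      hL.conj, hL.conj, FoldFactor.next, neg_sq, mul_pow, add_zero, add_zero]
    field_simp
  have hsign : 0 < (-1) ^ (k + 1) * -(r * β) := by
    have := mul_pos hr hL.sign_pos
    rw [pow_succ]
    linarith
  obtain ⟨h0, h00⟩ := signs_of_conj hs hk hsign hconj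
  obtain ⟨l', hl1, hl2, hl3⟩ := hg.exists_l_next hren
  obtain ⟨ρ, hρ0, hρ1, hρ⟩ := exists_neg_fixed hg.exp_next.continuous h0 hg.next_one
  have habs : |(-(r * β))| = r * |β| := by rw [abs_neg, abs_mul, abs_of_pos hr]
  refine ⟨-(r * β), FoldFactor.next g r, FoldFactor.nextDeriv g g' r, l', ρ,
    ⟨⟨hg.exp_next.mono hl1 le_rfl, hl2, hl3, hg.next_one, hρ0, hρ1, hρ, h00,
      hg.half_le_nextDeriv_one⟩, hg.next_le hL.r_le hren hρ0 hρ1 hρ, hsign, ?_, hconj, ?_⟩⟩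
  · have h1 := hL.le_abs
    have h2 := hg.one_eighth_le
    rw [habs, show (1 : ℝ) / 8 ^ (k + 1) = 1 / 8 * (1 / 8 ^ k) by rw [pow_succ]; field_simp]
    gcongr
  · intro x hx
    have hx' : |x| ≤ |β| := hx.trans (habs ▸ mul_le_of_le_one_left (abs_nonneg β) hg.r_lt.le)
    obtain ⟨h1, -, -⟩ := hL.bounds hx'
    obtain ⟨-, h2, -⟩ := hL.bounds h1
    rw [pow_succ 2, mul_two, dpar_add]
    calc _ ≤ |dsp a (2 ^ k) ((fa a)^[2 ^ k] x) * dpar a (2 ^ k) x| +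
          |dpar a (2 ^ k) ((fa a)^[2 ^ k] x)| := abs_add_le _ _
      _ ≤ 400 * 401 ^ k + 401 ^ k := by
        rw [abs_mul]
        have := hL.dpar_le _ hx'
        have := hL.dpar_le _ h1
        gcongr
      _ = _ := by ring

lemma RenormSigns.exists_level {m : ℕ} {a : ℝ} (ha : -2 ≤ a) (hs : RenormSigns m a) :
    ∃ β g g' l r, RenormLevel a m β g g' l r := by
  suffices ∀ k ≤ m, ∃ β g g' l r, RenormLevel a k β g g' l r from this m le_rfl
  intro k
  induction k with
  | zero => exact fun _ => hs.exists_level_zero ha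
  | succ k ih =>
    intro hk
    obtain ⟨β, g, g', l, r, hL⟩ := ih (by omega)
    exact hL.exists_next hs hk

namespace RenormLevel

variable {a β l r : ℝ} {k : ℕ} {g g' : ℝ → ℝ}

lemma abs_iterate_le (hL : RenormLevel a k β g g' l r) {x : ℝ} (hx : |x| ≤ |β|) (n : ℕ) :
    |(fa a)^[2 ^ k * n] x| ≤ |β| := by
  induction n with
  | zero => simpa using hx
  | succ n ih =>
    rw [mul_add_one, add_comm, Function.iterate_add_apply]
    exact (hL.bounds ih).1

lemma abs_dpar_le (hL : RenormLevel a k β g g' l r) (n : ℕ) :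
    |dpar a (2 ^ k * n) 0| ≤ 401 ^ k * 401 ^ n := by
  induction n with
  | zero => simp [dpar]
  | succ n ih =>
    have h1 : |(fa a)^[2 ^ k * n] 0| ≤ |β| := hL.abs_iterate_le (by simp) n
    obtain ⟨-, h2, -⟩ := hL.bounds h1
    rw [mul_add_one, dpar_add]
    calc _ ≤ |dsp a (2 ^ k) ((fa a)^[2 ^ k * n] 0) * dpar a (2 ^ k * n) 0| +
          |dpar a (2 ^ k) ((fa a)^[2 ^ k * n] 0)| := abs_add_le _ _
      _ ≤ 400 * (401 ^ k * 401 ^ n) + 401 ^ k * 1 := by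
        rw [abs_mul, mul_one]
        have := hL.dpar_le _ h1
        gcongr
      _ ≤ 400 * (401 ^ k * 401 ^ n) + 401 ^ k * 401 ^ n := by
        gcongr
        exact one_le_pow₀ (by norm_num)
      _ = _ := by ring

lemma abs_iterate_sub_le (hL : RenormLevel a k β g g' l r) {x : ℝ} (hx : |x| ≤ |β|) (n : ℕ) :
    |(fa a)^[2 ^ k * (n + 1)] x - co a (2 ^ k * (n + 1))| ≤ 400 ^ n * (200 * 8 ^ k * x ^ 2) := by
  induction n with
  | zero => simpa [co] using (hL.bounds hx).2.2
  | succ n ih =>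
    rw [show 2 ^ k * (n + 1 + 1) = 2 ^ k + 2 ^ k * (n + 1) by ring, co_add,
      Function.iterate_add_apply]
    have h1 := hL.abs_iterate_le hx (n + 1)
    have h2 := hL.abs_iterate_le (x := 0) (by simp) (n + 1)
    have h3 := Convex.norm_image_sub_le_of_norm_hasDerivWithin_le
      (f := (fa a)^[2 ^ k]) (f' := dsp a (2 ^ k)) (C := 400) (s := Icc (-|β|) |β|)
      (fun x _ => (hasDerivAt_iterate a (2 ^ k) x).hasDerivWithinAt)
      (fun x hx => (hL.bounds (abs_le.2 hx)).2.1) (convex_Icc _ _) (abs_le.1 h2) (abs_le.1 h1)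
    refine h3.trans ?_
    rw [pow_succ', mul_assoc]
    gcongr
    exact ih

end RenormLevel

lemma sign_eq_of_ne_zero_on_Icc {g : ℝ → ℝ} (hg : Continuous g) {x y : ℝ} (hxy : x ≤ y)
    (hne : ∀ t ∈ Icc x y, g t ≠ 0) : SignType.sign (g y) = SignType.sign (g x) := by
  have hx := hne x (left_mem_Icc.2 hxy)
  have hy := hne y (right_mem_Icc.2 hxy)
  have hiv : (0 : ℝ) ∉ uIcc (g x) (g y) := fun h0 => by
    obtain ⟨t, ht, ht'⟩ := intermediate_value_uIcc hg.continuousOn h0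
    exact hne t (uIcc_of_le hxy ▸ ht) ht'
  rcases hx.lt_or_gt with hx | hx <;> rcases hy.lt_or_gt with hy | hy
  · rw [sign_neg hx, sign_neg hy]
  · exact absurd (mem_uIcc.2 (Or.inl ⟨hx.le, hy.le⟩)) hiv
  · exact absurd (mem_uIcc.2 (Or.inr ⟨hy.le, hx.le⟩)) hiv
  · rw [sign_pos hx, sign_pos hy]

lemma mul_pos_of_sign_eq {s x y : ℝ} (h : SignType.sign x = SignType.sign y) (hy : 0 < s * y) :
    0 < s * x := by
  rw [← sign_eq_one_iff, sign_mul] at hy ⊢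
  rw [h, hy]

lemma continuous_iterate_fa (p : ℕ) : Continuous fun z : ℝ × ℝ => (fa z.1)^[p] z.2 := by
  induction p with
  | zero => exact continuous_snd
  | succ p ih =>
    have : (fun z : ℝ × ℝ => (fa z.1)^[p + 1] z.2) = fun z => (fa z.1)^[p] z.2 ^ 2 + z.1 := by
      funext z
      rw [Function.iterate_succ_apply', fa]
    rw [this]
    fun_prop

/-- If an iterate maps a neighbourhood of the turning point into itself and away from the turning
point, then the turning point is not periodic. -/
lemma co_ne_zero_of_trap {a : ℝ} {p : ℕ}
    (ht : ∀ x, |x| ≤ 2 * |co a p| → |(fa a)^[p] x - co a p| < |co a p|) {q : ℕ} (hq : 1 ≤ q) :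
    co a q ≠ 0 := by
  have key : ∀ j, |co a (p * j)| ≤ 2 * |co a p| ∧ co a (p * (j + 1)) ≠ 0 := by
    have hstep : ∀ j, |co a (p * j)| ≤ 2 * |co a p| →
        |co a (p * (j + 1)) - co a p| < |co a p| := fun j hj => by
      have := ht _ hj
      rwa [← co_add, ← Nat.add_comm, ← mul_add_one] at this
    have hne : ∀ j, |co a (p * j)| ≤ 2 * |co a p| → co a (p * (j + 1)) ≠ 0 := fun j hj h => by
      have := hstep j hj
      rw [h, zero_sub, abs_neg] at this
      exact lt_irrefl _ this
    intro j
    induction j with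
    | zero =>
      have h1 : |co a (p * 0)| ≤ 2 * |co a p| := by simp [co_zero]
      exact ⟨h1, hne 0 h1⟩
    | succ j ih =>
      have h1 : |co a (p * (j + 1))| ≤ 2 * |co a p| := by
        have h2 := hstep j ih.1
        have h3 := abs_sub_abs_le_abs_sub (co a (p * (j + 1))) (co a p)
        linarith
      exact ⟨h1, hne _ h1⟩
  intro hq0
  obtain ⟨i, rfl⟩ := Nat.exists_eq_add_of_le' hq
  refine (key i).2 ?_
  have := iterate_mod_of_periodic (φ := fa a) (p := i + 1) hq0 (p * (i + 1))
  rw [Nat.mul_mod_left] at this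
  exact this

/-- Parameters near a center with periodic turning point are not centers. -/
lemma eventually_co_ne_zero {A : ℝ} {p : ℕ} (hp : 1 ≤ p) (h0 : co A p = 0)
    (hne : ∀ j, 1 ≤ j → j < p → co A j ≠ 0) :
    ∀ᶠ a in 𝓝 A, a ∈ Icc (-2 : ℝ) (1 / 4) → a ≠ A → ∀ q, 1 ≤ q → co a q ≠ 0 := by
  obtain ⟨N, rfl⟩ := Nat.exists_eq_add_of_le' hp
  have hev : ∀ᶠ a in 𝓝 A, |co a (N + 1)| < 1 / (4 * 4 ^ N) := by
    have h1 : Tendsto (fun a => |co a (N + 1)|) (𝓝 A) (𝓝 0) := by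
      simpa [h0] using ((continuous_co (N + 1)).tendsto A).abs
    exact h1.eventually (gt_mem_nhds (by positivity))
  have hs : ∀ᶠ a in 𝓝 A, ∀ j ∈ Ico 1 (N + 1), SignType.sign (co a j) = SignType.sign (co A j) :=
    (eventually_all_finite (finite_Ico _ _)).2 fun j hj =>
      eventually_sign_eq (continuous_co j) (hne j hj.1 hj.2)
  filter_upwards [hev, hs] with a ha hsa hI hA q hq
  have hc : co a (N + 1) ≠ 0 := fun hc =>
    hA (periodic_param_unique hp h0 hc hne fun j hj hj' => (hsa j ⟨hj, hj'⟩).symm).symm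
  rw [lt_div_iff₀ (by positivity)] at ha
  have hc' := abs_pos.2 hc
  have h4 : (1 : ℝ) ≤ 4 ^ N := one_le_pow₀ (by norm_num)
  refine co_ne_zero_of_trap (p := N + 1) (fun x hx => ?_) hq
  refine (abs_iterate_sub_le hI (by nlinarith) N).trans_lt ?_
  have h2 : x ^ 2 ≤ (2 * |co a (N + 1)|) ^ 2 := sq_le_sq' (by linarith [(abs_le.1 hx).1]) (abs_le.1 hx).2
  calc 4 ^ N * x ^ 2 ≤ 4 ^ N * (2 * |co a (N + 1)|) ^ 2 := by gcongr
    _ = |co a (N + 1)| * (|co a (N + 1)| * (4 * 4 ^ N)) := by ring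
    _ < |co a (N + 1)| * 1 := by gcongr
    _ = _ := mul_one _

/-- The critical orbit of `fa a` has the signs of that of `tm b`, where the latter is nonzero. -/
def SameSigns (a b : ℝ) : Prop :=
  ∀ j, ct b j ≠ 0 → SignType.sign (co a j) = SignType.sign (ct b j)

lemma SameSigns.ne_zero {a b : ℝ} (hs : SameSigns a b) {j : ℕ} (hj : ct b j ≠ 0) : co a j ≠ 0 := by
  rwa [← sign_ne_zero, hs j hj, sign_ne_zero]

lemma SameSigns.renormSigns {a b : ℝ} {m : ℕ} (hs : SameSigns a b) (hb : 1 < b)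
    (hbm : b ^ 2 ^ m < 2) : RenormSigns m a := by
  have key : ∀ {s : ℝ} {j : ℕ}, 0 < s * ct b j → 0 < s * co a j := fun h =>
    mul_pos_of_sign_eq (hs _ (right_ne_zero_of_mul h.ne')) h
  obtain ⟨h1, h2, h3⟩ := ct_signs m hb hbm
  exact ⟨fun k hk j hj => key (h1 k hk j hj), key h2, key h3⟩

/-- A limit of parameters with the sign pattern of `tm b` is again a center of period `p` only if
it is the original one. -/
lemma co_ne_zero_of_limit {a₀ A b : ℝ} {p : ℕ} (hb : 1 < b) (hp : 1 ≤ p) (h0 : ct b p = 0)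
    (hne : ∀ j, 1 ≤ j → j < p → ct b j ≠ 0) (ha₀ : -2 ≤ a₀) (ha₀A : a₀ < A) (hA : A < 1 / 4)
    (hs₀ : SameSigns a₀ b) (hc₀ : co a₀ p = 0) (hs : ∀ a ∈ Ico a₀ A, SameSigns a b) :
    co A p ≠ 0 := by
  intro hcA
  have hfreq : ∀ {P : ℝ → Prop}, (∀ᶠ a in 𝓝 A, P a) → ∃ a ∈ Ico a₀ A, P a := fun {P} hP => by
    have h1 : ∀ᶠ a in 𝓝[<] A, a ∈ Ico a₀ A := Ico_mem_nhdsLT ha₀A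
    exact (h1.and (hP.filter_mono nhdsWithin_le_nhds)).exists
  have hsA : ∀ j, ct b j ≠ 0 → co A j ≠ 0 →
      SignType.sign (co A j) = SignType.sign (ct b j) := fun j hj hj' => by
    obtain ⟨a, ha, hE⟩ := hfreq (eventually_sign_eq (continuous_co j) hj')
    rw [← hE, hs a ha j hj]
  have hex : ∃ q, 1 ≤ q ∧ co A q = 0 := ⟨p, hp, hcA⟩
  classical
  set q := Nat.find hex with hq
  obtain ⟨hq1, hq0⟩ : 1 ≤ q ∧ co A q = 0 := Nat.find_spec hex
  have hqmin : ∀ j, 1 ≤ j → j < q → co A j ≠ 0 := fun j hj hjq h =>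
    Nat.find_min hex hjq ⟨hj, h⟩
  have hmod : ∀ j, co A j = co A (j % q) := iterate_mod_of_periodic hq0
  have hqp : q ≤ p := Nat.find_min' hex ⟨hp, hcA⟩
  rcases hqp.lt_or_eq with hlt | heq
  · have hdvd : q ∣ p := by
      refine Nat.dvd_of_mod_eq_zero ?_
      by_contra hr
      exact hqmin _ (Nat.one_le_iff_ne_zero.2 hr) (Nat.mod_lt _ hq1) (hmod p ▸ hcA)
    obtain ⟨r, hr⟩ := hdvd
    have hr2 : 2 ≤ r := by
      by_contra! hcon
      interval_cases r <;> omega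
    have hren := ct_renormalization hb hq1 hr2 (by rw [mul_comm, ← hr, h0]) (hne q hq1 hlt)
      (hne _ (Nat.mul_pos (by omega) hq1) (by
        rw [hr, mul_comm q]
        exact Nat.mul_lt_mul_of_pos_right (by omega) hq1)) (fun j hj i hi hiq => by
        have hlt' : j * q + i < p := by
          rw [hr]
          nlinarith
        have e1 : co A (j * q + i) = co A i := by
          rw [hmod, Nat.mul_add_mod', Nat.mod_eq_of_lt hiq]
        have hi0 := hqmin i hi hiq
        rw [← hsA _ (hne _ (by omega) hlt') (e1 ▸ hi0), e1, hsA i (hne i hi (by omega)) hi0])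
    obtain ⟨a, ha, hE⟩ := hfreq (eventually_sign_co_mul hq0 1)
    have hE' := hE ⟨ha₀.trans ha.1, (ha.2.trans hA).le⟩
    rw [one_add_one_eq_two, hs a ha _ (left_ne_zero_of_mul hren.ne),
      hs a ha _ (right_ne_zero_of_mul hren.ne)] at hE'
    have hsq := sign_mul (ct b (2 * q)) (ct b q)
    rw [sign_neg hren, hE', ← sign_mul,
      sign_pos (mul_self_pos.2 (right_ne_zero_of_mul hren.ne))] at hsq
    exact absurd hsq (by decide)
  · refine ha₀A.ne (periodic_param_unique hp hc₀ hcA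
      (fun j hj hj' => hs₀.ne_zero (hne j hj hj')) fun j hj hj' => ?_)
    rw [hs₀ j (hne j hj hj'), hsA j (hne j hj hj') (hqmin j hj (heq ▸ hj'))]

lemma eventually_trap {A η : ℝ} {p : ℕ} (hη : |co A p| = η) (hη0 : 0 < η)
    (h : ∀ x, |x| ≤ 3 * η → |(fa A)^[p] x - co A p| < η) :
    ∀ᶠ a in 𝓝 A, ∀ q, 1 ≤ q → co a q ≠ 0 := by
  have hcont : Continuous fun z : ℝ × ℝ => |(fa z.1)^[p] z.2 - co z.1 p| - |co z.1 p| := by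
    have h1 := continuous_iterate_fa p
    have h2 := (continuous_co p).comp continuous_fst (X := ℝ × ℝ)
    exact (h1.sub h2).abs.sub h2.abs
  have hK : ∀ᶠ a in 𝓝 A, ∀ x ∈ Icc (-(3 * η)) (3 * η),
      |(fa a)^[p] x - co a p| - |co a p| < 0 := by
    refine isCompact_Icc.eventually_forall_of_forall_eventually fun x hx => ?_
    refine (hcont.tendsto (A, x)).eventually (gt_mem_nhds ?_)
    have := h x (abs_le.2 hx)
    simp only
    linarith
  have hc : ∀ᶠ a in 𝓝 A, |co a p| < 3 / 2 * η :=
    (continuous_co p).abs.continuousAt.eventually (gt_mem_nhds (by simp only [hη]; linarith))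
  filter_upwards [hK, hc] with a ha hca q hq
  refine co_ne_zero_of_trap (p := p) (fun x hx => ?_) hq
  have := ha x (abs_le.1 (hx.trans (by linarith)))
  linarith

lemma no_superstable_right {a₀ b : ℝ} {m n : ℕ} (hb : 1 < b) (hbm : b ^ 2 ^ m < 2)
    (h0 : ct b (2 ^ m * (n + 1)) = 0) (hne : ∀ j, 1 ≤ j → j < 2 ^ m * (n + 1) → ct b j ≠ 0)
    (ha₀ : a₀ ∈ Icc (-2 : ℝ) (-1)) (hs₀ : ∀ j, SignType.sign (co a₀ j) = SignType.sign (ct b j)) :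
    ∀ A ∈ Ioc a₀ (a₀ + 1 / (10 ^ 7) ^ (n + 1 + m)), ∀ q, 1 ≤ q → co A q ≠ 0 := by
  set p := 2 ^ m * (n + 1) with hp
  set δ : ℝ := 1 / (10 ^ 7) ^ (n + 1 + m) with hδ
  have hp1 : 1 ≤ p := Nat.mul_pos (by positivity) n.succ_pos
  have hδ1 : δ ≤ 1 := (div_le_one (by positivity)).2 (one_le_pow₀ (by norm_num))
  have hc₀ : co a₀ p = 0 := by rw [← sign_eq_zero_iff, hs₀, h0, sign_zero]
  by_contra! hcon
  obtain ⟨A₁, hA₁, q₁, hq₁, hz₁⟩ := hcon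
  set S := {a | a₀ < a ∧ ∃ q, 1 ≤ q ∧ co a q = 0} with hS
  have hA₁S : A₁ ∈ S := ⟨hA₁.1, q₁, hq₁, hz₁⟩
  have hSb : BddBelow S := ⟨a₀, fun a ha => ha.1.le⟩
  set A := sInf S with hAdef
  have hAA₁ : A ≤ A₁ := csInf_le hSb hA₁S
  have hfree : ∀ a, a₀ < a → a < A → ∀ q, 1 ≤ q → co a q ≠ 0 := fun a h1 h2 q hq hz =>
    notMem_of_lt_csInf h2 hSb ⟨h1, q, hq, hz⟩
  have hfreqS : ∃ᶠ a in 𝓝 A, a ∈ S := mem_closure_iff_frequently.1 (csInf_mem_closure ⟨A₁, hA₁S⟩ hSb)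
  have ha₀A : a₀ < A := by
    refine (le_csInf ⟨A₁, hA₁S⟩ fun a ha => ha.1.le).lt_of_ne fun he => ?_
    have hev := eventually_co_ne_zero hp1 hc₀ fun j hj hj' => by
      rw [← sign_ne_zero, hs₀, sign_ne_zero]
      exact hne j hj hj'
    have hlt : ∀ᶠ a in 𝓝 A, a < 1 / 4 := gt_mem_nhds (by linarith [ha₀.2])
    rw [he] at hev
    obtain ⟨a, ⟨h1, q, hq, hz⟩, h2, h3⟩ := (hfreqS.and_eventually (hev.and hlt)).exists
    exact h2 ⟨ha₀.1.trans h1.le, h3.le⟩ (he ▸ h1.ne') q hq hz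
  have hAδ : A - a₀ ≤ δ := by linarith [hA₁.2]
  have hA4 : A < 1 / 4 := by linarith [ha₀.2]
  have hsame : ∀ a ∈ Ico a₀ A, SameSigns a b := fun a ha j hj => by
    rw [← hs₀]
    refine sign_eq_of_ne_zero_on_Icc (continuous_co j) ha.1 fun t ht => ?_
    rcases ht.1.lt_or_eq with hlt | rfl
    · refine hfree t hlt (ht.2.trans_lt ha.2) j (Nat.one_le_iff_ne_zero.2 ?_)
      rintro rfl
      exact hj (ct_zero b)
    · rwa [← sign_ne_zero, hs₀, sign_ne_zero]
  have hlevel : ∀ a ∈ Ico a₀ A, ∃ β g g' l r, RenormLevel a m β g g' l r := fun a ha =>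
    ((hsame a ha).renormSigns hb hbm).exists_level (ha₀.1.trans ha.1)
  have hcA : co A p ≠ 0 := co_ne_zero_of_limit hb hp1 h0 hne ha₀.1 ha₀A hA4
    (fun j _ => hs₀ j) hc₀ hsame
  set K : ℝ := 160400 ^ (n + 1 + m) with hK
  have hKδ : 9 * K * δ ≤ 1 := by
    rw [hδ, mul_one_div, div_le_one (by positivity), hK, show n + 1 + m = n + m + 1 by ring,
      pow_succ, pow_succ ((10 : ℝ) ^ 7)]
    calc (9 : ℝ) * (160400 ^ (n + m) * 160400) = 160400 ^ (n + m) * 1443600 := by ring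
      _ ≤ (10 ^ 7) ^ (n + m) * 10 ^ 7 := by gcongr <;> norm_num
  have hη : |co A p| ≤ 401 ^ (n + 1 + m) * δ := by
    have h1 := norm_image_sub_le_of_norm_deriv_le_segment' (f := fun a => co a p)
      (f' := fun a => dpar a p 0) (C := 401 ^ (n + 1 + m)) (a := a₀) (b := A)
      (fun a _ => (hasDerivAt_iterate_param a p 0).hasDerivWithinAt) (fun a ha => by
        obtain ⟨β, g, g', l, r, hL⟩ := hlevel a ha
        rw [pow_add, mul_comm]
        exact hL.abs_dpar_le (n + 1)) A (right_mem_Icc.2 ha₀A.le)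
    simp only [hc₀, sub_zero] at h1
    exact h1.trans (by gcongr)
  have hquad : ∀ x, |x| ≤ 1 / 8 ^ m →
      |(fa A)^[p] x - co A p| ≤ 400 ^ n * (200 * 8 ^ m * x ^ 2) := fun x hx => by
    have h1 : Continuous fun a => |(fa a)^[p] x - co a p| :=
      (((continuous_iterate_fa p).comp (Continuous.prodMk_left x)).sub (continuous_co p)).abs
    refine le_of_tendsto ((h1.tendsto A).mono_left (nhdsWithin_le_nhds (s := Iio A))) ?_
    filter_upwards [Ico_mem_nhdsLT ha₀A] with a ha
    obtain ⟨β, g, g', l, r, hL⟩ := hlevel a ha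
    exact hL.abs_iterate_sub_le (hx.trans hL.le_abs) n
  set η := |co A p| with hηdef
  have hη0 : 0 < η := abs_pos.2 hcA
  have hKη : 9 * (400 ^ (n + 1) * 8 ^ m) * η ≤ 1 := by
    refine le_trans ?_ hKδ
    calc 9 * (400 ^ (n + 1) * 8 ^ m) * η
        ≤ 9 * (400 ^ (n + 1) * 400 ^ m) * (401 ^ (n + 1 + m) * δ) := by gcongr; norm_num
      _ = 9 * K * δ := by
        rw [← pow_add, hK, show (160400 : ℝ) = 400 * 401 by norm_num, mul_pow]
        ring
  have h8 : 3 * η ≤ 1 / 8 ^ m := by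
    rw [le_div_iff₀ (by positivity)]
    refine le_trans ?_ hKη
    have : (1 : ℝ) ≤ 400 ^ (n + 1) := one_le_pow₀ (by norm_num)
    calc 3 * η * 8 ^ m = 3 * (1 * 8 ^ m) * η := by ring
      _ ≤ 9 * (400 ^ (n + 1) * 8 ^ m) * η := by gcongr; norm_num
  have htrap := eventually_trap (A := A) (p := p) rfl hη0 fun x hx => by
    refine (hquad x (hx.trans h8)).trans_lt ?_
    have hx2 : x ^ 2 ≤ (3 * η) ^ 2 := sq_le_sq' (abs_le.1 hx).1 (abs_le.1 hx).2
    calc (400 : ℝ) ^ n * (200 * 8 ^ m * x ^ 2) ≤ 400 ^ n * (200 * 8 ^ m * (3 * η) ^ 2) := by gcongr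
      _ = 1 / 2 * (9 * (400 ^ (n + 1) * 8 ^ m) * η) * η := by ring
      _ ≤ 1 / 2 * 1 * η := by gcongr
      _ < η := by linarith
  obtain ⟨a, ⟨-, q, hq, hz⟩, ha⟩ := (hfreqS.and_eventually htrap).exists
  exact ha q hq hz

/-- Lemma: there is a uniform `ρ > 0` such that, whenever
`log b̂ ∈ (2^{−m−1} log 2, 2^{−m} log 2)` and `0` is periodic under `T_{b̂}` with minimal
period `2^m·n`, the set `h⁻¹({log b̂}) ⊆ [-2, 1/4]` is an interval of diameter at least
`exp(−(n+m)ρ)`. -/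
theorem entropy_level_set_interval_length :
    ∃ ρ : ℝ, 0 < ρ ∧ ∀ m n : ℕ, 1 ≤ n → ∀ b : ℝ, b ∈ Set.Ioc (1 : ℝ) 2 →
      Real.log b ∈ Set.Ioo (Real.log 2 / 2 ^ (m + 1)) (Real.log 2 / 2 ^ m) →
      (tent b)^[2 ^ m * n] 0 = 0 →
      (∀ j, 1 ≤ j → j < 2 ^ m * n → (tent b)^[j] 0 ≠ 0) →
      ({a ∈ Set.Icc (-2 : ℝ) (1 / 4) | h a = Real.log b}.OrdConnected ∧
        Real.exp (-((n + m : ℕ) : ℝ) * ρ) ≤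
          Metric.diam {a ∈ Set.Icc (-2 : ℝ) (1 / 4) | h a = Real.log b}) := by
  refine ⟨Real.log (10 ^ 7), Real.log_pos (by norm_num), fun m n hn b hb hlog hper hmin => ⟨⟨?_⟩, ?_⟩⟩
  · rintro x ⟨hx, hxb⟩ y ⟨hy, hyb⟩ z hz
    have hzI : z ∈ Icc (-2 : ℝ) (1 / 4) := ⟨hx.1.trans hz.1, hz.2.trans hy.2⟩
    exact ⟨hzI, ((h_antitoneOn hx hzI hz.1).trans_eq hxb).antisymm
      (hyb.symm.trans_le (h_antitoneOn hzI hy hz.2))⟩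
  · obtain ⟨n, rfl⟩ := Nat.exists_eq_add_of_le' hn
    have hb1 := hb.1
    simp only [tent_iterate_zero, neg_eq_zero, ne_eq] at hper hmin
    have hbm : b ^ 2 ^ m < 2 := by
      rw [← Real.log_lt_log_iff (by positivity) two_pos, Real.log_pow]
      have := (lt_div_iff₀ (by positivity)).1 hlog.2
      push_cast
      linarith
    have hp3 : 3 ≤ 2 ^ m * (n + 1) := by
      have hpos : 0 < 2 ^ m * (n + 1) := by positivity
      by_contra! hcon
      obtain h1 | h2 : 2 ^ m * (n + 1) = 1 ∨ 2 ^ m * (n + 1) = 2 := by omega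
      · rw [h1, ct_one] at hper
        norm_num at hper
      · rw [h2, ct_succ, ct_one, abs_neg, abs_one] at hper
        linarith
    obtain ⟨a₀, ha₀, hs, hh⟩ := exists_center hb1 hb.2 hp3 hper hmin
    set δ : ℝ := 1 / (10 ^ 7) ^ (n + 1 + m) with hδ
    have hδ0 : 0 < δ := by positivity
    have hδ1 : δ ≤ 1 := (div_le_one (by positivity)).2 (one_le_pow₀ (by norm_num))
    have hno := no_superstable_right hb1 hbm hper hmin ha₀ hs
    have hI₀ : a₀ ∈ Icc (-2 : ℝ) (1 / 4) := ⟨ha₀.1, by linarith [ha₀.2]⟩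
    have hI₁ : a₀ + δ ∈ Icc (-2 : ℝ) (1 / 4) := ⟨by linarith [ha₀.1], by linarith [ha₀.2]⟩
    have hh₁ : h (a₀ + δ) = Real.log b := by
      rw [← hh, h_eq_growth hI₀, h_eq_growth hI₁]
      simp only [growth, nz_fa_eq_of_no_superstable (le_add_of_nonneg_right hδ0.le) hno]
    have hbdd : Bornology.IsBounded {a ∈ Icc (-2 : ℝ) (1 / 4) | h a = Real.log b} :=
      (Metric.isBounded_Icc _ _).subset (sep_subset _ _)
    calc Real.exp (-((n + 1 + m : ℕ) : ℝ) * Real.log (10 ^ 7)) = δ := by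
          rw [neg_mul, Real.exp_neg, ← Real.log_pow, Real.exp_log (by positivity), hδ, one_div]
      _ = dist (a₀ + δ) a₀ := by rw [Real.dist_eq, add_sub_cancel_left, abs_of_pos hδ0]
      _ ≤ _ := Metric.dist_le_diam_of_mem hbdd ⟨hI₁, hh₁⟩ ⟨hI₀, hh⟩
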